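/- arXiv:2510.10856 — 13 statements merged into one kernel-verified Lean document; each statement's English description precedes it below -/
import Mathlib

section
/- Fix a measurable ξ : [0,T] → [−1,1], y₀ ∈ ℝ, and t ∈ [0,T]. (i) For any two piecewise-constant decision triples (x⁰, x↑, x↓) and (x⁰′, x↑′, x↓′) with x↑_k, x↓_k, x↑′_k, x↓′_k ≥ 0 and any θ ∈ [0,1], y(θ·x⁰ + (1−θ)·x⁰′, θ·x↑ + (1−θ)·x↑′, θ·x↓ + (1−θ)·x↓′, ξ, y₀, t) ≥ θ·y(x⁰, x↑, x↓, ξ, y₀, t) + (1−θ)·y(x⁰′, x↑′, x↓′, ξ, y₀, t). (ii) y is nonincreasing in x⁰ and in x↑ and nondecreasing in x↓ under the pointwise ordering of the decision functions; moreover, if t > 0 and x⁰(τ) < x⁰′(τ) for all τ ∈ [0, t), then y(x⁰, x↑, x↓, ξ, y₀, t) > y(x⁰′, x↑, x↓, ξ, y₀, t). -/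
open MeasureTheory

/-- Power output: `x(x⁰, x↑, x↓, ξ) = x⁰ + [ξ]⁺·x↑ − [ξ]⁻·x↓`. -/
def power (x0 xu xd ξ : ℝ) : ℝ := x0 + max ξ 0 * xu - max (-ξ) 0 * xd

/-- State of charge:
`y(x⁰, x↑, x↓, ξ, y₀, t) = y₀ + ∫₀ᵗ (ηc·[x(τ)]⁻ − (1/ηd)·[x(τ)]⁺) dτ`. -/
noncomputable def soc (ηc ηd : ℝ) (f0 fu fd ξ : ℝ → ℝ) (y0 t : ℝ) : ℝ :=
  y0 + ∫ τ in (0:ℝ)..t,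
    (ηc * max (-(power (f0 τ) (fu τ) (fd τ) (ξ τ))) 0
      - (1/ηd) * max (power (f0 τ) (fu τ) (fd τ) (ξ τ)) 0)

/-- `f` is piecewise constant with (1-indexed) values `v k` on the `K` trading
intervals `𝒯_k = [(k−1)·Δt, k·Δt)` (with the endpoint `T = K·Δt` included in `𝒯_K`). -/
def IsPC (Δt : ℝ) (K : ℕ) (v : ℕ → ℝ) (f : ℝ → ℝ) : Prop :=
  (∀ k : ℕ, 1 ≤ k → k ≤ K →
    ∀ τ ∈ Set.Ico (((k : ℝ) - 1) * Δt) ((k : ℝ) * Δt), f τ = v k) ∧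
  f ((K : ℝ) * Δt) = v K

/-- Membership in the uncertainty set
`Ξ = {ξ : [0,T] → [−1,1] measurable, ∫₀ᵀ |ξ| ≤ γ}`. -/
def memXi (T γ : ℝ) (ξ : ℝ → ℝ) : Prop :=
  Measurable ξ ∧ (∀ t, ξ t ∈ Set.Icc (-1:ℝ) 1) ∧ (∫ t in (0:ℝ)..T, |ξ t|) ≤ γ

/-- Rate of change of the state of charge as a function of the power output. -/
noncomputable def rate (ηc ηd p : ℝ) : ℝ := ηc * max (-p) 0 - (1/ηd) * max p 0

lemma rate_eq_min {ηc ηd : ℝ} (hηc : ηc ∈ Set.Ioo (0:ℝ) 1) (hηd : ηd ∈ Set.Ioo (0:ℝ) 1)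
    (p : ℝ) : rate ηc ηd p = min (-(ηc * p)) (-((1/ηd) * p)) := by
  have h1 : 1 < 1/ηd := by rw [lt_div_iff₀ hηd.1]; linarith [hηd.2]
  have h2 := hηc.2
  unfold rate
  rcases le_total 0 p with hp | hp
  · rw [max_eq_right (by linarith), max_eq_left hp, min_eq_right (by nlinarith)]; ring
  · rw [max_eq_left (by linarith), max_eq_right hp, min_eq_left (by nlinarith)]; ring

lemma rate_strictAnti {ηc ηd : ℝ} (hηc : ηc ∈ Set.Ioo (0:ℝ) 1) (hηd : ηd ∈ Set.Ioo (0:ℝ) 1) :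
    StrictAnti (rate ηc ηd) := by
  intro p q hpq
  rw [rate_eq_min hηc hηd, rate_eq_min hηc hηd]
  have h1 : 0 < 1/ηd := one_div_pos.2 hηd.1
  have h2 := hηc.1
  exact min_lt_min (by nlinarith) (by nlinarith)

lemma rate_concave {ηc ηd : ℝ} (hηc : ηc ∈ Set.Ioo (0:ℝ) 1) (hηd : ηd ∈ Set.Ioo (0:ℝ) 1)
    {θ : ℝ} (hθ : θ ∈ Set.Icc (0:ℝ) 1) (p q : ℝ) :
    θ * rate ηc ηd p + (1 - θ) * rate ηc ηd q ≤ rate ηc ηd (θ * p + (1 - θ) * q) := by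
  simp only [rate_eq_min hηc hηd]
  have h0 := hθ.1
  have h1 : 0 ≤ 1 - θ := by linarith [hθ.2]
  refine le_min ?_ ?_
  · have a := mul_le_mul_of_nonneg_left (min_le_left (-(ηc * p)) (-((1/ηd) * p))) h0
    have b := mul_le_mul_of_nonneg_left (min_le_left (-(ηc * q)) (-((1/ηd) * q))) h1
    linarith
  · have a := mul_le_mul_of_nonneg_left (min_le_right (-(ηc * p)) (-((1/ηd) * p))) h0
    have b := mul_le_mul_of_nonneg_left (min_le_right (-(ηc * q)) (-((1/ηd) * q))) h1
    linarith

lemma IsPC.intervalIntegrable {Δt : ℝ} (hΔt : 0 < Δt) {K : ℕ} {v : ℕ → ℝ} {f : ℝ → ℝ}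
    (h : IsPC Δt K v f) {t : ℝ} (ht : t ∈ Set.Icc (0:ℝ) ((K : ℝ) * Δt)) :
    IntervalIntegrable f volume 0 t := by
  have key : ∀ n : ℕ, n ≤ K → IntegrableOn f (Set.Ico 0 ((n : ℝ) * Δt)) := by
    intro n
    induction n with
    | zero => intro _; simp
    | succ n ih =>
      intro hn
      have e : Set.Ico 0 (((n + 1 : ℕ) : ℝ) * Δt)
          = Set.Ico 0 ((n : ℝ) * Δt) ∪ Set.Ico ((n : ℝ) * Δt) (((n + 1 : ℕ) : ℝ) * Δt) := by
        rw [Set.Ico_union_Ico_eq_Ico (by positivity)]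
        push_cast; nlinarith
      rw [e]
      refine (ih (by omega)).union ?_
      have hc : IntegrableOn (fun _ : ℝ => v (n+1))
          (Set.Ico ((n : ℝ) * Δt) (((n + 1 : ℕ) : ℝ) * Δt)) := integrableOn_const (by simp)
      refine hc.congr_fun ?_ measurableSet_Ico
      intro τ hτ
      refine (h.1 (n+1) (by omega) hn τ ?_).symm
      simpa using hτ
  rw [intervalIntegrable_iff_integrableOn_Ico_of_le ht.1]
  exact (key K le_rfl).mono_set (Set.Ico_subset_Ico_right ht.2)

lemma power_integrable {f0 fu fd ξ : ℝ → ℝ} {t : ℝ} (ht : 0 ≤ t) (hξm : Measurable ξ)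
    (hξb : ∀ τ, ξ τ ∈ Set.Icc (-1:ℝ) 1)
    (h0 : IntervalIntegrable f0 volume 0 t) (hu : IntervalIntegrable fu volume 0 t)
    (hd : IntervalIntegrable fd volume 0 t) :
    IntervalIntegrable (fun τ => power (f0 τ) (fu τ) (fd τ) (ξ τ)) volume 0 t := by
  rw [intervalIntegrable_iff_integrableOn_Ioc_of_le ht] at *
  unfold power
  refine (Integrable.add h0 ?_).sub ?_
  · refine Integrable.bdd_mul (c := 1) hu (by fun_prop) (Filter.Eventually.of_forall ?_)
    intro τ
    have := hξb τ
    rw [Real.norm_of_nonneg (le_max_right _ _)]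
    exact max_le this.2 zero_le_one
  · refine Integrable.bdd_mul (c := 1) hd (by fun_prop) (Filter.Eventually.of_forall ?_)
    intro τ
    have := hξb τ
    rw [Real.norm_of_nonneg (le_max_right _ _)]
    exact max_le (by linarith [this.1]) zero_le_one

lemma rate_integrable (ηc ηd : ℝ) {p : ℝ → ℝ} {t : ℝ} (ht : 0 ≤ t)
    (hp : IntervalIntegrable p volume 0 t) :
    IntervalIntegrable (fun τ => rate ηc ηd (p τ)) volume 0 t := by
  rw [intervalIntegrable_iff_integrableOn_Ioc_of_le ht] at *
  unfold rate
  exact ((Integrable.neg_part hp).const_mul _).sub ((Integrable.pos_part hp).const_mul _)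

/-- for fixed `ξ`, `y₀`, `t`, the state of charge is concave in the
piecewise-constant market decisions `(x⁰, x↑, x↓)`, nonincreasing in `x⁰` and `x↑`,
nondecreasing in `x↓`, and strictly decreasing in `x⁰` when `t > 0`. -/
theorem statement1 (Δt : ℝ) (hΔt : 0 < Δt) (K : ℕ) (hK : 0 < K)
    (ηc ηd : ℝ) (hηc : ηc ∈ Set.Ioo (0:ℝ) 1) (hηd : ηd ∈ Set.Ioo (0:ℝ) 1)
    (ξ : ℝ → ℝ) (hξm : Measurable ξ) (hξb : ∀ τ, ξ τ ∈ Set.Icc (-1:ℝ) 1)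
    (y0 t : ℝ) (ht : t ∈ Set.Icc (0:ℝ) ((K : ℝ) * Δt)) :
    -- (i) concavity in the market decisions
    (∀ (x0 xu xd x0' xu' xd' : ℕ → ℝ) (f0 fu fd f0' fu' fd' : ℝ → ℝ),
      (∀ k, 1 ≤ k → k ≤ K → 0 ≤ xu k ∧ 0 ≤ xd k ∧ 0 ≤ xu' k ∧ 0 ≤ xd' k) →
      IsPC Δt K x0 f0 → IsPC Δt K xu fu → IsPC Δt K xd fd →
      IsPC Δt K x0' f0' → IsPC Δt K xu' fu' → IsPC Δt K xd' fd' →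
      ∀ θ ∈ Set.Icc (0:ℝ) 1,
        θ * soc ηc ηd f0 fu fd ξ y0 t + (1 - θ) * soc ηc ηd f0' fu' fd' ξ y0 t ≤
          soc ηc ηd (fun τ => θ * f0 τ + (1 - θ) * f0' τ)
            (fun τ => θ * fu τ + (1 - θ) * fu' τ)
            (fun τ => θ * fd τ + (1 - θ) * fd' τ) ξ y0 t) ∧
    -- (ii) monotonicity in the market decisions
    (∀ (x0 xu xd x0' xu' xd' : ℕ → ℝ) (f0 fu fd f0' fu' fd' : ℝ → ℝ),
      (∀ k, 1 ≤ k → k ≤ K → 0 ≤ xu k ∧ 0 ≤ xd k ∧ 0 ≤ xu' k ∧ 0 ≤ xd' k) →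
      IsPC Δt K x0 f0 → IsPC Δt K xu fu → IsPC Δt K xd fd →
      IsPC Δt K x0' f0' → IsPC Δt K xu' fu' → IsPC Δt K xd' fd' →
      ((∀ τ, f0 τ ≤ f0' τ) →
        soc ηc ηd f0' fu fd ξ y0 t ≤ soc ηc ηd f0 fu fd ξ y0 t) ∧
      ((∀ τ, fu τ ≤ fu' τ) →
        soc ηc ηd f0 fu' fd ξ y0 t ≤ soc ηc ηd f0 fu fd ξ y0 t) ∧
      ((∀ τ, fd τ ≤ fd' τ) →
        soc ηc ηd f0 fu fd ξ y0 t ≤ soc ηc ηd f0 fu fd' ξ y0 t) ∧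
      (0 < t → (∀ τ ∈ Set.Ico (0:ℝ) t, f0 τ < f0' τ) →
        soc ηc ηd f0' fu fd ξ y0 t < soc ηc ηd f0 fu fd ξ y0 t)) := by
  have hI : ∀ {v0 vu vd : ℕ → ℝ} {f0 fu fd : ℝ → ℝ}, IsPC Δt K v0 f0 → IsPC Δt K vu fu →
      IsPC Δt K vd fd → IntervalIntegrable
        (fun τ => rate ηc ηd (power (f0 τ) (fu τ) (fd τ) (ξ τ))) volume 0 t :=
    fun h0 hu hd => rate_integrable ηc ηd ht.1 (power_integrable ht.1 hξm hξb
      (h0.intervalIntegrable hΔt ht) (hu.intervalIntegrable hΔt ht)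
      (hd.intervalIntegrable hΔt ht))
  have hS : ∀ f0 fu fd : ℝ → ℝ, soc ηc ηd f0 fu fd ξ y0 t =
      y0 + ∫ τ in (0:ℝ)..t, rate ηc ηd (power (f0 τ) (fu τ) (fd τ) (ξ τ)) :=
    fun _ _ _ => rfl
  have hanti := rate_strictAnti hηc hηd
  refine ⟨?_, ?_⟩
  · intro x0 xu xd x0' xu' xd' f0 fu fd f0' fu' fd' _ h0 hu hd h0' hu' hd' θ hθ
    have comb : ∀ {f f' : ℝ → ℝ} {v v' : ℕ → ℝ}, IsPC Δt K v f → IsPC Δt K v' f' →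
        IsPC Δt K (fun k => θ * v k + (1 - θ) * v' k) (fun τ => θ * f τ + (1 - θ) * f' τ) := by
      intro f f' v v' h h'
      refine ⟨fun k h1 h2 τ hτ => ?_, ?_⟩
      · simp only [h.1 k h1 h2 τ hτ, h'.1 k h1 h2 τ hτ]
      · simp only [h.2, h'.2]
    have i1 := hI h0 hu hd
    have i2 := hI h0' hu' hd'
    have i3 := hI (comb h0 h0') (comb hu hu') (comb hd hd')
    have := intervalIntegral.integral_mono_on ht.1
      ((i1.const_mul θ).add (i2.const_mul (1 - θ))) i3 (fun τ _ => by
        refine (rate_concave hηc hηd hθ _ _).trans (le_of_eq ?_)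
        congr 1
        unfold power
        ring)
    rw [intervalIntegral.integral_add (i1.const_mul θ) (i2.const_mul (1 - θ)),
      intervalIntegral.integral_const_mul, intervalIntegral.integral_const_mul] at this
    rw [hS, hS, hS]
    linarith
  · intro x0 xu xd x0' xu' xd' f0 fu fd f0' fu' fd' _ h0 hu hd h0' hu' hd'
    have i := hI h0 hu hd
    simp only [hS]
    refine ⟨fun hle => ?_, fun hle => ?_, fun hle => ?_, fun htpos hlt => ?_⟩
    · refine add_le_add_right (intervalIntegral.integral_mono_on ht.1 (hI h0' hu hd) i
        fun τ _ => hanti.antitone ?_) _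
      unfold power
      linarith [hle τ]
    · refine add_le_add_right (intervalIntegral.integral_mono_on ht.1 (hI h0 hu' hd) i
        fun τ _ => hanti.antitone ?_) _
      unfold power
      have := mul_le_mul_of_nonneg_left (hle τ) (le_max_right (ξ τ) 0)
      linarith
    · refine add_le_add_right (intervalIntegral.integral_mono_on ht.1 i (hI h0 hu hd')
        fun τ _ => hanti.antitone ?_) _
      unfold power
      have := mul_le_mul_of_nonneg_left (hle τ) (le_max_right (-ξ τ) 0)
      linarith
    · have i' := hI h0' hu hd
      have := intervalIntegral.intervalIntegral_pos_of_pos_on (i.sub i') (fun τ hτ => by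
        refine sub_pos.2 (hanti ?_)
        unfold power
        linarith [hlt τ ⟨hτ.1.le, hτ.2⟩]) htpos
      rw [intervalIntegral.integral_sub i i'] at this
      linarith
end

section
/- Let x⁰, x↑, x↓ be piecewise-constant market decisions with x↑_k ≥ 0 and x↓_k ≥ 0 for all k, and fix y₀ ∈ ℝ. If ξ₁, ξ₂ : [0,T] → [−1,1] are measurable with ξ₁(τ) ≤ ξ₂(τ) for all τ ∈ [0,T], then y(x⁰, x↑, x↓, ξ₂, y₀, t) ≤ y(x⁰, x↑, x↓, ξ₁, y₀, t) for every t ∈ [0,T]. -/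
open MeasureTheory

lemma isPC_rep (Δt : ℝ) (hΔt : 0 < Δt) (K : ℕ) (hK : 0 < K) (v : ℕ → ℝ) (f : ℝ → ℝ)
    (hf : IsPC Δt K v f) (τ : ℝ) (hτ : τ ∈ Set.Icc (0:ℝ) ((K : ℝ) * Δt)) :
    f τ = v (min K (⌊τ / Δt⌋₊ + 1)) := by
  obtain ⟨h1, h2⟩ := hf
  rcases eq_or_lt_of_le hτ.2 with h | h
  · subst h
    rw [h2, mul_div_cancel_right₀ _ hΔt.ne', Nat.floor_natCast, min_eq_left (Nat.le_succ K)]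
  · have hd : 0 ≤ τ / Δt := div_nonneg hτ.1 hΔt.le
    have hlt : ⌊τ / Δt⌋₊ < K := (Nat.floor_lt hd).2 ((div_lt_iff₀ hΔt).2 h)
    rw [min_eq_right hlt]
    refine h1 _ (by omega) hlt τ ⟨?_, ?_⟩
    · have := Nat.floor_le hd
      rw [le_div_iff₀ hΔt] at this
      push_cast
      linarith
    · have := Nat.lt_floor_add_one (τ / Δt)
      rw [div_lt_iff₀ hΔt] at this
      push_cast
      linarith

lemma rep_measurable (Δt : ℝ) (K : ℕ) (v : ℕ → ℝ) :
    Measurable (fun τ : ℝ => v (min K (⌊τ / Δt⌋₊ + 1))) := by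
  have h : Measurable (fun τ : ℝ => ⌊τ / Δt⌋₊) :=
    Nat.measurable_floor.comp (measurable_id.div_const Δt)
  exact (measurable_from_top (f := fun n : ℕ => v (min K (n + 1)))).comp h

lemma rep_bound (K : ℕ) (v : ℕ → ℝ) (n : ℕ) :
    |v (min K n)| ≤ ∑ k ∈ Finset.range (K + 1), |v k| := by
  refine Finset.single_le_sum (f := fun k => |v k|) (fun i _ => abs_nonneg _) ?_
  simp

lemma power_integrable_s2 (Δt : ℝ) (hΔt : 0 < Δt) (K : ℕ) (hK : 0 < K)
    (ηc ηd : ℝ) (x0 xu xd : ℕ → ℝ) (f0 fu fd : ℝ → ℝ)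
    (hf0 : IsPC Δt K x0 f0) (hfu : IsPC Δt K xu fu) (hfd : IsPC Δt K xd fd)
    (ξ : ℝ → ℝ) (hm : Measurable ξ) (hb : ∀ τ, ξ τ ∈ Set.Icc (-1:ℝ) 1)
    (t : ℝ) (ht : t ∈ Set.Icc (0:ℝ) ((K : ℝ) * Δt)) :
    IntervalIntegrable (fun τ => ηc * max (-(power (f0 τ) (fu τ) (fd τ) (ξ τ))) 0
      - (1/ηd) * max (power (f0 τ) (fu τ) (fd τ) (ξ τ)) 0) volume 0 t := by
  rw [intervalIntegrable_iff_integrableOn_Ioc_of_le ht.1]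
  have hp : IntegrableOn (fun τ => power (f0 τ) (fu τ) (fd τ) (ξ τ)) (Set.Ioc 0 t) volume := by
    have hg : IntegrableOn (fun τ => power (x0 (min K (⌊τ / Δt⌋₊ + 1)))
        (xu (min K (⌊τ / Δt⌋₊ + 1))) (xd (min K (⌊τ / Δt⌋₊ + 1))) (ξ τ)) (Set.Ioc 0 t) volume := by
      refine Measure.integrableOn_of_bounded
        (M := (∑ k ∈ Finset.range (K + 1), |x0 k|) + (∑ k ∈ Finset.range (K + 1), |xu k|)
          + ∑ k ∈ Finset.range (K + 1), |xd k|) (by simp) ?_ ?_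
      · unfold power
        exact (((rep_measurable Δt K x0).add
          ((hm.max measurable_const).mul (rep_measurable Δt K xu))).sub
          ((hm.neg.max measurable_const).mul (rep_measurable Δt K xd))).aestronglyMeasurable
      · refine Filter.Eventually.of_forall fun τ => ?_
        have b0 := rep_bound K x0 (⌊τ / Δt⌋₊ + 1)
        have bu := rep_bound K xu (⌊τ / Δt⌋₊ + 1)
        have bd := rep_bound K xd (⌊τ / Δt⌋₊ + 1)
        have key : ∀ c x : ℝ, 0 ≤ c → c ≤ 1 → |c * x| ≤ |x| := fun c x h0 h1 => by
          rw [abs_mul, abs_of_nonneg h0]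
          exact mul_le_of_le_one_left (abs_nonneg x) h1
        have cu := key (max (ξ τ) 0) (xu (min K (⌊τ / Δt⌋₊ + 1))) (le_max_right _ _)
          (max_le (hb τ).2 zero_le_one)
        have cd := key (max (-ξ τ) 0) (xd (min K (⌊τ / Δt⌋₊ + 1))) (le_max_right _ _)
          (max_le (by linarith [(hb τ).1]) zero_le_one)
        rw [Real.norm_eq_abs]
        unfold power
        refine (abs_sub _ _).trans (add_le_add ((abs_add_le _ _).trans
          (add_le_add b0 (cu.trans bu))) (cd.trans bd))
    refine hg.congr_fun (fun τ hτ => ?_) measurableSet_Ioc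
    have hτ' : τ ∈ Set.Icc (0:ℝ) ((K : ℝ) * Δt) := ⟨hτ.1.le, hτ.2.trans ht.2⟩
    simp only
    rw [isPC_rep Δt hΔt K hK x0 f0 hf0 τ hτ', isPC_rep Δt hΔt K hK xu fu hfu τ hτ',
      isPC_rep Δt hΔt K hK xd fd hfd τ hτ']
  exact (hp.neg.pos_part.const_mul ηc).sub (hp.pos_part.const_mul (1/ηd))

/-- the state of charge is nonincreasing in the regulation signal:
if `ξ₁ ≤ ξ₂` pointwise then `y(·, ξ₂, ·) ≤ y(·, ξ₁, ·)` at every time `t ∈ [0,T]`. -/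
theorem statement2 (Δt : ℝ) (hΔt : 0 < Δt) (K : ℕ) (hK : 0 < K)
    (ηc ηd : ℝ) (hηc : ηc ∈ Set.Ioo (0:ℝ) 1) (hηd : ηd ∈ Set.Ioo (0:ℝ) 1)
    (x0 xu xd : ℕ → ℝ) (f0 fu fd : ℝ → ℝ)
    (hpos : ∀ k, 1 ≤ k → k ≤ K → 0 ≤ xu k ∧ 0 ≤ xd k)
    (hf0 : IsPC Δt K x0 f0) (hfu : IsPC Δt K xu fu) (hfd : IsPC Δt K xd fd)
    (y0 : ℝ) (ξ₁ ξ₂ : ℝ → ℝ)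
    (hξ₁m : Measurable ξ₁) (hξ₂m : Measurable ξ₂)
    (hξ₁b : ∀ τ, ξ₁ τ ∈ Set.Icc (-1:ℝ) 1) (hξ₂b : ∀ τ, ξ₂ τ ∈ Set.Icc (-1:ℝ) 1)
    (hle : ∀ τ, ξ₁ τ ≤ ξ₂ τ) :
    ∀ t ∈ Set.Icc (0:ℝ) ((K : ℝ) * Δt),
      soc ηc ηd f0 fu fd ξ₂ y0 t ≤ soc ηc ηd f0 fu fd ξ₁ y0 t := by
  intro t ht
  unfold soc
  have hi := fun ξ hm hb => power_integrable_s2 Δt hΔt K hK ηc ηd x0 xu xd f0 fu fd hf0 hfu hfd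
    ξ hm hb t ht
  refine add_le_add le_rfl (intervalIntegral.integral_mono_on ht.1 (hi ξ₂ hξ₂m hξ₂b)
    (hi ξ₁ hξ₁m hξ₁b) fun τ hτ => ?_)
  have hτ' : τ ∈ Set.Icc (0:ℝ) ((K : ℝ) * Δt) := ⟨hτ.1, hτ.2.trans ht.2⟩
  have hk := hpos (min K (⌊τ / Δt⌋₊ + 1)) (by omega) (min_le_left _ _)
  rw [← isPC_rep Δt hΔt K hK xu fu hfu τ hτ', ← isPC_rep Δt hΔt K hK xd fd hfd τ hτ'] at hk
  have hP : power (f0 τ) (fu τ) (fd τ) (ξ₁ τ) ≤ power (f0 τ) (fu τ) (fd τ) (ξ₂ τ) := by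
    unfold power
    have h1 := mul_le_mul_of_nonneg_right (max_le_max_right 0 (hle τ)) hk.1
    have h2 := mul_le_mul_of_nonneg_right (max_le_max_right 0 (neg_le_neg (hle τ))) hk.2
    linarith
  have hd : 0 ≤ 1 / ηd := one_div_nonneg.2 hηd.1.le
  exact sub_le_sub
    (mul_le_mul_of_nonneg_left (max_le_max_right 0 (neg_le_neg hP)) hηc.1.le)
    (mul_le_mul_of_nonneg_left (max_le_max_right 0 hP) hd)
end

section
/- For every k ∈ {1,…,K}, every t ∈ 𝒯_k, and every ξ ∈ Ξ⁺, the function L_t(L_t† ξ) belongs to Ξ⁺, i.e., it takes values in [0,1] and its integral over [0,T] is at most γ. -/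
open MeasureTheory

/-- Membership in the nonnegative uncertainty set
`Ξ⁺ = {ξ : [0,T] → [0,1] measurable, ∫₀ᵀ |ξ| ≤ γ}`. -/
def memXiPlus (T γ : ℝ) (ξ : ℝ → ℝ) : Prop :=
  Measurable ξ ∧ (∀ t, ξ t ∈ Set.Icc (0:ℝ) 1) ∧ (∫ t in (0:ℝ)..T, |ξ t|) ≤ γ

/-- The time constants `σ_l(t)` for `t` in the (0-indexed) `k`-th trading interval:
`σ_l(t) = Δt` for `l < k`, `σ_k(t) = t − k·Δt`, and `σ_l(t) = 0` for `l > k`. -/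
noncomputable def sigmaT (Δt t : ℝ) (k l : ℕ) : ℝ :=
  if l < k then Δt else if l = k then t - (k : ℝ) * Δt else 0

open Classical in
/-- The lifting operator `L_t`: `(L_t v)(τ)` equals the entry of `v` indexing the
trading interval containing `τ` for `τ ∈ [0, t)`, and `0` for `τ ∉ [0, t)`. -/
noncomputable def lift (Δt : ℝ) (K : ℕ) (t : ℝ) (v : Fin K → ℝ) : ℝ → ℝ :=
  fun τ =>
    if h : 0 ≤ τ ∧ τ < t ∧ (⌊τ / Δt⌋).toNat < K then v ⟨(⌊τ / Δt⌋).toNat, h.2.2⟩ else 0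

open Classical in
/-- The scaled adjoint operator `L_t†` (for `t` in the 0-indexed `k`-th interval):
`(L_t† w)_l = (1/σ_l(t))·∫_{l·Δt}^{min{(l+1)·Δt, t}} w(τ) dτ` when `σ_l(t) > 0`
and `(L_t† w)_l = 0` when `σ_l(t) ≤ 0`. -/
noncomputable def adj (Δt : ℝ) (K : ℕ) (k : ℕ) (t : ℝ) (w : ℝ → ℝ) : Fin K → ℝ :=
  fun l =>
    if 0 < sigmaT Δt t k l.val then
      (1 / sigmaT Δt t k l.val) *
        ∫ τ in ((l.val : ℝ) * Δt)..(min (((l.val : ℝ) + 1) * Δt) t), w τ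
    else 0

theorem sigma_eq (Δt t : ℝ) (k l : ℕ) (hΔt : 0 < Δt) (h1 : (k : ℝ) * Δt ≤ t)
    (h2 : t ≤ ((k : ℝ) + 1) * Δt) (hl : l ≤ k) :
    sigmaT Δt t k l = min (((l : ℝ) + 1) * Δt) t - (l : ℝ) * Δt := by
  unfold sigmaT
  rcases hl.lt_or_eq with h | h
  · have h3 : ((l : ℝ) + 1) ≤ k := by exact_mod_cast h
    have h4 : ((l : ℝ) + 1) * Δt ≤ t := le_trans (by gcongr) h1
    rw [if_pos h, min_eq_left h4]
    ring
  · subst h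
    rw [if_neg (lt_irrefl _), if_pos rfl, min_eq_right h2]

theorem xi_integrable (ξ : ℝ → ℝ) (hm : Measurable ξ) (hb : ∀ t, ξ t ∈ Set.Icc (0:ℝ) 1)
    (a b : ℝ) : IntervalIntegrable ξ volume a b := by
  refine (intervalIntegrable_const (c := (1:ℝ))).mono_fun hm.aestronglyMeasurable ?_
  refine Filter.Eventually.of_forall fun x => ?_
  have := hb x
  simp only [Real.norm_eq_abs, abs_one]
  rw [abs_of_nonneg this.1]
  exact this.2

theorem adj_mem (Δt : ℝ) (hΔt : 0 < Δt) (K k : ℕ) (t : ℝ) (h1 : (k : ℝ) * Δt ≤ t)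
    (h2 : t ≤ ((k : ℝ) + 1) * Δt)
    (ξ : ℝ → ℝ) (hm : Measurable ξ) (hb : ∀ t, ξ t ∈ Set.Icc (0:ℝ) 1) (l : Fin K) :
    adj Δt K k t ξ l ∈ Set.Icc (0:ℝ) 1 := by
  unfold adj
  split_ifs with h
  · have hl : l.val ≤ k := by
      by_contra hl
      have e1 : ¬ l.val < k := by omega
      have e2 : ¬ l.val = k := by omega
      simp [sigmaT, e1, e2] at h
    have hs := sigma_eq Δt t k l.val hΔt h1 h2 hl
    have hle : (l.val : ℝ) * Δt ≤ min (((l.val : ℝ) + 1) * Δt) t := by linarith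
    have i0 := intervalIntegral.integral_nonneg hle (μ := volume) (f := ξ) fun u _ => (hb u).1
    have i1 := intervalIntegral.integral_mono_on hle (xi_integrable ξ hm hb _ _)
      (intervalIntegrable_const (μ := volume) (c := (1:ℝ))) fun u _ => (hb u).2
    rw [intervalIntegral.integral_const, smul_eq_mul, mul_one, ← hs] at i1
    constructor
    · positivity
    · rw [one_div, inv_mul_le_iff₀ h, mul_one]
      exact i1
  · simp

theorem lift_meas (Δt : ℝ) (K : ℕ) (t : ℝ) (v : Fin K → ℝ) : Measurable (lift Δt K t v) := by
  classical
  let g : ℤ → ℝ := fun n => if h : n.toNat < K then v ⟨n.toNat, h⟩ else 0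
  have hg : Measurable g := measurable_from_top
  have e : lift Δt K t v = fun τ => if τ ∈ Set.Ico 0 t then g ⌊τ / Δt⌋ else 0 := by
    funext τ
    simp only [lift, g, Set.mem_Ico]
    by_cases a : 0 ≤ τ <;> by_cases b : τ < t <;> by_cases c : ⌊τ / Δt⌋.toNat < K <;>
      simp [a, b, c]
  rw [e]
  exact Measurable.ite measurableSet_Ico
    (hg.comp (Int.measurable_floor.comp (measurable_id.div_const _))) measurable_const

theorem lift_mem (Δt : ℝ) (K : ℕ) (t : ℝ) (v : Fin K → ℝ) (hv : ∀ l, v l ∈ Set.Icc (0:ℝ) 1)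
    (τ : ℝ) : lift Δt K t v τ ∈ Set.Icc (0:ℝ) 1 := by
  unfold lift
  split_ifs
  · exact hv _
  · simp

theorem lift_eq (Δt : ℝ) (hΔt : 0 < Δt) (K : ℕ) (t : ℝ) (v : Fin K → ℝ) (l : ℕ) (hl : l < K)
    (τ : ℝ) (h1 : (l : ℝ) * Δt ≤ τ) (h2 : τ < ((l : ℝ) + 1) * Δt) (h3 : τ < t) :
    lift Δt K t v τ = v ⟨l, hl⟩ := by
  have hf : ⌊τ / Δt⌋ = (l : ℤ) := by
    rw [Int.floor_eq_iff]
    constructor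
    · rw [le_div_iff₀ hΔt]
      exact_mod_cast h1
    · rw [div_lt_iff₀ hΔt]
      exact_mod_cast h2
  have h0 : 0 ≤ τ := le_trans (by positivity) h1
  simp [lift, hf, h0, h3, hl]

theorem lift_zero (Δt : ℝ) (K : ℕ) (t : ℝ) (v : Fin K → ℝ) (τ : ℝ) (h : t ≤ τ) :
    lift Δt K t v τ = 0 := by
  simp [lift, not_lt.mpr h]

theorem piece (Δt : ℝ) (hΔt : 0 < Δt) (K k : ℕ) (t : ℝ) (h1 : (k : ℝ) * Δt ≤ t)
    (h2 : t ≤ ((k : ℝ) + 1) * Δt)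
    (ξ : ℝ → ℝ) (hm : Measurable ξ) (hb : ∀ t, ξ t ∈ Set.Icc (0:ℝ) 1) (l : ℕ) (hl : l < K) :
    (∫ τ in ((l : ℝ) * Δt)..(((l : ℝ) + 1) * Δt), lift Δt K t (adj Δt K k t ξ) τ) ≤
      ∫ τ in ((l : ℝ) * Δt)..(((l : ℝ) + 1) * Δt), ξ τ := by
  have hab : (l : ℝ) * Δt ≤ ((l : ℝ) + 1) * Δt := by nlinarith
  have hF := xi_integrable _ (lift_meas Δt K t (adj Δt K k t ξ))
    (lift_mem Δt K t _ (adj_mem Δt hΔt K k t h1 h2 ξ hm hb))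
  have hX := xi_integrable ξ hm hb
  by_cases hlk : l ≤ k
  · have hs := sigma_eq Δt t k l hΔt h1 h2 hlk
    have hlk' : (l : ℝ) ≤ k := by exact_mod_cast hlk
    have ham : (l : ℝ) * Δt ≤ min (((l : ℝ) + 1) * Δt) t :=
      le_min hab (le_trans (by gcongr) h1)
    have hmb : min (((l : ℝ) + 1) * Δt) t ≤ ((l : ℝ) + 1) * Δt := min_le_left _ _
    have hv : adj Δt K k t ξ ⟨l, hl⟩ * sigmaT Δt t k l =
        ∫ τ in ((l : ℝ) * Δt)..(min (((l : ℝ) + 1) * Δt) t), ξ τ := by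
      unfold adj
      split_ifs with h
      · simp only at h ⊢
        field_simp
      · simp only at h
        have : min (((l : ℝ) + 1) * Δt) t = (l : ℝ) * Δt := by linarith
        rw [this]
        simp
    have hA : (∫ τ in ((l : ℝ) * Δt)..(min (((l : ℝ) + 1) * Δt) t),
        lift Δt K t (adj Δt K k t ξ) τ) =
        ∫ τ in ((l : ℝ) * Δt)..(min (((l : ℝ) + 1) * Δt) t), adj Δt K k t ξ ⟨l, hl⟩ := by
      refine intervalIntegral.integral_congr_Ioo_of_le ham fun τ hτ => ?_
      have := lt_min_iff.mp hτ.2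
      exact lift_eq Δt hΔt K t _ l hl τ hτ.1.le this.1 this.2
    have hB : (∫ τ in (min (((l : ℝ) + 1) * Δt) t)..(((l : ℝ) + 1) * Δt),
        lift Δt K t (adj Δt K k t ξ) τ) =
        ∫ τ in (min (((l : ℝ) + 1) * Δt) t)..(((l : ℝ) + 1) * Δt), (0:ℝ) := by
      refine intervalIntegral.integral_congr_Ioo_of_le hmb fun τ hτ => ?_
      refine lift_zero Δt K t _ τ ?_
      rcases min_lt_iff.mp hτ.1 with h | h
      · exact absurd hτ.2 (not_lt.mpr h.le)
      · exact h.le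
    rw [← intervalIntegral.integral_add_adjacent_intervals (hF _ _) (hF _ _), hA, hB,
      ← intervalIntegral.integral_add_adjacent_intervals (hX _ _)
        (hX (min (((l : ℝ) + 1) * Δt) t) _), ← hv, hs]
    have := intervalIntegral.integral_nonneg hmb (μ := volume) (f := ξ) fun u _ => (hb u).1
    simp only [intervalIntegral.integral_const, smul_eq_mul, mul_zero]
    linarith
  · have hkl : (k : ℝ) + 1 ≤ l := by exact_mod_cast not_le.mp hlk
    have hB : (∫ τ in ((l : ℝ) * Δt)..(((l : ℝ) + 1) * Δt),
        lift Δt K t (adj Δt K k t ξ) τ) =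
        ∫ τ in ((l : ℝ) * Δt)..(((l : ℝ) + 1) * Δt), (0:ℝ) := by
      refine intervalIntegral.integral_congr_Ioo_of_le hab fun τ hτ => ?_
      refine lift_zero Δt K t _ τ ?_
      have : ((k : ℝ) + 1) * Δt ≤ l * Δt := by gcongr
      linarith [hτ.1]
    rw [hB]
    have := intervalIntegral.integral_nonneg hab (μ := volume) (f := ξ) fun u _ => (hb u).1
    simpa using this

theorem split_sum (Δt : ℝ) (K : ℕ) (f : ℝ → ℝ)
    (hf : ∀ a b, IntervalIntegrable f volume a b) :
    (∫ τ in (0:ℝ)..((K : ℝ) * Δt), f τ) = ∑ l ∈ Finset.range K,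
      ∫ τ in ((l : ℝ) * Δt)..(((l : ℝ) + 1) * Δt), f τ := by
  have := intervalIntegral.sum_integral_adjacent_intervals (μ := volume) (f := f)
    (a := fun n : ℕ => (n : ℝ) * Δt) (n := K) fun _ _ => hf _ _
  simpa using this.symm

/-- for every trading interval `𝒯_k`, every `t ∈ 𝒯_k` and every
`ξ ∈ Ξ⁺`, the function `L_t(L_t† ξ)` belongs to `Ξ⁺`. -/
theorem statement4 (Δt : ℝ) (hΔt : 0 < Δt) (K : ℕ) (hK : 0 < K)
    (γ : ℝ) (hγ0 : 0 ≤ γ) (hγT : γ ≤ (K : ℝ) * Δt)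
    (k : ℕ) (hk : k < K) (t : ℝ)
    (ht : t ∈ Set.Ico ((k : ℝ) * Δt) (((k : ℝ) + 1) * Δt) ∨
      (k + 1 = K ∧ t = (K : ℝ) * Δt))
    (ξ : ℝ → ℝ) (hξ : memXiPlus ((K : ℝ) * Δt) γ ξ) :
    memXiPlus ((K : ℝ) * Δt) γ (lift Δt K t (adj Δt K k t ξ)) := by
  obtain ⟨hm, hb, hi⟩ := hξ
  have h12 : (k : ℝ) * Δt ≤ t ∧ t ≤ ((k : ℝ) + 1) * Δt := by
    rcases ht with h | ⟨h, h'⟩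
    · exact ⟨h.1, h.2.le⟩
    · have : (K : ℝ) = (k : ℝ) + 1 := by exact_mod_cast h.symm
      rw [h', this]
      exact ⟨by nlinarith, le_refl _⟩
  obtain ⟨h1, h2⟩ := h12
  have hM := lift_meas Δt K t (adj Δt K k t ξ)
  have hB := lift_mem Δt K t _ (adj_mem Δt hΔt K k t h1 h2 ξ hm hb)
  refine ⟨hM, hB, le_trans ?_ hi⟩
  have e1 : (fun τ => |lift Δt K t (adj Δt K k t ξ) τ|) = lift Δt K t (adj Δt K k t ξ) :=
    funext fun τ => abs_of_nonneg (hB τ).1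
  have e2 : (fun τ => |ξ τ|) = ξ := funext fun τ => abs_of_nonneg (hb τ).1
  rw [e1, e2, split_sum Δt K _ (xi_integrable _ hM hB), split_sum Δt K _ (xi_integrable ξ hm hb)]
  exact Finset.sum_le_sum fun l hl =>
    piece Δt hΔt K k t h1 h2 ξ hm hb l (Finset.mem_range.mp hl)
end

section
/- For every k ∈ {1,…,K} and every t with (k−1)·Δt < t ≤ k·Δt, the image of Ξ⁺ under L_t† equals the polytope { ξ ∈ [0,1]^K : Σ_{l=1}^{k} σ_l(t)·ξ_l ≤ γ and ξ_l = 0 for all l ∈ {k+1,…,K} }. -/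
open MeasureTheory

theorem aux_ii {w : ℝ → ℝ} (hm : Measurable w) (hb : ∀ t, w t ∈ Set.Icc (0:ℝ) 1) (a b : ℝ) :
    IntervalIntegrable w volume a b := by
  refine (intervalIntegrable_const (c := (1:ℝ))).mono_fun hm.aestronglyMeasurable ?_
  refine Filter.Eventually.of_forall fun x => ?_
  show ‖w x‖ ≤ ‖(1:ℝ)‖
  rw [Real.norm_eq_abs, abs_of_nonneg (hb x).1]
  simpa using (hb x).2

theorem aux_sigma {Δt t : ℝ} (hΔt : 0 < Δt) {k l : ℕ} (hl : l ≤ k)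
    (ht1 : (k : ℝ) * Δt < t) (ht2 : t ≤ ((k : ℝ) + 1) * Δt) :
    0 < sigmaT Δt t k l ∧
      min (((l : ℝ) + 1) * Δt) t - (l : ℝ) * Δt = sigmaT Δt t k l := by
  unfold sigmaT
  rcases hl.lt_or_eq with h | h
  · have h1 : ((l : ℝ) + 1) * Δt ≤ k * Δt := by
      apply mul_le_mul_of_nonneg_right _ hΔt.le
      exact_mod_cast h
    rw [if_pos h, min_eq_left (by linarith)]
    exact ⟨hΔt, by ring⟩
  · subst h
    rw [if_neg (lt_irrefl _), if_pos rfl, min_eq_right ht2]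
    exact ⟨by linarith, rfl⟩

theorem aux_sigma_zero {Δt t : ℝ} {k l : ℕ} (hl : k < l) : sigmaT Δt t k l = 0 := by
  unfold sigmaT
  rw [if_neg (by omega), if_neg (by omega)]

theorem aux_sum {Δt : ℝ} {w : ℝ → ℝ} (hm : Measurable w)
    (hb : ∀ t, w t ∈ Set.Icc (0:ℝ) 1) (K : ℕ) :
    ∑ l : Fin K, ∫ τ in ((l.val : ℝ) * Δt)..(((l.val : ℝ) + 1) * Δt), w τ
      = ∫ τ in (0:ℝ)..((K : ℝ) * Δt), |w τ| := by
  have h := intervalIntegral.sum_integral_adjacent_intervals (μ := volume) (f := w)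
    (a := fun n : ℕ => (n : ℝ) * Δt) (n := K) (fun _ _ => aux_ii hm hb _ _)
  rw [Finset.sum_range] at h
  have e : (fun τ => |w τ|) = w := funext fun x => abs_of_nonneg (hb x).1
  rw [e]
  simpa using h

theorem aux_const {w : ℝ → ℝ} {a b c : ℝ} (hab : a ≤ b) (h : ∀ x ∈ Set.Ioo a b, w x = c) :
    ∫ τ in a..b, w τ = (b - a) * c := by
  have : ∫ τ in a..b, w τ = ∫ τ in a..b, c := by
    rw [intervalIntegral.integral_of_le hab, intervalIntegral.integral_of_le hab,
      integral_Ioc_eq_integral_Ioo, integral_Ioc_eq_integral_Ioo]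
    exact setIntegral_congr_fun measurableSet_Ioo h
  rw [this]
  simp

/-- for `t` with `k·Δt < t ≤ (k+1)·Δt` (0-indexed interval `k`), the
image of `Ξ⁺` under `L_t†` is exactly the polytope
`{ξ ∈ [0,1]^K : Σ_l σ_l(t)·ξ_l ≤ γ, ξ_l = 0 for l > k}`. -/
theorem statement5 (Δt : ℝ) (hΔt : 0 < Δt) (K : ℕ) (hK : 0 < K)
    (γ : ℝ) (hγ0 : 0 ≤ γ) (hγT : γ ≤ (K : ℝ) * Δt)
    (k : ℕ) (hk : k < K) (t : ℝ)
    (ht1 : (k : ℝ) * Δt < t) (ht2 : t ≤ ((k : ℝ) + 1) * Δt) :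
    (adj Δt K k t) '' {ξ : ℝ → ℝ | memXiPlus ((K : ℝ) * Δt) γ ξ} =
      {v : Fin K → ℝ | (∀ l : Fin K, v l ∈ Set.Icc (0:ℝ) 1) ∧
        (∑ l : Fin K, sigmaT Δt t k l.val * v l) ≤ γ ∧
        ∀ l : Fin K, k < l.val → v l = 0} := by
  have hend : ∀ l : ℕ, (l : ℝ) * Δt ≤ ((l : ℝ) + 1) * Δt := fun l => by nlinarith
  ext v
  constructor
  · rintro ⟨w, ⟨hm, hb, hγ⟩, rfl⟩
    have key : ∀ l : Fin K, l.val ≤ k → sigmaT Δt t k l.val * adj Δt K k t w l =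
        ∫ τ in ((l.val : ℝ) * Δt)..(min (((l.val : ℝ) + 1) * Δt) t), w τ := by
      intro l hl
      obtain ⟨h0, _⟩ := aux_sigma hΔt hl ht1 ht2
      unfold adj
      rw [if_pos h0]
      field_simp
    have hz : ∀ l : Fin K, k < l.val → adj Δt K k t w l = 0 := by
      intro l hl
      unfold adj
      rw [if_neg (by rw [aux_sigma_zero hl]; exact lt_irrefl _)]
    refine ⟨fun l => ?_, ?_, hz⟩
    · rcases le_or_gt l.val k with hl | hl
      · obtain ⟨h0, h1⟩ := aux_sigma hΔt hl ht1 ht2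
        have hle : (l.val : ℝ) * Δt ≤ min (((l.val : ℝ) + 1) * Δt) t := by linarith
        have hk := key l hl
        have i0 : 0 ≤ ∫ τ in ((l.val : ℝ) * Δt)..(min (((l.val : ℝ) + 1) * Δt) t), w τ :=
          intervalIntegral.integral_nonneg hle fun x _ => (hb x).1
        have i1 : ∫ τ in ((l.val : ℝ) * Δt)..(min (((l.val : ℝ) + 1) * Δt) t), w τ ≤
            ∫ τ in ((l.val : ℝ) * Δt)..(min (((l.val : ℝ) + 1) * Δt) t), (1:ℝ) :=
          intervalIntegral.integral_mono_on hle (aux_ii hm hb _ _) intervalIntegrable_const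
            fun x _ => (hb x).2
        rw [intervalIntegral.integral_const, smul_eq_mul, mul_one, h1] at i1
        rw [← hk] at i0 i1
        exact ⟨nonneg_of_mul_nonneg_right i0 h0,
          le_of_mul_le_mul_left (by linarith) h0⟩
      · rw [hz l hl]; simp
    · refine le_trans ?_ hγ
      rw [← aux_sum hm hb K]
      refine Finset.sum_le_sum fun l _ => ?_
      rcases le_or_gt l.val k with hl | hl
      · obtain ⟨h0, h1⟩ := aux_sigma hΔt hl ht1 ht2
        rw [key l hl, ← intervalIntegral.integral_add_adjacent_intervals
          (aux_ii hm hb ((l.val : ℝ) * Δt) (min (((l.val : ℝ) + 1) * Δt) t))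
          (aux_ii hm hb _ (((l.val : ℝ) + 1) * Δt))]
        have := intervalIntegral.integral_nonneg (μ := volume)
          (min_le_left (((l.val : ℝ) + 1) * Δt) t) fun x _ => (hb x).1
        linarith
      · rw [hz l hl, mul_zero]
        exact intervalIntegral.integral_nonneg (hend _) fun x _ => (hb x).1
  · rintro ⟨hv, hsum, hz⟩
    let g : ℕ → ℝ := fun n => if h : n < K then v ⟨n, h⟩ else 0
    let w : ℝ → ℝ := fun τ => if τ < t then g ⌊τ / Δt⌋₊ else 0
    have hg : ∀ n, g n ∈ Set.Icc (0:ℝ) 1 := by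
      intro n
      by_cases h : n < K
      · simp only [g, dif_pos h]; exact hv _
      · simp only [g, dif_neg h]; simp
    have hb : ∀ τ, w τ ∈ Set.Icc (0:ℝ) 1 := by
      intro τ
      by_cases h : τ < t
      · simp only [w, if_pos h]; exact hg _
      · simp only [w, if_neg h]; simp
    have hm : Measurable w := by
      refine Measurable.ite measurableSet_Iio ?_ measurable_const
      exact (measurable_from_nat (f := g)).comp
        (Nat.measurable_floor.comp (measurable_id.div_const Δt))
    have hint : ∀ l : Fin K, l.val ≤ k →
        ∫ τ in ((l.val : ℝ) * Δt)..(min (((l.val : ℝ) + 1) * Δt) t), w τ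
          = sigmaT Δt t k l.val * v l := by
      intro l hl
      obtain ⟨h0, h1⟩ := aux_sigma hΔt hl ht1 ht2
      rw [← h1]
      refine aux_const (by linarith) ?_
      rintro x ⟨hx1, hx2⟩
      obtain ⟨hx2, hx3⟩ := lt_min_iff.1 hx2
      have hf : ⌊x / Δt⌋₊ = l.val := by
        have hx0 : (l.val : ℝ) ≤ x / Δt := by rw [le_div_iff₀ hΔt]; exact hx1.le
        rw [Nat.floor_eq_iff (le_trans (Nat.cast_nonneg _) hx0)]
        exact ⟨hx0, by rw [div_lt_iff₀ hΔt]; exact hx2⟩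
      simp only [w, if_pos hx3, hf, g, dif_pos l.isLt]
    refine ⟨w, ⟨hm, hb, ?_⟩, ?_⟩
    · rw [← aux_sum hm hb K]
      refine le_trans (le_of_eq ?_) hsum
      refine Finset.sum_congr rfl fun l _ => ?_
      rcases le_or_gt l.val k with hl | hl
      · rw [← hint l hl, ← intervalIntegral.integral_add_adjacent_intervals
          (aux_ii hm hb ((l.val : ℝ) * Δt) (min (((l.val : ℝ) + 1) * Δt) t))
          (aux_ii hm hb _ (((l.val : ℝ) + 1) * Δt))]
        rw [aux_const (w := w) (c := 0) (min_le_left (((l.val : ℝ) + 1) * Δt) t)]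
        · ring
        · rintro x ⟨hx1, hx2⟩
          have : ¬ x < t := fun h => absurd hx1 (not_lt.2 (le_min hx2.le h.le))
          simp only [w, if_neg this]
      · rw [aux_sigma_zero hl, aux_const (w := w) (c := 0) (hend _)]
        · ring
        · rintro x ⟨hx1, hx2⟩
          have h1 : ((k : ℝ) + 1) * Δt ≤ l.val * Δt := by
            apply mul_le_mul_of_nonneg_right _ hΔt.le
            exact_mod_cast hl
          have : ¬ x < t := by linarith
          simp only [w, if_neg this]
    · funext l
      unfold adj
      rcases le_or_gt l.val k with hl | hl
      · obtain ⟨h0, h1⟩ := aux_sigma hΔt hl ht1 ht2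
        rw [if_pos h0, hint l hl]
        field_simp
      · rw [if_neg (by rw [aux_sigma_zero hl]; exact lt_irrefl _), hz l hl]
end

section
/- Assume γ = m·Δt for a positive integer m ≤ K, fix y₀, ȳ ∈ ℝ and x̲ ≤ 0 ≤ x̄, and let x⁰, x↑, x↓ be piecewise-constant market decisions with x↑_k ≥ 0, x↓_k ≥ 0, x̲ ≤ x⁰_k − x↓_k and x⁰_k ≤ x̄ for all k. Then y(x⁰, x↑, x↓, ξ, y₀, t) ≤ ȳ holds for all t ∈ [0,T] and all ξ ∈ Ξ if and only if there exist λ̄ ∈ ℝ^K with 0 ≤ λ̄_k ≤ (x̄ − x̲)/ηd, binary vectors υ₁, υ₂ ∈ {0,1}^{K−1}, and reals Λ̄_{kl} for 1 ≤ l ≤ k ≤ K such that: for every k ∈ {1,…,K}: y₀ + γ·λ̄_k + Δt·Σ_{l=1}^{k} Λ̄_{kl} ≤ ȳ, Λ̄_{kk} ≥ −ηc·x⁰_k, Λ̄_{kk} ≥ ηc·(x↓_k − x⁰_k) − λ̄_k, and Λ̄_{kk} ≥ 0; for every k ∈ {1,…,K−1}: (1 − υ₁_k)·x̲ ≤ x⁰_k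 − x↓_k ≤ υ₁_k·x̄ and υ₂_k·x̲ ≤ x⁰_k ≤ (1 − υ₂_k)·x̄; and for all 1 ≤ l < k ≤ K: Λ̄_{kl} ≥ (x↓_l − x⁰_l)/ηd − λ̄_k + (1 − υ₁_l)·Δη·x̲, Λ̄_{kl} ≥ −x⁰_l/ηd + υ₂_l·Δη·x̲, Λ̄_{kl} ≥ ηc·(x↓_l − x⁰_l) − λ̄_k − υ₁_l·Δη·x̄, Λ̄_{kl} ≥ −ηc·x⁰_l − (1 − υ₂_l)·Δη·x̄, and Λ̄_{kl}·x↓_l + λ̄_k·x⁰_l ≥ υ₂_l·x̲·(x̄ − x̲)/ηd − υ₁_l·x̄²/(4·ηd). -/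
open MeasureTheory

/-- Specific loss `Δη = 1/ηd − ηc`. -/
noncomputable def deltaEta (ηc ηd : ℝ) : ℝ := 1 / ηd - ηc


noncomputable def phiF (c e p : ℝ) : ℝ := c * max (-p) 0 - e * max p 0

lemma phiF_nonneg {c e p : ℝ} (h : 0 ≤ p) : phiF c e p = -(e * p) := by
  unfold phiF; rw [max_eq_right (by linarith), max_eq_left h]; ring

lemma phiF_nonpos {c e p : ℝ} (h : p ≤ 0) : phiF c e p = -(c * p) := by
  unfold phiF; rw [max_eq_left (by linarith), max_eq_right h]; ring

lemma phiF_le1 {c e : ℝ} (h : c < e) (p : ℝ) : phiF c e p ≤ -(c * p) := by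
  rcases le_total 0 p with hp | hp
  · rw [phiF_nonneg hp]; nlinarith
  · rw [phiF_nonpos hp]

lemma phiF_le2 {c e : ℝ} (h : c < e) (p : ℝ) : phiF c e p ≤ -(e * p) := by
  rcases le_total 0 p with hp | hp
  · rw [phiF_nonneg hp]
  · rw [phiF_nonpos hp]; nlinarith

lemma phiF_conc {c e : ℝ} (h : c < e) {α β : ℝ} (hα : 0 ≤ α) (hβ : 0 ≤ β) (p q : ℝ) :
    α * phiF c e p + β * phiF c e q ≤ phiF c e (α * p + β * q) := by
  rcases le_total 0 (α * p + β * q) with hp | hp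
  · rw [phiF_nonneg hp]
    have := mul_le_mul_of_nonneg_left (phiF_le2 h p) hα
    have := mul_le_mul_of_nonneg_left (phiF_le2 h q) hβ
    linarith
  · rw [phiF_nonpos hp]
    have := mul_le_mul_of_nonneg_left (phiF_le1 h p) hα
    have := mul_le_mul_of_nonneg_left (phiF_le1 h q) hβ
    linarith

lemma phiF_anti {c e : ℝ} (hc : 0 < c) (h : c < e) {p q : ℝ} (hpq : p ≤ q) :
    phiF c e q ≤ phiF c e p := by
  rcases le_total 0 p with hp | hp
  · rw [phiF_nonneg hp, phiF_nonneg (hp.trans hpq)]; nlinarith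
  · rw [phiF_nonpos hp]
    refine (phiF_le1 h q).trans ?_
    nlinarith

lemma phiF_homog {c e s : ℝ} (hs : 0 ≤ s) (p : ℝ) : phiF c e (s * p) = s * phiF c e p := by
  rcases le_total 0 p with hp | hp
  · rw [phiF_nonneg hp, phiF_nonneg (mul_nonneg hs hp)]; ring
  · rw [phiF_nonpos hp, phiF_nonpos (mul_nonpos_of_nonneg_of_nonpos hs hp)]; ring

lemma phiF_lip {c e : ℝ} (hc : 0 < c) (h : c < e) {p d : ℝ} (hd : 0 ≤ d) :
    phiF c e (p - d) ≤ phiF c e p + e * d := by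
  rcases le_total 0 p with hp | hp
  · rw [phiF_nonneg hp]
    have := phiF_le2 h (p - d)
    linarith
  · rw [phiF_nonpos hp, phiF_nonpos (by linarith)]; nlinarith

lemma phiF_cont (c e : ℝ) : Continuous (phiF c e) := by
  unfold phiF; fun_prop

lemma sep_lemma {ι : Type*} (P : ι → Prop) (b v : ι → ℝ) (γ Y : ℝ)
    (h0 : ∃ i, P i ∧ b i < γ) (h1 : ∀ i, P i → b i ≤ γ → v i ≤ Y)
    (h2 : ∀ i j, P i → P j → b i < γ → γ < b j →
      (b j - γ) * v i + (γ - b i) * v j ≤ Y * (b j - b i)) :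
    ∃ lam : ℝ, 0 ≤ lam ∧ ∀ i, P i → v i + lam * (γ - b i) ≤ Y := by
  let A : Set ℝ := {r | r = 0 ∨ ∃ j, P j ∧ γ < b j ∧ r = (v j - Y) / (b j - γ)}
  have key : ∀ i, P i → b i < γ → ∀ r ∈ A, r ≤ (Y - v i) / (γ - b i) := by
    intro i hi hb r hr
    rcases hr with rfl | ⟨j, hj, hbj, rfl⟩
    · exact div_nonneg (by linarith [h1 i hi hb.le]) (by linarith)
    · rw [div_le_div_iff₀ (by linarith) (by linarith)]
      nlinarith [h2 i j hi hj hb hbj]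
  obtain ⟨i0, hi0, hb0⟩ := h0
  have hbdd : BddAbove A := ⟨_, fun r hr => key i0 hi0 hb0 r hr⟩
  have hne : A.Nonempty := ⟨0, Or.inl rfl⟩
  refine ⟨sSup A, le_csSup hbdd (Or.inl rfl), ?_⟩
  intro i hi
  rcases lt_trichotomy (b i) γ with hb | hb | hb
  · have := csSup_le hne (key i hi hb)
    rw [le_div_iff₀ (by linarith)] at this
    linarith
  · have := h1 i hi hb.le
    rw [hb]; simpa using this
  · have : (v i - Y) / (b i - γ) ≤ sSup A := le_csSup hbdd (Or.inr ⟨i, hi, hb, rfl⟩)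
    rw [div_le_iff₀ (by linarith)] at this
    linarith

/-- pointwise bound, ζ part -/
lemma key_zeta {c e x d L lam u1 u2 xl xu : ℝ} (hc : 0 < c) (hce : c < e) (hd : 0 ≤ d)
    (hlam : 0 ≤ lam)
    (hu1 : u1 = 0 ∨ u1 = 1) (hu2 : u2 = 0 ∨ u2 = 1)
    (a1 : x - d ≤ u1 * xu) (a1' : (1 - u1) * xl ≤ x - d)
    (a2 : u2 * xl ≤ x) (a2' : x ≤ (1 - u2) * xu)
    (b1 : e * (d - x) - lam + (1 - u1) * (e - c) * xl ≤ L)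
    (b2 : -(e * x) + u2 * (e - c) * xl ≤ L)
    (b3 : c * (d - x) - lam - u1 * (e - c) * xu ≤ L)
    (b4 : -(c * x) - (1 - u2) * (e - c) * xu ≤ L)
    (b5 : u2 = 0 → u1 = 0 → 0 ≤ L * d + lam * x)
    {ζ : ℝ} (h0 : 0 ≤ ζ) (h1 : ζ ≤ 1) :
    phiF c e (x - ζ * d) ≤ L + lam * ζ := by
  rcases hu1 with rfl | rfl <;> rcases hu2 with rfl | rfl <;>
    norm_num at a1 a1' a2 a2' b1 b2 b3 b4 b5
  · rcases le_total 0 (x - ζ * d) with hp | hp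
    · rw [phiF_nonneg hp]
      rcases a2.eq_or_lt with hx | hx
      · subst hx
        nlinarith [mul_nonneg hlam h0, mul_nonneg h0 hd]
      · have e1 := mul_le_mul_of_nonneg_left b2 hp
        have e2 := mul_nonneg h0 b5
        by_contra hcon
        push Not at hcon
        have e3 := mul_lt_mul_of_pos_left hcon hx
        nlinarith
    · rw [phiF_nonpos hp]
      rcases a1.eq_or_lt with hx | hx
      · subst hx
        rcases a2.eq_or_lt with hx | hx
        · rw [← hx] at b2 ⊢
          nlinarith [mul_nonneg hlam h0]
        · have : 0 ≤ L + lam := by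
            by_contra hcon
            push Not at hcon
            nlinarith
          have : 1 ≤ ζ := by
            by_contra hcon
            push Not at hcon
            nlinarith
          have : ζ = 1 := le_antisymm h1 this
          subst this
          nlinarith
      · have e1 := mul_le_mul_of_nonneg_left b3 (by linarith : 0 ≤ ζ * d - x)
        have e2 := mul_nonneg (by linarith : 0 ≤ 1 - ζ) b5
        by_contra hcon
        push Not at hcon
        have e3 := mul_lt_mul_of_pos_left hcon (by linarith : 0 < d - x)
        nlinarith
  · refine (phiF_le1 hce _).trans ?_
    have e1 := mul_le_mul_of_nonneg_left b4 (by linarith : 0 ≤ 1 - ζ)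
    have e2 := mul_le_mul_of_nonneg_left b3 h0
    nlinarith
  · refine (phiF_le2 hce _).trans ?_
    have e1 := mul_le_mul_of_nonneg_left b2 (by linarith : 0 ≤ 1 - ζ)
    have e2 := mul_le_mul_of_nonneg_left b1 h0
    nlinarith
  · have hx : x = 0 := by linarith
    have hdd : d = 0 := by linarith
    subst hx; subst hdd
    rw [phiF_nonneg (by simp)]
    nlinarith [mul_nonneg hlam h0]

lemma key_diag {c e x d L lam : ℝ} (hce : c < e)
    (b3 : c * (d - x) - lam ≤ L) (b4 : -(c * x) ≤ L)
    {ζ : ℝ} (h0 : 0 ≤ ζ) (h1 : ζ ≤ 1) :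
    phiF c e (x - ζ * d) ≤ L + lam * ζ := by
  refine (phiF_le1 hce _).trans ?_
  have e1 := mul_le_mul_of_nonneg_left b4 (by linarith : 0 ≤ 1 - ζ)
  have e2 := mul_le_mul_of_nonneg_left b3 h0
  nlinarith

lemma key_xi {c e x u d L lam : ℝ} (hc : 0 < c) (hce : c < e) (hu : 0 ≤ u)
    (hlam : 0 ≤ lam)
    (H : ∀ ζ : ℝ, 0 ≤ ζ → ζ ≤ 1 → phiF c e (x - ζ * d) ≤ L + lam * ζ)
    {ξ : ℝ} (h : ξ ∈ Set.Icc (-1:ℝ) 1) :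
    phiF c e (power x u d ξ) ≤ L + lam * |ξ| := by
  unfold power
  rcases le_total 0 ξ with hx | hx
  · rw [max_eq_left hx, max_eq_right (by linarith), abs_of_nonneg hx]
    have h1 := H 0 le_rfl zero_le_one
    have h2 : phiF c e (x + ξ * u - 0 * d) ≤ phiF c e (x - 0 * d) :=
      phiF_anti hc hce (by nlinarith [mul_nonneg hx hu])
    nlinarith [mul_nonneg hlam hx]
  · rw [max_eq_right hx, max_eq_left (by linarith), abs_of_nonpos hx]
    have := H (-ξ) (by linarith) (by linarith [h.1])
    simpa using this

/-- piecewise integral -/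
lemma piece_int (Δt : ℝ) (h : ℝ → ℝ) (I : ℕ → ℝ) (n : ℕ)
    (H : ∀ i < n, IntervalIntegrable h volume ((i:ℝ) * Δt) (((i:ℝ)+1) * Δt) ∧
      ∫ τ in ((i:ℝ) * Δt)..(((i:ℝ)+1) * Δt), h τ = I (i+1)) :
    IntervalIntegrable h volume 0 ((n:ℝ) * Δt) ∧
      ∫ τ in (0:ℝ)..((n:ℝ) * Δt), h τ = ∑ l ∈ Finset.Icc 1 n, I l := by
  induction n with
  | zero => simp
  | succ n ih =>
    obtain ⟨i1, i2⟩ := ih (fun i hi => H i (by omega))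
    obtain ⟨j1, j2⟩ := H n (by omega)
    push_cast
    refine ⟨i1.trans j1, ?_⟩
    rw [← intervalIntegral.integral_add_adjacent_intervals i1 j1, i2, j2,
      Finset.sum_Icc_succ_top (by omega)]

lemma int_congr_Ico {f g : ℝ → ℝ} {a b : ℝ} (hab : a ≤ b)
    (h : ∀ τ ∈ Set.Ico a b, f τ = g τ) (hg : IntervalIntegrable g volume a b) :
    IntervalIntegrable f volume a b ∧ ∫ τ in a..b, f τ = ∫ τ in a..b, g τ := by
  have hae : ∀ᵐ τ ∂volume, τ ∈ Set.uIoc a b → g τ = f τ := by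
    have : ∀ᵐ τ ∂(volume : Measure ℝ), τ ≠ b := by
      simp [ae_iff]
    filter_upwards [this] with τ hτ hm
    rw [Set.uIoc_of_le hab] at hm
    exact (h τ ⟨hm.1.le, lt_of_le_of_ne hm.2 hτ⟩).symm
  refine ⟨?_, (intervalIntegral.integral_congr_ae hae).symm⟩
  refine hg.congr_ae ?_
  rw [Filter.EventuallyEq, ae_restrict_iff' measurableSet_uIoc]
  exact hae

lemma int_of_bdd {f : ℝ → ℝ} (hf : Measurable f) {C : ℝ} (hC : ∀ τ, |f τ| ≤ C) (a b : ℝ) :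
    IntervalIntegrable f volume a b := by
  refine (intervalIntegrable_const (c := C)).mono_fun hf.aestronglyMeasurable ?_
  refine Filter.Eventually.of_forall fun τ => ?_
  simp only [Real.norm_eq_abs]
  exact (hC τ).trans (le_abs_self C)

lemma phi_power_int {c e x u d : ℝ} {ξ : ℝ → ℝ} (hm : Measurable ξ)
    (hξ : ∀ t, ξ t ∈ Set.Icc (-1:ℝ) 1) (a b : ℝ) :
    IntervalIntegrable (fun τ => phiF c e (power x u d (ξ τ))) volume a b := by
  have hcont : Continuous (fun r => phiF c e (power x u d r)) := by
    unfold power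
    exact (phiF_cont c e).comp (by fun_prop)
  obtain ⟨C, hC⟩ := (isCompact_Icc (a := (-1:ℝ)) (b := 1)).exists_bound_of_continuousOn
    hcont.continuousOn
  exact int_of_bdd (hcont.measurable.comp hm) (C := C) (fun τ => hC _ (hξ τ)) a b

lemma pc_eq {Δt : ℝ} {K : ℕ} {v : ℕ → ℝ} {f : ℝ → ℝ} (h : IsPC Δt K v f) {i : ℕ} (hi : i < K)
    {τ : ℝ} (h1 : (i:ℝ) * Δt ≤ τ) (h2 : τ < ((i:ℝ) + 1) * Δt) : f τ = v (i+1) := by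
  refine h.1 (i+1) (by omega) (by omega) τ ⟨?_, ?_⟩ <;> push_cast
  · linarith
  · linarith

/-- Weak duality. -/
lemma backward {Δt : ℝ} (hΔt : 0 < Δt) {K : ℕ} {c e γ y0 yub : ℝ}
    {x0 xu xd : ℕ → ℝ} {f0 fu fd : ℝ → ℝ}
    (hf0 : IsPC Δt K x0 f0) (hfu : IsPC Δt K xu fu) (hfd : IsPC Δt K xd fd)
    {lam : ℝ} (hlam : 0 ≤ lam) {L : ℕ → ℝ} {n : ℕ} (hn : n < K)
    (hL : 0 ≤ L (n+1))
    (hy : y0 + γ * lam + Δt * ∑ l ∈ Finset.Icc 1 (n+1), L l ≤ yub)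
    {ξ : ℝ → ℝ} (hξ : memXi ((K:ℝ) * Δt) γ ξ)
    (H : ∀ i ≤ n, ∀ r ∈ Set.Icc (-1:ℝ) 1,
      phiF c e (power (x0 (i+1)) (xu (i+1)) (xd (i+1)) r) ≤ L (i+1) + lam * |r|)
    {t : ℝ} (ht1 : (n:ℝ) * Δt ≤ t) (ht2 : t ≤ ((n:ℝ)+1) * Δt) :
    y0 + ∫ τ in (0:ℝ)..t, phiF c e (power (f0 τ) (fu τ) (fd τ) (ξ τ)) ≤ yub := by
  obtain ⟨hm, hb, hγ⟩ := hξ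
  set h : ℝ → ℝ := fun τ => phiF c e (power (f0 τ) (fu τ) (fd τ) (ξ τ)) with hh
  have hint : ∀ a b, IntervalIntegrable (fun τ => |ξ τ|) volume a b := fun a b =>
    int_of_bdd (continuous_abs.measurable.comp hm) (C := 1)
      (fun τ => by simpa [abs_le] using hb τ) a b
  have piece : ∀ i ≤ n, ∀ b, (i:ℝ) * Δt ≤ b → b ≤ ((i:ℝ)+1) * Δt →
      IntervalIntegrable h volume ((i:ℝ)*Δt) b ∧
      ∫ τ in ((i:ℝ)*Δt)..b, h τ ≤ (b - (i:ℝ)*Δt) * L (i+1) + lam * ∫ τ in ((i:ℝ)*Δt)..b, |ξ τ| := by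
    intro i hi b hb1 hb2
    obtain ⟨k1, k2⟩ := int_congr_Ico (f := h)
      (g := fun τ => phiF c e (power (x0 (i+1)) (xu (i+1)) (xd (i+1)) (ξ τ))) hb1
      (fun τ hτ => by
        have a1 := hτ.1
        have a2 : τ < ((i:ℝ)+1) * Δt := lt_of_lt_of_le hτ.2 hb2
        simp only [hh]
        rw [pc_eq hf0 (by omega) a1 a2, pc_eq hfu (by omega) a1 a2, pc_eq hfd (by omega) a1 a2])
      (phi_power_int hm hb _ _)
    refine ⟨k1, ?_⟩
    rw [k2]
    have i1 : IntervalIntegrable (fun τ => lam * |ξ τ|) volume ((i:ℝ)*Δt) b :=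
      (hint _ _).const_mul lam
    have i0 : IntervalIntegrable (fun _ : ℝ => L (i+1)) volume ((i:ℝ)*Δt) b :=
      intervalIntegrable_const
    have := intervalIntegral.integral_mono_on hb1 (phi_power_int (c := c) (e := e)
      (x := x0 (i+1)) (u := xu (i+1)) (d := xd (i+1)) hm hb ((i:ℝ)*Δt) b) (i0.add i1)
      (fun τ _ => H i hi (ξ τ) (hb τ))
    refine this.trans (le_of_eq ?_)
    rw [intervalIntegral.integral_add i0 i1, intervalIntegral.integral_const,
      intervalIntegral.integral_const_mul, smul_eq_mul]
  have pos := piece_int Δt h (fun l => ∫ τ in (((l:ℝ)-1) * Δt)..((l:ℝ) * Δt), h τ) n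
    (fun i hi => ⟨(piece i hi.le _ (by linarith) le_rfl).1, by push_cast; ring_nf⟩)
  have posξ := piece_int Δt (fun τ => |ξ τ|)
    (fun l => ∫ τ in (((l:ℝ)-1) * Δt)..((l:ℝ) * Δt), |ξ τ|) n
    (fun i hi => ⟨hint _ _, by push_cast; ring_nf⟩)
  have hsum : ∫ τ in (0:ℝ)..((n:ℝ)*Δt), h τ ≤
      Δt * ∑ l ∈ Finset.Icc 1 n, L l + lam * ∫ τ in (0:ℝ)..((n:ℝ)*Δt), |ξ τ| := by
    rw [pos.2, posξ.2, Finset.mul_sum, Finset.mul_sum, ← Finset.sum_add_distrib]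
    refine Finset.sum_le_sum fun l hl => ?_
    rw [Finset.mem_Icc] at hl
    obtain ⟨i, rfl⟩ : ∃ i, l = i + 1 := ⟨l - 1, by omega⟩
    have := (piece i (by omega) (((i:ℝ)+1)*Δt) (by linarith) le_rfl).2
    push_cast
    have e1 : ((i:ℝ) + 1 - 1) = i := by ring
    rw [e1]
    refine this.trans (le_of_eq ?_)
    ring
  have hlast := piece n le_rfl t ht1 ht2
  have hT : ∫ τ in (0:ℝ)..t, |ξ τ| ≤ γ := by
    refine le_trans ?_ hγ
    have hn' : ((n:ℝ)+1) * Δt ≤ (K:ℝ) * Δt := by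
      have : ((n:ℝ)+1) ≤ K := by exact_mod_cast hn
      exact mul_le_mul_of_nonneg_right this hΔt.le
    refine intervalIntegral.integral_mono_interval le_rfl ?_ (ht2.trans hn') ?_ (hint _ _)
    · exact le_trans (by positivity) ht1
    · exact Filter.Eventually.of_forall fun τ => abs_nonneg _
  rw [← intervalIntegral.integral_add_adjacent_intervals pos.1 hlast.1]
  rw [← intervalIntegral.integral_add_adjacent_intervals (hint 0 ((n:ℝ)*Δt)) (hint _ t)] at hT
  rw [Finset.sum_Icc_succ_top (by omega)] at hy
  have e1 : (t - n * Δt) * L (n+1) ≤ Δt * L (n+1) :=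
    mul_le_mul_of_nonneg_right (by linarith) hL
  have e2 := mul_le_mul_of_nonneg_left hT hlam
  linarith [hlast.2]

/-- Realizing a primal point by a scenario. -/
lemma forward {Δt : ℝ} (hΔt : 0 < Δt) {K : ℕ} {c e γ y0 yub : ℝ}
    {x0 xu xd : ℕ → ℝ} {f0 fu fd : ℝ → ℝ}
    (hf0 : IsPC Δt K x0 f0) (hfu : IsPC Δt K xu fu) (hfd : IsPC Δt K xd fd)
    (R : ∀ t ∈ Set.Icc (0:ℝ) ((K : ℝ) * Δt), ∀ ξ : ℝ → ℝ, memXi ((K : ℝ) * Δt) γ ξ →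
        y0 + ∫ τ in (0:ℝ)..t, phiF c e (power (f0 τ) (fu τ) (fd τ) (ξ τ)) ≤ yub)
    {n : ℕ} (hn : n < K) {s : ℝ} {z : ℕ → ℝ} (hz : ∀ l, 0 ≤ z l ∧ z l ≤ 1)
    (hzs : z (n+1) ≤ s) (hs : s ≤ 1)
    (hbud : Δt * (∑ l ∈ Finset.Icc 1 n, z l + z (n+1)) ≤ γ) :
    y0 + Δt * (∑ l ∈ Finset.Icc 1 n, phiF c e (x0 l - z l * xd l)
      + phiF c e (s * x0 (n+1) - z (n+1) * xd (n+1))) ≤ yub := by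
  have hs0 : 0 ≤ s := (hz (n+1)).1.trans hzs
  set t : ℝ := ((n:ℝ) + s) * Δt with ht
  set w : ℕ → ℝ := fun l => if l ≤ n then z l else z (n+1) / s with hw
  have hw01 : ∀ l, 0 ≤ w l ∧ w l ≤ 1 := by
    intro l
    simp only [hw]
    split_ifs
    · exact hz l
    · exact ⟨div_nonneg (hz _).1 hs0, div_le_one_of_le₀ hzs hs0⟩
  have hsw : s * w (n+1) = z (n+1) := by
    simp only [hw]
    rw [if_neg (by omega)]
    rcases hs0.eq_or_lt with h | h
    · have := (hz (n+1)).1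
      rw [← h] at hzs ⊢
      linarith
    · field_simp
  set ξ : ℝ → ℝ := fun τ => if τ < t then -w (⌊τ/Δt⌋₊ + 1) else 0 with hξ
  have hξm : Measurable ξ := by
    refine Measurable.ite (measurableSet_lt measurable_id measurable_const) ?_ measurable_const
    have h1 : Measurable (fun i : ℕ => -w (i+1)) := measurable_from_nat
    have h2 : Measurable (fun τ : ℝ => ⌊τ/Δt⌋₊) := Nat.measurable_floor.comp (by fun_prop)
    exact h1.comp h2
  have hξb : ∀ τ, ξ τ ∈ Set.Icc (-1:ℝ) 1 := by
    intro τ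
    simp only [hξ]
    split_ifs
    · have := hw01 (⌊τ/Δt⌋₊ + 1)
      constructor <;> linarith
    · constructor <;> norm_num
  have htn : (n:ℝ) * Δt ≤ t := by rw [ht]; nlinarith
  have htn1 : t ≤ ((n:ℝ)+1) * Δt := by rw [ht]; nlinarith
  have hnK : ((n:ℝ)+1) * Δt ≤ (K:ℝ) * Δt := by
    have : ((n:ℝ)+1) ≤ K := by exact_mod_cast hn
    exact mul_le_mul_of_nonneg_right this hΔt.le
  have ht0 : 0 ≤ t := le_trans (by positivity) htn
  have hξv : ∀ i : ℕ, ∀ τ, (i:ℝ) * Δt ≤ τ → τ < ((i:ℝ)+1) * Δt → τ < t → ξ τ = -w (i+1) := by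
    intro i τ h1 h2 h3
    simp only [hξ]
    rw [if_pos h3]
    have : ⌊τ/Δt⌋₊ = i := by
      rw [Nat.floor_eq_iff (div_nonneg (le_trans (by positivity) h1) hΔt.le)]
      rw [le_div_iff₀ hΔt, div_lt_iff₀ hΔt]
      exact ⟨h1, h2⟩
    rw [this]
  -- general integral of functions that are constant on pieces
  have gen : ∀ (h : ℝ → ℝ) (C : ℕ → ℝ),
      (∀ i ≤ n, ∀ τ, (i:ℝ) * Δt ≤ τ → τ < ((i:ℝ)+1) * Δt → τ < t → h τ = C (i+1)) →
      IntervalIntegrable h volume 0 t ∧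
      ∫ τ in (0:ℝ)..t, h τ = Δt * (∑ l ∈ Finset.Icc 1 n, C l + s * C (n+1)) := by
    intro h C hC
    have p1 := piece_int Δt h (fun l => Δt * C l) n (fun i hi => by
      have hit : ((i:ℝ)+1) * Δt ≤ t := by
        refine le_trans ?_ htn
        have : ((i:ℝ)+1) ≤ n := by exact_mod_cast hi
        exact mul_le_mul_of_nonneg_right this hΔt.le
      have := int_congr_Ico (f := h) (g := fun _ => C (i+1))
        (a := (i:ℝ) * Δt) (b := ((i:ℝ)+1) * Δt) (by linarith)
        (fun τ hτ => hC i hi.le τ hτ.1 hτ.2 (lt_of_lt_of_le hτ.2 hit)) intervalIntegrable_const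
      refine ⟨this.1, ?_⟩
      rw [this.2, intervalIntegral.integral_const, smul_eq_mul]
      ring)
    have p2 := int_congr_Ico (f := h) (g := fun _ => C (n+1)) htn
        (fun τ hτ => hC n le_rfl τ hτ.1 (lt_of_lt_of_le hτ.2 htn1) hτ.2) intervalIntegrable_const
    refine ⟨p1.1.trans p2.1, ?_⟩
    rw [← intervalIntegral.integral_add_adjacent_intervals p1.1 p2.1, p1.2, p2.2,
      intervalIntegral.integral_const, smul_eq_mul, ← Finset.mul_sum, ht]
    ring
  have hwn : ∀ l ∈ Finset.Icc 1 n, w l = z l := by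
    intro l hl
    rw [Finset.mem_Icc] at hl
    simp only [hw]
    rw [if_pos hl.2]
  have g1 := gen (fun τ => |ξ τ|) w (fun i _ τ h1 h2 h3 => by
    rw [hξv i τ h1 h2 h3, abs_neg, abs_of_nonneg (hw01 _).1])
  have hmem : memXi ((K:ℝ) * Δt) γ ξ := by
    refine ⟨hξm, hξb, ?_⟩
    have z1 := int_congr_Ico (f := fun τ => |ξ τ|) (g := fun _ => (0:ℝ)) (htn1.trans hnK)
      (fun τ hτ => by simp only [hξ]; rw [if_neg (not_lt.mpr hτ.1), abs_zero])
      intervalIntegrable_const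
    rw [← intervalIntegral.integral_add_adjacent_intervals g1.1 z1.1, g1.2, z1.2,
      Finset.sum_congr rfl hwn, hsw]
    simpa using hbud
  have g2 := gen (fun τ => phiF c e (power (f0 τ) (fu τ) (fd τ) (ξ τ)))
    (fun l => phiF c e (x0 l - w l * xd l)) (fun i hi τ h1 h2 h3 => by
    rw [hξv i τ h1 h2 h3, pc_eq hf0 (by omega) h1 h2, pc_eq hfu (by omega) h1 h2,
      pc_eq hfd (by omega) h1 h2]
    unfold power
    rw [max_eq_right (by linarith [(hw01 (i+1)).1]), max_eq_left (by linarith [(hw01 (i+1)).1])]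
    congr 1
    ring)
  have := R t ⟨ht0, htn1.trans hnK⟩ ξ hmem
  rw [g2.2, Finset.sum_congr rfl (fun l hl => by rw [hwn l hl]), ← phiF_homog hs0, mul_sub,
    ← mul_assoc s (w (n+1)), hsw] at this
  exact this

/-- Strong duality: existence of the multiplier. -/
lemma multiplier {Δt : ℝ} (hΔt : 0 < Δt) {c e γ y0 yub : ℝ} (hce : c < e) (hγ : 0 < γ)
    {x0 xd : ℕ → ℝ} {n : ℕ}
    (R : ∀ (s : ℝ) (z : ℕ → ℝ), (∀ l, 0 ≤ z l ∧ z l ≤ 1) → z (n+1) ≤ s → s ≤ 1 →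
      Δt * (∑ l ∈ Finset.Icc 1 n, z l + z (n+1)) ≤ γ →
      y0 + Δt * (∑ l ∈ Finset.Icc 1 n, phiF c e (x0 l - z l * xd l)
        + phiF c e (s * x0 (n+1) - z (n+1) * xd (n+1))) ≤ yub) :
    ∃ lam : ℝ, 0 ≤ lam ∧ ∀ (s : ℝ) (z : ℕ → ℝ), (∀ l, 0 ≤ z l ∧ z l ≤ 1) → z (n+1) ≤ s → s ≤ 1 →
      y0 + γ * lam + Δt * (∑ l ∈ Finset.Icc 1 n, (phiF c e (x0 l - z l * xd l) - lam * z l)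
        + (phiF c e (s * x0 (n+1) - z (n+1) * xd (n+1)) - lam * z (n+1))) ≤ yub := by
  have SL := sep_lemma (ι := ℝ × (ℕ → ℝ))
    (fun i => (∀ l, 0 ≤ i.2 l ∧ i.2 l ≤ 1) ∧ i.2 (n+1) ≤ i.1 ∧ i.1 ≤ 1)
    (fun i => Δt * (∑ l ∈ Finset.Icc 1 n, i.2 l + i.2 (n+1)))
    (fun i => y0 + Δt * (∑ l ∈ Finset.Icc 1 n, phiF c e (x0 l - i.2 l * xd l)
        + phiF c e (i.1 * x0 (n+1) - i.2 (n+1) * xd (n+1)))) γ yub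
    ⟨(0, fun _ => 0), by simp, by simpa using hγ⟩
    (fun i hi hb => R i.1 i.2 hi.1 hi.2.1 hi.2.2 hb)
  obtain ⟨lam, h0, h⟩ := SL (by
    rintro ⟨s, z⟩ ⟨s', z'⟩ ⟨hz, hzs, hs⟩ ⟨hz', hzs', hs'⟩ hb hb'
    simp only at *
    set B := Δt * (∑ l ∈ Finset.Icc 1 n, z l + z (n+1)) with hB
    set B' := Δt * (∑ l ∈ Finset.Icc 1 n, z' l + z' (n+1)) with hB'
    set α := (B' - γ) / (B' - B) with hα
    set β := (γ - B) / (B' - B) with hβ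
    have hpos : 0 < B' - B := by linarith
    have hα0 : 0 ≤ α := div_nonneg (by linarith) hpos.le
    have hβ0 : 0 ≤ β := div_nonneg (by linarith) hpos.le
    have hαβ : α + β = 1 := by rw [hα, hβ, ← add_div]; rw [div_eq_one_iff_eq hpos.ne']; ring
    have hαe : α * (B' - B) = B' - γ := div_mul_cancel₀ _ hpos.ne'
    have hβe : β * (B' - B) = γ - B := div_mul_cancel₀ _ hpos.ne'
    have key := R (α * s + β * s') (fun l => α * z l + β * z' l)
      (fun l => ⟨add_nonneg (mul_nonneg hα0 (hz l).1) (mul_nonneg hβ0 (hz' l).1), by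
        have := mul_le_mul_of_nonneg_left (hz l).2 hα0
        have := mul_le_mul_of_nonneg_left (hz' l).2 hβ0
        linarith⟩)
      (by
        have := mul_le_mul_of_nonneg_left hzs hα0
        have := mul_le_mul_of_nonneg_left hzs' hβ0
        linarith)
      (by
        have := mul_le_mul_of_nonneg_left hs hα0
        have := mul_le_mul_of_nonneg_left hs' hβ0
        linarith)
      (by
        have : Δt * (∑ l ∈ Finset.Icc 1 n, (α * z l + β * z' l) + (α * z (n+1) + β * z' (n+1)))
            = α * B + β * B' := by
          rw [Finset.sum_add_distrib, ← Finset.mul_sum, ← Finset.mul_sum, hB, hB']; ring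
        rw [this]
        have hα' : α = 1 - β := by linarith
        rw [hα']
        linarith)
    have c1 : α * ∑ l ∈ Finset.Icc 1 n, phiF c e (x0 l - z l * xd l)
        + β * ∑ l ∈ Finset.Icc 1 n, phiF c e (x0 l - z' l * xd l)
        ≤ ∑ l ∈ Finset.Icc 1 n, phiF c e (x0 l - (α * z l + β * z' l) * xd l) := by
      rw [Finset.mul_sum, Finset.mul_sum, ← Finset.sum_add_distrib]
      refine Finset.sum_le_sum fun l _ => ?_
      refine (phiF_conc hce hα0 hβ0 _ _).trans (le_of_eq ?_)
      congr 1
      have hα' : α = 1 - β := by linarith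
      rw [hα']; ring
    have c2 := phiF_conc hce hα0 hβ0 (s * x0 (n+1) - z (n+1) * xd (n+1))
      (s' * x0 (n+1) - z' (n+1) * xd (n+1))
    have c3 : α * (s * x0 (n+1) - z (n+1) * xd (n+1)) + β * (s' * x0 (n+1) - z' (n+1) * xd (n+1))
      = (α * s + β * s') * x0 (n+1) - (α * z (n+1) + β * z' (n+1)) * xd (n+1) := by ring
    rw [c3] at c2
    have c4 := mul_le_mul_of_nonneg_left (add_le_add c1 c2) hΔt.le
    have c5 : α * (y0 + Δt * (∑ l ∈ Finset.Icc 1 n, phiF c e (x0 l - z l * xd l)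
        + phiF c e (s * x0 (n+1) - z (n+1) * xd (n+1))))
      + β * (y0 + Δt * (∑ l ∈ Finset.Icc 1 n, phiF c e (x0 l - z' l * xd l)
        + phiF c e (s' * x0 (n+1) - z' (n+1) * xd (n+1)))) ≤ yub := by
      have hα' : y0 = α * y0 + β * y0 := by rw [← add_mul, hαβ, one_mul]
      linarith
    have c6 := mul_le_mul_of_nonneg_right c5 hpos.le
    rw [add_mul, mul_right_comm, hαe, mul_right_comm, hβe] at c6
    exact c6)
  refine ⟨lam, h0, fun s z hz hzs hs => ?_⟩
  have := h (s, z) ⟨hz, hzs, hs⟩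
  simp only at this
  rw [Finset.sum_sub_distrib, ← Finset.mul_sum]
  linarith

/-- clamped kink position -/
noncomputable def kink (x d : ℝ) : ℝ := max 0 (min 1 (x / d))

lemma kink_mem (x d : ℝ) : 0 ≤ kink x d ∧ kink x d ≤ 1 := by
  unfold kink
  exact ⟨le_max_left _ _, max_le zero_le_one (min_le_left _ _)⟩

noncomputable def bigM (c e x d lam : ℝ) : ℝ :=
  max (phiF c e x) (max (phiF c e (x - d) - lam) (phiF c e (x - kink x d * d) - lam * kink x d))

noncomputable def bigN (c x d lam : ℝ) : ℝ := max 0 (max (-(c * x)) (c * (d - x) - lam))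

lemma bigM_attain {c e x d lam0 L : ℝ} (hc : 0 < c) (hce : c < e) (hd : 0 ≤ d) (hL : e * d ≤ L) :
    ∃ z : ℝ, 0 ≤ z ∧ z ≤ 1 ∧ bigM c e x d (min lam0 L) ≤ phiF c e (x - z * d) - lam0 * z := by
  rcases le_total lam0 L with h | h
  · rw [min_eq_left h]
    unfold bigM
    rcases max_choice (phiF c e x) (max (phiF c e (x - d) - lam0)
      (phiF c e (x - kink x d * d) - lam0 * kink x d)) with h1 | h1
    · rw [h1]; exact ⟨0, le_rfl, zero_le_one, by simp⟩
    · rw [h1]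
      rcases max_choice (phiF c e (x - d) - lam0)
        (phiF c e (x - kink x d * d) - lam0 * kink x d) with h1 | h1
      · rw [h1]; exact ⟨1, zero_le_one, le_rfl, by simp⟩
      · rw [h1]; exact ⟨kink x d, (kink_mem x d).1, (kink_mem x d).2, le_rfl⟩
  · rw [min_eq_right h]
    refine ⟨0, le_rfl, zero_le_one, ?_⟩
    simp only [zero_mul, mul_zero, sub_zero]
    unfold bigM
    refine max_le le_rfl (max_le ?_ ?_)
    · linarith [phiF_lip hc hce (p := x) hd]
    · have hk := kink_mem x d
      have := phiF_lip hc hce (p := x) (mul_nonneg hk.1 hd)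
      nlinarith [mul_le_mul_of_nonneg_left hL hk.1]

lemma bigN_attain {c e x d lam0 L : ℝ} (hc : 0 < c) (hce : c < e) (hd : 0 ≤ d) (hL : e * d ≤ L)
    (hlam : 0 ≤ lam0) :
    ∃ s z : ℝ, 0 ≤ z ∧ z ≤ s ∧ s ≤ 1 ∧
      bigN c x d (min lam0 L) ≤ phiF c e (s * x - z * d) - lam0 * z := by
  have hL0 : 0 ≤ L := le_trans (by nlinarith) hL
  have hm0 : 0 ≤ min lam0 L := le_min hlam hL0
  unfold bigN
  rcases le_total (max (-(c * x)) (c * (d - x) - min lam0 L)) 0 with h1 | h1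
  · rw [max_eq_left h1]
    exact ⟨0, 0, le_rfl, le_rfl, zero_le_one, by simp [phiF]⟩
  · rw [max_eq_right h1]
    rcases le_total (c * (d - x) - min lam0 L) (-(c * x)) with h2 | h2
    · rw [max_eq_left h2] at h1 ⊢
      refine ⟨1, 0, le_rfl, zero_le_one, le_rfl, ?_⟩
      have : x ≤ 0 := by
        by_contra hcon
        push Not at hcon
        nlinarith
      simp [phiF_nonpos this]
    · rw [max_eq_right h2] at h1 ⊢
      rcases le_total lam0 L with h | h
      · rw [min_eq_left h] at h1 ⊢
        refine ⟨1, 1, zero_le_one, le_rfl, le_rfl, ?_⟩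
        have : x - d ≤ 0 := by
          by_contra hcon
          push Not at hcon
          nlinarith
        simp only [one_mul, mul_one]
        rw [phiF_nonpos this]
        linarith
      · rw [min_eq_right h] at h1 h2 ⊢
        have hcd : c * d ≤ L := le_trans (by nlinarith) hL
        have : c * (d - x) - L ≤ -(c * x) := by linarith
        refine ⟨1, 0, le_rfl, zero_le_one, le_rfl, ?_⟩
        have hx : x ≤ 0 := by
          by_contra hcon
          push Not at hcon
          nlinarith
        simp only [one_mul, zero_mul, mul_zero, sub_zero]
        rw [phiF_nonpos hx]
        linarith

lemma bigM_cons {c e x d lam xl xu : ℝ} (hc : 0 < c) (hce : c < e) (hd : 0 ≤ d)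
    (hxl : xl ≤ 0) (hxu : 0 ≤ xu) (h1 : xl ≤ x - d) (h2 : x ≤ xu)
    (hlam : 0 ≤ lam) (hlam2 : lam ≤ e * (xu - xl)) :
    ∃ u1 u2 : ℝ, u1 = (if 0 ≤ x - d then 1 else 0) ∧ u2 = (if 0 ≤ x then 0 else 1) ∧
    e * (d - x) - lam + (1 - u1) * (e - c) * xl ≤ bigM c e x d lam ∧
    -(e * x) + u2 * (e - c) * xl ≤ bigM c e x d lam ∧
    c * (d - x) - lam - u1 * (e - c) * xu ≤ bigM c e x d lam ∧
    -(c * x) - (1 - u2) * (e - c) * xu ≤ bigM c e x d lam ∧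
    u2 * (e * (xl * (xu - xl))) - u1 * (e * (xu ^ 2 / 4)) ≤ bigM c e x d lam * d + lam * x := by
  have m1 : phiF c e x ≤ bigM c e x d lam := le_max_left _ _
  have m2 : phiF c e (x - d) - lam ≤ bigM c e x d lam :=
    (le_max_left _ _).trans (le_max_right _ _)
  have m3 : phiF c e (x - kink x d * d) - lam * kink x d ≤ bigM c e x d lam :=
    (le_max_right _ _).trans (le_max_right _ _)
  generalize bigM c e x d lam = M at *
  refine ⟨_, _, rfl, rfl, ?_⟩
  have he : 0 < e := hc.trans hce
  have hec : 0 < e - c := by linarith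
  by_cases p1 : 0 ≤ x - d
  · have p2 : 0 ≤ x := by linarith
    rw [if_pos p1, if_pos p2]
    rw [phiF_nonneg p2] at m1
    rw [phiF_nonneg p1] at m2
    refine ⟨by linarith, by linarith, ?_, ?_, ?_⟩
    · nlinarith [mul_nonneg hec.le (by linarith : 0 ≤ xu - x + d)]
    · nlinarith [mul_nonneg hec.le (by linarith : 0 ≤ xu - x)]
    · have k1 := mul_le_mul_of_nonneg_right m2 hd
      have k2 : 0 ≤ lam * (x - d) := mul_nonneg hlam p1
      have k3 : (x - d) * d ≤ xu ^ 2 / 4 := by nlinarith [sq_nonneg (x - 2 * d)]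
      have k4 := mul_le_mul_of_nonneg_left k3 he.le
      nlinarith
  · push Not at p1
    by_cases p2 : 0 ≤ x
    · rw [if_neg (not_le.mpr p1), if_pos p2]
      rw [phiF_nonneg p2] at m1
      rw [phiF_nonpos p1.le] at m2
      have hd0 : 0 < d := by linarith
      have hk : kink x d = x / d := by
        unfold kink
        rw [min_eq_right (by rw [div_le_one hd0]; linarith), max_eq_right (by positivity)]
      have hkd : kink x d * d = x := by rw [hk]; field_simp
      rw [hkd, sub_self, phiF_nonneg le_rfl] at m3
      refine ⟨?_, by linarith, by linarith, ?_, ?_⟩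
      · nlinarith [mul_nonneg hec.le (by linarith : 0 ≤ x - d - xl)]
      · nlinarith [mul_nonneg hec.le (by linarith : 0 ≤ xu - x)]
      · have k1 := mul_le_mul_of_nonneg_right m3 hd
        have k2 : lam * kink x d * d = lam * x := by rw [mul_assoc, hkd]
        nlinarith
    · rw [if_neg (not_le.mpr p1), if_neg p2]
      push Not at p2
      rw [phiF_nonpos p2.le] at m1
      rw [phiF_nonpos p1.le] at m2
      refine ⟨?_, ?_, by linarith, by linarith, ?_⟩
      · nlinarith [mul_nonneg hec.le (by linarith : 0 ≤ x - d - xl)]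
      · nlinarith [mul_nonneg hec.le (by linarith : 0 ≤ x - xl)]
      · have hM : 0 ≤ M := le_trans (by nlinarith) m1
        have k1 := mul_nonneg hM hd
        have k2 := mul_le_mul_of_nonneg_right hlam2 (by linarith : 0 ≤ -x)
        have k3 := mul_le_mul_of_nonneg_left (by linarith : -x ≤ -xl)
          (mul_nonneg he.le (by linarith : 0 ≤ xu - xl))
        nlinarith

/-- the robust upper bound `y(x⁰, x↑, x↓, ξ, y₀, t) ≤ ȳ` for all
`t ∈ [0,T]` and `ξ ∈ Ξ` is equivalent to the finite mixed-binary bilinear system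
of Proposition 7 (upper bound on SOC). -/
theorem statement8 (Δt : ℝ) (hΔt : 0 < Δt) (K : ℕ) (hK : 0 < K)
    (ηc ηd : ℝ) (hηc : ηc ∈ Set.Ioo (0:ℝ) 1) (hηd : ηd ∈ Set.Ioo (0:ℝ) 1)
    (γ : ℝ) (m : ℕ) (hm : 0 < m) (hmK : m ≤ K) (hγ : γ = (m : ℝ) * Δt)
    (y0 yub : ℝ) (xlb xub : ℝ) (hxlb : xlb ≤ 0) (hxub : 0 ≤ xub)
    (x0 xu xd : ℕ → ℝ) (f0 fu fd : ℝ → ℝ)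
    (hpos : ∀ k, 1 ≤ k → k ≤ K → 0 ≤ xu k ∧ 0 ≤ xd k)
    (hfeas : ∀ k, 1 ≤ k → k ≤ K → xlb ≤ x0 k - xd k ∧ x0 k ≤ xub)
    (hf0 : IsPC Δt K x0 f0) (hfu : IsPC Δt K xu fu) (hfd : IsPC Δt K xd fd) :
    (∀ t ∈ Set.Icc (0:ℝ) ((K : ℝ) * Δt), ∀ ξ : ℝ → ℝ, memXi ((K : ℝ) * Δt) γ ξ →
        soc ηc ηd f0 fu fd ξ y0 t ≤ yub) ↔
    (∃ (lamU u1 u2 : ℕ → ℝ) (LamU : ℕ → ℕ → ℝ),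
      -- 0 ≤ λ̄_k ≤ (x̄ − x̲)/ηd
      (∀ k, 1 ≤ k → k ≤ K → 0 ≤ lamU k ∧ lamU k ≤ (xub - xlb) / ηd) ∧
      -- υ₁, υ₂ ∈ {0,1}^{K−1}
      (∀ k, 1 ≤ k → k < K → (u1 k = 0 ∨ u1 k = 1) ∧ (u2 k = 0 ∨ u2 k = 1)) ∧
      -- constraints for every k ∈ {1,…,K}
      (∀ k, 1 ≤ k → k ≤ K →
        y0 + γ * lamU k + Δt * ∑ l ∈ Finset.Icc 1 k, LamU k l ≤ yub ∧
        -(ηc * x0 k) ≤ LamU k k ∧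
        ηc * (xd k - x0 k) - lamU k ≤ LamU k k ∧
        0 ≤ LamU k k) ∧
      -- constraints for every k ∈ {1,…,K−1}
      (∀ k, 1 ≤ k → k < K →
        (1 - u1 k) * xlb ≤ x0 k - xd k ∧ x0 k - xd k ≤ u1 k * xub ∧
        u2 k * xlb ≤ x0 k ∧ x0 k ≤ (1 - u2 k) * xub) ∧
      -- constraints for all 1 ≤ l < k ≤ K
      (∀ k l, 1 ≤ l → l < k → k ≤ K →
        (xd l - x0 l) / ηd - lamU k + (1 - u1 l) * deltaEta ηc ηd * xlb ≤ LamU k l ∧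
        -(x0 l / ηd) + u2 l * deltaEta ηc ηd * xlb ≤ LamU k l ∧
        ηc * (xd l - x0 l) - lamU k - u1 l * deltaEta ηc ηd * xub ≤ LamU k l ∧
        -(ηc * x0 l) - (1 - u2 l) * deltaEta ηc ηd * xub ≤ LamU k l ∧
        u2 l * (xlb * (xub - xlb) / ηd) - u1 l * (xub ^ 2 / (4 * ηd)) ≤
          LamU k l * xd l + lamU k * x0 l)) := by
  have hc : 0 < ηc := hηc.1
  have hd0 : 0 < ηd := hηd.1
  obtain ⟨e, he⟩ : ∃ e : ℝ, e = 1 / ηd := ⟨_, rfl⟩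
  have hce : ηc < e := by
    have : 1 < 1 / ηd := by rw [lt_div_iff₀ hd0]; linarith [hηd.2]
    rw [he]; linarith [hηc.2]
  have hγ0 : 0 < γ := by rw [hγ]; positivity
  have hdiv : ∀ a : ℝ, a / ηd = e * a := fun a => by rw [he]; ring
  have hdel : deltaEta ηc ηd = e - ηc := by rw [he]; rfl
  have hsoc : ∀ ξ t, soc ηc ηd f0 fu fd ξ y0 t =
      y0 + ∫ τ in (0:ℝ)..t, phiF ηc e (power (f0 τ) (fu τ) (fd τ) (ξ τ)) := by
    intro ξ t
    rw [he]; rfl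
  have h4 : xub ^ 2 / (4 * ηd) = e * (xub ^ 2 / 4) := by rw [he]; field_simp
  simp only [hsoc, hdiv, hdel, h4]
  constructor
  · intro R
    have hmult : ∀ n, ∃ lam : ℝ, n < K → 0 ≤ lam ∧ ∀ (s : ℝ) (z : ℕ → ℝ),
        (∀ l, 0 ≤ z l ∧ z l ≤ 1) → z (n+1) ≤ s → s ≤ 1 →
        y0 + γ * lam + Δt * (∑ l ∈ Finset.Icc 1 n, (phiF ηc e (x0 l - z l * xd l) - lam * z l)
        + (phiF ηc e (s * x0 (n+1) - z (n+1) * xd (n+1)) - lam * z (n+1))) ≤ yub := by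
      intro n
      by_cases hn : n < K
      · obtain ⟨lam, h⟩ := multiplier hΔt hce hγ0 (fun s z a1 a2 a3 a4 =>
          forward (n := n) hΔt hf0 hfu hfd R hn a1 a2 a3 a4)
        exact ⟨lam, fun _ => h⟩
      · exact ⟨0, fun h => absurd h hn⟩
    choose lam0 hlam0 using hmult
    set L := e * (xub - xlb) with hL
    have hL0 : 0 ≤ L := mul_nonneg (hc.trans hce).le (by linarith)
    have hdL : ∀ l, 1 ≤ l → l ≤ K → e * xd l ≤ L := fun l h1 h2 =>
      mul_le_mul_of_nonneg_left (by linarith [(hfeas l h1 h2).1, (hfeas l h1 h2).2])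
        (hc.trans hce).le
    have hlb : ∀ k, 1 ≤ k → k ≤ K → 0 ≤ min (lam0 (k-1)) L := fun k h1 h2 =>
      le_min (hlam0 (k-1) (by omega)).1 hL0
    refine ⟨fun k => min (lam0 (k-1)) L, fun l => if 0 ≤ x0 l - xd l then 1 else 0,
      fun l => if 0 ≤ x0 l then 0 else 1,
      fun k l => if l < k then bigM ηc e (x0 l) (xd l) (min (lam0 (k-1)) L)
        else bigN ηc (x0 l) (xd l) (min (lam0 (k-1)) L), ?_, ?_, ?_, ?_, ?_⟩
    · exact fun k h1 h2 => ⟨hlb k h1 h2, min_le_right _ _⟩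
    · intro k _ _
      constructor
      · by_cases h : 0 ≤ x0 k - xd k <;> simp [h]
      · by_cases h : 0 ≤ x0 k <;> simp [h]
    · intro k h1 h2
      simp only [lt_irrefl, if_false]
      refine ⟨?_, (le_max_left _ _).trans (le_max_right _ _),
        (le_max_right _ _).trans (le_max_right _ _), le_max_left _ _⟩
      obtain ⟨n, rfl⟩ : ∃ n, k = n + 1 := ⟨k - 1, by omega⟩
      rw [Finset.sum_Icc_succ_top (by omega)]
      simp only [lt_irrefl, if_false, Nat.add_sub_cancel]
      obtain ⟨g1, g2⟩ := hlam0 n (by omega)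
      have hz : ∀ l, ∃ z : ℝ, 0 ≤ z ∧ z ≤ 1 ∧ (l ∈ Finset.Icc 1 n →
          bigM ηc e (x0 l) (xd l) (min (lam0 n) L) ≤
            phiF ηc e (x0 l - z * xd l) - lam0 n * z) := by
        intro l
        by_cases hl : l ∈ Finset.Icc 1 n
        · have hl' := Finset.mem_Icc.mp hl
          obtain ⟨z, q1, q2, q3⟩ := bigM_attain (x := x0 l) (lam0 := lam0 n) hc hce
            (hpos l hl'.1 (by omega)).2 (hdL l hl'.1 (by omega))
          exact ⟨z, q1, q2, fun _ => q3⟩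
        · exact ⟨0, le_rfl, zero_le_one, fun h => absurd h hl⟩
      choose z z0 z1 z2 using hz
      obtain ⟨s, zn, q1, q2, q3, q4⟩ := bigN_attain (x := x0 (n+1)) hc hce
        (hpos (n+1) h1 h2).2 (hdL (n+1) h1 h2) g1
      have fin := g2 s (fun l => if l = n + 1 then zn else z l)
        (fun l => by
          by_cases h : l = n + 1
          · simp only [h, if_true]; exact ⟨q1, q2.trans q3⟩
          · simp only [h, if_false]; exact ⟨z0 l, z1 l⟩)
        (by simpa using q2) q3
      simp only [if_true] at fin
      have hsum : ∑ l ∈ Finset.Icc 1 n, (if l < n + 1 then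
            bigM ηc e (x0 l) (xd l) (min (lam0 n) L)
            else bigN ηc (x0 l) (xd l) (min (lam0 n) L)) ≤
          ∑ l ∈ Finset.Icc 1 n, (phiF ηc e (x0 l - (if l = n + 1 then zn else z l) * xd l)
            - lam0 n * (if l = n + 1 then zn else z l)) := by
        refine Finset.sum_le_sum fun l hl => ?_
        have hl' := Finset.mem_Icc.mp hl
        rw [if_pos (by omega), if_neg (by omega)]
        exact z2 l hl
      have e1 := mul_le_mul_of_nonneg_left (add_le_add hsum q4) hΔt.le
      have e2 := mul_le_mul_of_nonneg_left (min_le_left (lam0 n) L) hγ0.le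
      linarith
    · intro k h1 h2
      have f := hfeas k h1 h2.le
      have hp := (hpos k h1 h2.le).2
      refine ⟨?_, ?_, ?_, ?_⟩ <;> simp only <;> split_ifs <;> linarith
    · intro k l h1 h2 h3
      have f := hfeas l h1 (by omega)
      obtain ⟨u1, u2, hu1, hu2, h⟩ := bigM_cons hc hce (hpos l h1 (by omega)).2 hxlb hxub f.1 f.2
        (hlb k (by omega) h3) (min_le_right _ _)
      simp only [if_pos h2]
      rw [← hu1, ← hu2]
      exact h
  · rintro ⟨lam, u1, u2, Lam, H1, H2, H3, H4, H5⟩ t ht ξ hξ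
    obtain ⟨n, hn, ht1, ht2⟩ : ∃ n : ℕ, n < K ∧ (n:ℝ) * Δt ≤ t ∧ t ≤ ((n:ℝ)+1) * Δt := by
      rcases ht.2.eq_or_lt with h | h
      · refine ⟨K - 1, by omega, ?_, ?_⟩
        all_goals
          rw [h, Nat.cast_sub (by omega)]
          push_cast
          nlinarith
      · have hq : 0 ≤ t / Δt := div_nonneg ht.1 hΔt.le
        refine ⟨⌊t / Δt⌋₊, ?_, ?_, ?_⟩
        · rw [Nat.floor_lt hq, div_lt_iff₀ hΔt]; exact h
        · rw [← le_div_iff₀ hΔt]; exact Nat.floor_le hq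
        · rw [← div_le_iff₀ hΔt]; exact (Nat.lt_floor_add_one _).le
    have l0 := (H1 (n+1) (by omega) (by omega)).1
    obtain ⟨k1, k2, k3, k4⟩ := H3 (n+1) (by omega) (by omega)
    refine backward hΔt hf0 hfu hfd l0 hn k4 k1 hξ ?_ ht1 ht2
    intro i hi r hr
    have hp := hpos (i+1) (by omega) (by omega)
    refine key_xi hc hce hp.1 l0 (fun ζ z0 z1 => ?_) hr
    rcases hi.eq_or_lt with rfl | hi
    · exact key_diag hce k3 k2 z0 z1
    · obtain ⟨b1, b2, b3, b4, b5⟩ := H5 (n+1) (i+1) (by omega) (by omega) (by omega)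
      obtain ⟨a1, a2, a3, a4⟩ := H4 (i+1) (by omega) (by omega)
      obtain ⟨c1, c2⟩ := H2 (i+1) (by omega) (by omega)
      refine key_zeta hc hce hp.2 l0 c1 c2 a2 a1 a3 a4 b1 b2 b3 b4 ?_ z0 z1
      intro g2 g1
      rw [g1, g2] at b5
      linarith
end

section
/- Let Δt > 0, K a positive integer, T = K·Δt, γ ≥ 0, x̲ ≤ 0 ≤ x̄, and let x⁰, x↓ ∈ ℝ^K satisfy x̲ ≤ x⁰_l − x↓_l, x⁰_l ≤ x̄ and x↓_l ≥ 0 for all l. For k ∈ {1,…,K} define S̄_k = inf over λ ∈ [0, (x̄ − x̲)/ηd] of ( γ·λ + Δt·Σ_{l=1}^{k−1} φ̄(x⁰_l, x↓_l, λ) + Δt·[φ̄(x⁰_k, x↓_k, λ)]⁺ ) and S̲_k = inf over λ ∈ [0, (x̄ − x̲)/ηd] of ( γ·λ + Δt·Σ_{l=1}^{k−1} φ̲(x⁰_l, x↓_l, λ) + Δt·[φ̲(x⁰_k, x↓_k, λ)]⁺ ). Then for every k, S̄_k − S̲_k ≤ (T − Δt)·Δη·min{ −x̲, x̄, (x̄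 − x̲)/(1 + ηc·ηd) }. -/
/-- The upper approximation `φ̄(x⁰, x↓, λ)`. -/
noncomputable def phibar (ηc ηd x0 xd lam : ℝ) : ℝ :=
  if xd ≤ x0 ∨ max ((xd - ηd * lam) / (1 - ηc * ηd)) 0 ≤ x0 then
    max (-(x0 / ηd)) ((xd - x0) / ηd - lam)
  else
    max (-(ηc * x0)) (ηc * (xd - x0) - lam)

/-- The lower approximation `φ̲(x⁰, x↓, λ)`. -/
noncomputable def philo (ηc ηd x0 xd lam : ℝ) : ℝ :=
  if x0 ≤ 0 then max (-(ηc * x0)) (ηc * (xd - x0) - lam)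
  else if xd ≤ x0 then max (-(x0 / ηd)) ((xd - x0) / ηd - lam)
  else max (-(x0 / ηd)) (ηc * (xd - x0) - lam)

theorem aux_lb (ηc ηd x0 xd lam : ℝ) :
    min (-(x0 / ηd)) (-(ηc * x0)) ≤ phibar ηc ηd x0 xd lam := by
  unfold phibar
  split_ifs
  · exact le_trans (min_le_left _ _) (le_max_left _ _)
  · exact le_trans (min_le_right _ _) (le_max_left _ _)

theorem aux_core (c e x0 xd lam : ℝ) (hc0 : 0 < c) (hc1 : c < 1) (he0 : 0 < e) (he1 : e < 1)
    (hxd : 0 ≤ xd) (hlam : 0 ≤ lam) :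
    max (phibar c e x0 xd lam) 0 ≤ max (philo c e x0 xd lam) 0 ∧
    (phibar c e x0 xd lam ≤ philo c e x0 xd lam ∨
      (0 < x0 ∧ 0 < xd - x0 ∧
        phibar c e x0 xd lam - philo c e x0 xd lam ≤ (1 / e - c) * x0 ∧
        phibar c e x0 xd lam - philo c e x0 xd lam ≤ (1 / e - c) * (xd - x0))) := by
  have hce : c * e < 1 := by nlinarith
  have hpos : 0 < 1 - c * e := by linarith
  have key : ∀ h : x0 ≤ 0 ∨ xd ≤ x0, phibar c e x0 xd lam ≤ philo c e x0 xd lam := by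
    intro h
    by_cases hx : x0 ≤ 0
    · have hlo : philo c e x0 xd lam = max (-(c * x0)) (c * (xd - x0) - lam) := by
        unfold philo; rw [if_pos hx]
      rw [hlo]
      unfold phibar
      split_ifs with hb
      · have hx0 : x0 = 0 := by
          rcases hb with hb | hb
          · linarith
          · exact le_antisymm hx (le_trans (le_max_right _ _) hb)
        subst hx0
        have hle : xd / e - lam ≤ 0 := by
          rcases hb with hb | hb
          · have : xd = 0 := le_antisymm hb hxd
            subst this; simpa using hlam
          · have h1 := le_trans (le_max_left _ _) hb
            rw [div_le_iff₀ hpos] at h1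
            have : xd / e ≤ lam := by rw [div_le_iff₀ he0]; linarith
            linarith
        apply le_trans _ (le_max_left _ _)
        apply max_le
        · simp
        · simpa using hle
      · exact le_rfl
    · have hx2 : xd ≤ x0 := by tauto
      unfold phibar philo
      rw [if_pos (Or.inl hx2), if_neg hx, if_pos hx2]
  by_cases h : x0 ≤ 0 ∨ xd ≤ x0
  · exact ⟨max_le_max_right _ (key h), Or.inl (key h)⟩
  · push Not at h
    obtain ⟨h0, h1⟩ := h
    have hlo : philo c e x0 xd lam = max (-(x0 / e)) (c * (xd - x0) - lam) := by
      unfold philo; rw [if_neg (not_le.2 h0), if_neg (not_le.2 h1)]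
    have hdiv : (xd - x0) / e = (1 / e) * (xd - x0) := by ring
    have hdiv2 : x0 / e = (1 / e) * x0 := by ring
    have hinv : e * (1 / e) = 1 := by field_simp
    have hD : 0 < 1 / e - c := by
      have : c < 1 / e := by rw [lt_div_iff₀ he0]; exact hce
      linarith
    have hA := le_max_left (-(x0 / e)) (c * (xd - x0) - lam)
    have hB := le_max_right (-(x0 / e)) (c * (xd - x0) - lam)
    have hcx : 0 < c * x0 := mul_pos hc0 h0
    have hDx : 0 < (1 / e - c) * x0 := mul_pos hD h0
    have hDb : 0 < (1 / e - c) * (xd - x0) := mul_pos hD (by linarith)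
    rw [hlo]
    by_cases hb : (xd - e * lam) / (1 - c * e) ≤ x0
    · have hbar : phibar c e x0 xd lam = max (-(x0 / e)) ((xd - x0) / e - lam) := by
        unfold phibar
        rw [if_pos (Or.inr (max_le hb h0.le))]
      rw [div_le_iff₀ hpos] at hb
      have hk : (xd - x0) / e - lam ≤ -(c * x0) := by
        have : (xd - x0) / e ≤ lam - c * x0 := by rw [div_le_iff₀ he0]; linarith
        linarith
      rw [hbar]
      have hneg : -(x0 / e) ≤ 0 := by
        have := div_pos h0 he0
        linarith
      refine ⟨max_le (le_trans (max_le hneg (by linarith)) (le_max_right _ _))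
        (le_max_right _ _), Or.inr ⟨h0, by linarith, ?_, ?_⟩⟩
      · rw [sub_le_iff_le_add]
        apply max_le <;> linarith
      · rw [sub_le_iff_le_add]
        apply max_le <;> linarith
    · have hbar : phibar c e x0 xd lam = max (-(c * x0)) (c * (xd - x0) - lam) := by
        unfold phibar
        rw [if_neg]
        rintro (h | h)
        · linarith
        · exact hb (le_trans (le_max_left _ _) h)
      rw [not_le, lt_div_iff₀ hpos] at hb
      have hk : -(c * x0) ≤ (xd - x0) / e - lam := by
        have : lam - c * x0 ≤ (xd - x0) / e := by rw [le_div_iff₀ he0]; linarith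
        linarith
      rw [hbar]
      refine ⟨max_le (max_le ?_ ?_) (le_max_right _ _), Or.inr ⟨h0, by linarith, ?_, ?_⟩⟩
      · exact le_trans (by linarith) (le_max_right _ _)
      · exact le_trans hB (le_max_left _ _)
      · rw [sub_le_iff_le_add]
        apply max_le <;> linarith
      · rw [sub_le_iff_le_add]
        apply max_le <;> linarith

/-- Proposition 9: the gap between the maximum state of charge
estimated by the restriction and by the relaxation is at most
`(T − Δt)·Δη·min{−x̲, x̄, (x̄ − x̲)/(1 + ηc·ηd)}`. -/
theorem statement11 (Δt : ℝ) (hΔt : 0 < Δt) (K : ℕ) (hK : 0 < K)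
    (γ : ℝ) (hγ : 0 ≤ γ)
    (ηc ηd : ℝ) (hηc : ηc ∈ Set.Ioo (0:ℝ) 1) (hηd : ηd ∈ Set.Ioo (0:ℝ) 1)
    (xlb xub : ℝ) (hxlb : xlb ≤ 0) (hxub : 0 ≤ xub)
    (x0 xd : ℕ → ℝ)
    (hfeas : ∀ l, 1 ≤ l → l ≤ K → xlb ≤ x0 l - xd l ∧ x0 l ≤ xub ∧ 0 ≤ xd l) :
    ∀ k, 1 ≤ k → k ≤ K →
      sInf ((fun lam : ℝ =>
          γ * lam + Δt * ∑ l ∈ Finset.Ico 1 k, phibar ηc ηd (x0 l) (xd l) lam +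
            Δt * max (phibar ηc ηd (x0 k) (xd k) lam) 0) ''
          Set.Icc (0:ℝ) ((xub - xlb) / ηd)) -
        sInf ((fun lam : ℝ =>
          γ * lam + Δt * ∑ l ∈ Finset.Ico 1 k, philo ηc ηd (x0 l) (xd l) lam +
            Δt * max (philo ηc ηd (x0 k) (xd k) lam) 0) ''
          Set.Icc (0:ℝ) ((xub - xlb) / ηd)) ≤
      ((K : ℝ) * Δt - Δt) * (1 / ηd - ηc) *
        min (min (-xlb) xub) ((xub - xlb) / (1 + ηc * ηd)) := by
  intro k hk1 hkK
  obtain ⟨hc0, hc1⟩ := hηc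
  obtain ⟨he0, he1⟩ := hηd
  set M := min (min (-xlb) xub) ((xub - xlb) / (1 + ηc * ηd)) with hM
  have hce : ηc * ηd < 1 := by nlinarith
  have hce0 : 0 < ηc * ηd := mul_pos hc0 he0
  have hD : 0 < 1 / ηd - ηc := by
    have : ηc < 1 / ηd := by rw [lt_div_iff₀ he0]; exact hce
    linarith
  have hM0 : 0 ≤ M := by
    refine le_min (le_min (by linarith) hxub) (div_nonneg (by linarith) (by linarith))
  have hDM : 0 ≤ (1 / ηd - ηc) * M := mul_nonneg hD.le hM0
  have hgap : ∀ l, 1 ≤ l → l ≤ K → ∀ lam, 0 ≤ lam →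
      phibar ηc ηd (x0 l) (xd l) lam ≤ philo ηc ηd (x0 l) (xd l) lam + (1 / ηd - ηc) * M := by
    intro l h1 h2 lam hlam
    obtain ⟨f1, f2, f3⟩ := hfeas l h1 h2
    rcases (aux_core ηc ηd (x0 l) (xd l) lam hc0 hc1 he0 he1 f3 hlam).2 with h | ⟨ha, hb, g1, g2⟩
    · linarith
    · have hm : min (x0 l) (xd l - x0 l) ≤ M := by
        refine le_min (le_min ?_ ?_) ?_
        · exact le_trans (min_le_right _ _) (by linarith)
        · exact le_trans (min_le_left _ _) f2
        · rw [le_div_iff₀ (by linarith)]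
          have m1 := min_le_left (x0 l) (xd l - x0 l)
          have m2 := min_le_right (x0 l) (xd l - x0 l)
          have m0 : 0 < min (x0 l) (xd l - x0 l) := lt_min ha hb
          nlinarith
      have hm2 := mul_le_mul_of_nonneg_left hm hD.le
      rcases min_choice (x0 l) (xd l - x0 l) with h | h <;> rw [h] at hm2 <;> linarith
  rw [sub_le_iff_le_add, ← sub_le_iff_le_add']
  apply le_csInf
  · exact (Set.nonempty_Icc.2 (div_nonneg (by linarith) he0.le)).image _
  rintro _ ⟨lam, hlam, rfl⟩
  rw [sub_le_iff_le_add']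
  have hbdd : BddBelow ((fun lam : ℝ =>
          γ * lam + Δt * ∑ l ∈ Finset.Ico 1 k, phibar ηc ηd (x0 l) (xd l) lam +
            Δt * max (phibar ηc ηd (x0 k) (xd k) lam) 0) ''
          Set.Icc (0:ℝ) ((xub - xlb) / ηd)) := by
    refine ⟨Δt * ∑ l ∈ Finset.Ico 1 k, min (-(x0 l / ηd)) (-(ηc * x0 l)), ?_⟩
    rintro _ ⟨lam, hlam, rfl⟩
    have a1 : 0 ≤ γ * lam := mul_nonneg hγ hlam.1
    have a2 : 0 ≤ Δt * max (phibar ηc ηd (x0 k) (xd k) lam) 0 :=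
      mul_nonneg hΔt.le (le_max_right _ _)
    have a3 := mul_le_mul_of_nonneg_left (Finset.sum_le_sum (s := Finset.Ico 1 k)
      (fun l _ => aux_lb ηc ηd (x0 l) (xd l) lam)) hΔt.le
    simp only
    linarith
  refine le_trans (csInf_le hbdd ⟨lam, hlam, rfl⟩) ?_
  have b1 := mul_le_mul_of_nonneg_left
    (aux_core ηc ηd (x0 k) (xd k) lam hc0 hc1 he0 he1 (hfeas k hk1 hkK).2.2 hlam.1).1 hΔt.le
  have b2 : ∑ l ∈ Finset.Ico 1 k, phibar ηc ηd (x0 l) (xd l) lam ≤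
      ∑ l ∈ Finset.Ico 1 k, philo ηc ηd (x0 l) (xd l) lam
        + ((k : ℝ) - 1) * ((1 / ηd - ηc) * M) := by
    have := Finset.sum_le_sum (s := Finset.Ico 1 k) (fun l hl =>
      hgap l (Finset.mem_Ico.1 hl).1 ((Finset.mem_Ico.1 hl).2.le.trans hkK) lam hlam.1)
    rw [Finset.sum_add_distrib, Finset.sum_const, Nat.card_Ico, nsmul_eq_mul,
      Nat.cast_sub hk1, Nat.cast_one] at this
    exact this
  have b3 := mul_le_mul_of_nonneg_left b2 hΔt.le
  have hkK' : (k : ℝ) ≤ K := by exact_mod_cast hkK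
  have b4 : Δt * (((k : ℝ) - 1) * ((1 / ηd - ηc) * M)) ≤
      Δt * (((K : ℝ) - 1) * ((1 / ηd - ηc) * M)) :=
    mul_le_mul_of_nonneg_left (mul_le_mul_of_nonneg_right (by linarith) hDM) hΔt.le
  have b5 : ((K : ℝ) * Δt - Δt) * (1 / ηd - ηc) * M
      = Δt * (((K : ℝ) - 1) * ((1 / ηd - ηc) * M)) := by ring
  rw [b5]
  simp only
  linarith
end

section
/- Let x̲ ≤ 0 ≤ x̄. For all reals x⁰, x↓, λ with x̲ ≤ x⁰ − x↓, x⁰ ≤ x̄, x↓ ≥ 0 and 0 ≤ λ ≤ (x̄ − x̲)/ηd, one has φ̄(x⁰, x↓, λ) − φ̲(x⁰, x↓, λ) ≤ Δη·min{ −x̲, x̄, (x̄ − x̲)/(1 + ηc·ηd) }. -/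
/-- pointwise bound on the gap between the upper and lower
approximations of the `φ`-function. -/
theorem statement12 (ηc ηd : ℝ) (hηc : ηc ∈ Set.Ioo (0:ℝ) 1) (hηd : ηd ∈ Set.Ioo (0:ℝ) 1)
    (xlb xub : ℝ) (hxlb : xlb ≤ 0) (hxub : 0 ≤ xub) :
    ∀ x0 xd lam : ℝ, xlb ≤ x0 - xd → x0 ≤ xub → 0 ≤ xd →
      0 ≤ lam → lam ≤ (xub - xlb) / ηd →
      phibar ηc ηd x0 xd lam - philo ηc ηd x0 xd lam ≤
        (1 / ηd - ηc) * min (min (-xlb) xub) ((xub - xlb) / (1 + ηc * ηd)) := by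
  intro x0 xd lam h1 h2 h3 h4 _
  obtain ⟨hc0, hc1⟩ := hηc
  obtain ⟨hd0, hd1⟩ := hηd
  have hcd0 : 0 < ηc * ηd := mul_pos hc0 hd0
  have hcd : ηc * ηd < 1 := by nlinarith
  obtain ⟨a, ha⟩ : ∃ a, a = 1 / ηd := ⟨_, rfl⟩
  have hda : ηd * a = 1 := by rw [ha]; field_simp
  have hdiv : ∀ t : ℝ, t / ηd = a * t := by intro t; rw [ha]; ring
  have ha1 : 1 < a := by rw [ha]; exact (one_lt_div hd0).2 hd1
  have hD : 0 < a - ηc := by linarith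
  rw [← ha]
  -- it suffices to bound the gap by `D * m` with `m` small
  have key : ∀ g m : ℝ, g ≤ (a - ηc) * m → m ≤ -xlb → m ≤ xub →
      g ≤ (a - ηc) * min (min (-xlb) xub) ((xub - xlb) / (1 + ηc * ηd)) := by
    intro g m hg hm1 hm2
    refine hg.trans (mul_le_mul_of_nonneg_left ?_ hD.le)
    refine le_min (le_min hm1 hm2) ?_
    rw [le_div_iff₀ (by linarith)]
    rcases le_total m 0 with hm | hm <;> nlinarith
  unfold phibar philo
  simp only [hdiv]
  by_cases hx : x0 ≤ 0
  · refine key _ 0 ?_ (by linarith) hxub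
    rw [if_pos hx, mul_zero, sub_nonpos]
    split_ifs with hc
    · have hx0 : x0 = 0 := by
        rcases hc with hc | hc
        · linarith
        · linarith [le_max_right ((xd - ηd * lam) / (1 - ηc * ηd)) 0]
      subst hx0
      have hy : a * (xd - 0) - lam ≤ 0 := by
        rcases hc with hc | hc
        · have : xd = 0 := by linarith
          subst this; linarith
        · have h := (le_max_left _ _).trans hc
          rw [div_le_iff₀ (by linarith)] at h
          have := mul_le_mul_of_nonneg_left h (by linarith : (0:ℝ) ≤ a)
          linear_combination this + lam * hda
      refine max_le ?_ ?_
      · exact le_max_of_le_left (by simp)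
      · exact le_max_of_le_left (by simpa using hy)
    · exact le_rfl
  · rw [if_neg hx]
    push Not at hx
    by_cases hxx : xd ≤ x0
    · refine key _ 0 ?_ (by linarith) hxub
      rw [if_pos (Or.inl hxx), if_pos hxx]
      simp
    · rw [if_neg hxx]
      push Not at hxx
      have hfin : ∀ g : ℝ, g ≤ (a - ηc) * x0 → g ≤ (a - ηc) * (xd - x0) →
          g ≤ (a - ηc) * min (min (-xlb) xub) ((xub - xlb) / (1 + ηc * ηd)) := by
        intro g hg1 hg2
        refine key g (min x0 (xd - x0)) ?_ ((min_le_right _ _).trans (by linarith))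
          ((min_le_left _ _).trans h2)
        rcases min_choice x0 (xd - x0) with h | h <;> rw [h] <;> assumption
      have hl1 := le_max_left (-(a * x0)) (ηc * (xd - x0) - lam)
      have hl2 := le_max_right (-(a * x0)) (ηc * (xd - x0) - lam)
      have p1 : 0 ≤ (a - ηc) * x0 := mul_nonneg hD.le hx.le
      have p2 : 0 ≤ (a - ηc) * (xd - x0) := mul_nonneg hD.le (by linarith)
      split_ifs with hc
      · have hy : a * (xd - x0) + ηc * x0 ≤ lam := by
          rcases hc with hc | hc
          · linarith
          · have h := (le_max_left _ _).trans hc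
            rw [div_le_iff₀ (by linarith)] at h
            have := mul_le_mul_of_nonneg_left h (by linarith : (0:ℝ) ≤ a)
            linear_combination this + (lam - ηc * x0) * hda
        rcases max_choice (-(a * x0)) (a * (xd - x0) - lam) with h | h <;>
          rw [h] <;> apply hfin <;> linarith
      · have hy : lam ≤ a * (xd - x0) + ηc * x0 := by
          push Not at hc
          have h := hc.2
          rcases lt_max_iff.1 h with h | h
          · rw [lt_div_iff₀ (by linarith)] at h
            have := mul_le_mul_of_nonneg_left h.le (by linarith : (0:ℝ) ≤ a)
            linear_combination this - (lam - ηc * x0) * hda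
          · linarith
        rcases max_choice (-(ηc * x0)) (ηc * (xd - x0) - lam) with h | h <;>
          rw [h] <;> apply hfin <;> linarith
end

section
/- For all x⁰ ∈ ℝ, x↓ ≥ 0 and λ ≥ 0, one has φ̲(x⁰, x↓, λ) ≤ φ(x⁰, x↓, λ) ≤ φ̄(x⁰, x↓, λ). -/
/-- The optimal value function
`φ(x⁰, x↓, λ) = min_{u ∈ [0,1]} max{(1/ηd − Δη·u)·(x↓ − x⁰) − λ, (Δη·u − 1/ηd)·x⁰}`. -/
noncomputable def phi (ηc ηd x0 xd lam : ℝ) : ℝ :=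
  sInf ((fun u : ℝ =>
    max ((1 / ηd - (1 / ηd - ηc) * u) * (xd - x0) - lam)
      (((1 / ηd - ηc) * u - 1 / ηd) * x0)) '' Set.Icc (0:ℝ) 1)

/-- `φ̲ ≤ φ ≤ φ̄` for all `x⁰ ∈ ℝ`, `x↓ ≥ 0` and `λ ≥ 0`. -/
theorem statement13 (ηc ηd : ℝ) (hηc : ηc ∈ Set.Ioo (0:ℝ) 1) (hηd : ηd ∈ Set.Ioo (0:ℝ) 1) :
    ∀ x0 xd lam : ℝ, 0 ≤ xd → 0 ≤ lam →
      philo ηc ηd x0 xd lam ≤ phi ηc ηd x0 xd lam ∧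
      phi ηc ηd x0 xd lam ≤ phibar ηc ηd x0 xd lam := by
  intro x0 xd lam hxd hlam
  obtain ⟨hc0, hc1⟩ := hηc
  obtain ⟨hd0, hd1⟩ := hηd
  have hD : 1 < 1 / ηd := by rw [lt_div_iff₀ hd0]; linarith
  have e1 : x0 / ηd = 1 / ηd * x0 := by ring
  have e2 : (xd - x0) / ηd = 1 / ηd * (xd - x0) := by ring
  have key : ∀ u ∈ Set.Icc (0:ℝ) 1, philo ηc ηd x0 xd lam ≤
      max ((1 / ηd - (1 / ηd - ηc) * u) * (xd - x0) - lam)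
        (((1 / ηd - ηc) * u - 1 / ηd) * x0) := by
    rintro u ⟨hu0, hu1⟩
    unfold philo
    rw [e1, e2]
    generalize 1 / ηd = D at *
    obtain ⟨k, hk⟩ : ∃ k, k = D - (D - ηc) * u := ⟨_, rfl⟩
    have hk1 : ηc ≤ k := by nlinarith
    have hk2 : k ≤ D := by nlinarith
    have hk3 : (D - ηc) * u - D = -k := by rw [hk]; ring
    rw [hk3, ← hk, max_comm (k * (xd - x0) - lam)]
    split_ifs with h1 h2
    · exact max_le_max (by nlinarith) (by nlinarith)
    · exact max_le_max (by nlinarith) (by nlinarith)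
    · exact max_le_max (by nlinarith) (by nlinarith)
  have hne : ((fun u : ℝ =>
      max ((1 / ηd - (1 / ηd - ηc) * u) * (xd - x0) - lam)
        (((1 / ηd - ηc) * u - 1 / ηd) * x0)) '' Set.Icc (0:ℝ) 1).Nonempty :=
    ⟨_, 0, ⟨le_refl _, zero_le_one⟩, rfl⟩
  have hlb : philo ηc ηd x0 xd lam ∈ lowerBounds ((fun u : ℝ =>
      max ((1 / ηd - (1 / ηd - ηc) * u) * (xd - x0) - lam)
        (((1 / ηd - ηc) * u - 1 / ηd) * x0)) '' Set.Icc (0:ℝ) 1) := by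
    rintro _ ⟨u, hu, rfl⟩
    exact key u hu
  refine ⟨le_csInf hne fun b hb => hlb hb, ?_⟩
  unfold phibar
  rw [e1, e2]
  split_ifs
  · refine csInf_le ⟨_, hlb⟩ ⟨0, ⟨le_refl _, zero_le_one⟩, ?_⟩
    dsimp only
    rw [max_comm]
    congr 1 <;> ring
  · refine csInf_le ⟨_, hlb⟩ ⟨1, ⟨zero_le_one, le_refl _⟩, ?_⟩
    dsimp only
    rw [max_comm]
    congr 1 <;> ring
end

section
/- Let x⁰ ∈ ℝ, x↓ ≥ 0 and λ ≥ 0. Then: (i) if x↓ ≤ x⁰, then φ(x⁰, x↓, λ) = max{ (x↓ − x⁰)/ηd − λ, −x⁰/ηd }; (ii) if x⁰ ≤ 0, then φ(x⁰, x↓, λ) = max{ ηc·(x↓ − x⁰) − λ, −ηc·x⁰ }; (iii) if 0 ≤ x⁰ ≤ x↓ and x↓ > 0, then φ(x⁰, x↓, λ) = max{ ηc·(x↓ − x⁰) − λ, −λ·x⁰/x↓, −x⁰/ηd }. -/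
theorem phi_eq_aux (ηc ηd x0 xd lam t v : ℝ) (h : ηc < 1 / ηd) (h1 : ηc ≤ t) (h2 : t ≤ 1 / ηd)
    (hv : max (t * (xd - x0) - lam) (-(t * x0)) = v)
    (hl : ∀ s, ηc ≤ s → s ≤ 1 / ηd → v ≤ max (s * (xd - x0) - lam) (-(s * x0))) :
    phi ηc ηd x0 xd lam = v := by
  unfold phi
  generalize 1 / ηd = k at *
  have hk : 0 < k - ηc := by linarith
  apply IsLeast.csInf_eq
  constructor
  · refine ⟨(k - t) / (k - ηc), ⟨div_nonneg (by linarith) hk.le, ?_⟩, ?_⟩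
    · rw [div_le_one hk]; linarith
    · have e : (k - ηc) * ((k - t) / (k - ηc)) = k - t := by field_simp
      simp only [e]
      rw [← hv]
      congr 1 <;> ring
  · rintro _ ⟨u, ⟨hu0, hu1⟩, rfl⟩
    have := hl (k - (k - ηc) * u) (by nlinarith) (by nlinarith)
    refine this.trans (le_of_eq ?_)
    simp only
    congr 1; ring

/-- closed-form expressions for the optimal value function `φ`
in the three cases `x↓ ≤ x⁰`, `x⁰ ≤ 0`, and `0 ≤ x⁰ ≤ x↓` with `x↓ > 0`. -/
theorem statement14 (ηc ηd : ℝ) (hηc : ηc ∈ Set.Ioo (0:ℝ) 1) (hηd : ηd ∈ Set.Ioo (0:ℝ) 1)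
    (x0 xd lam : ℝ) (hxd : 0 ≤ xd) (hlam : 0 ≤ lam) :
    (xd ≤ x0 →
      phi ηc ηd x0 xd lam = max ((xd - x0) / ηd - lam) (-(x0 / ηd))) ∧
    (x0 ≤ 0 →
      phi ηc ηd x0 xd lam = max (ηc * (xd - x0) - lam) (-(ηc * x0))) ∧
    (0 ≤ x0 → x0 ≤ xd → 0 < xd →
      phi ηc ηd x0 xd lam =
        max (ηc * (xd - x0) - lam) (max (-(lam * x0 / xd)) (-(x0 / ηd)))) := by
  obtain ⟨hc0, hc1⟩ := hηc
  obtain ⟨hd0, hd1⟩ := hηd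
  have hk : 1 < 1 / ηd := by rw [lt_div_iff₀ hd0]; linarith
  have h : ηc < 1 / ηd := by linarith
  have e1 : ∀ y : ℝ, y / ηd = 1 / ηd * y := fun y => by ring
  refine ⟨fun hx => ?_, fun hx => ?_, fun hx hx' hp => ?_⟩
  · rw [e1 (xd - x0), e1 x0]
    refine phi_eq_aux ηc ηd x0 xd lam (1 / ηd) _ h h.le le_rfl rfl fun s hs hs' => ?_
    apply max_le_max <;> nlinarith
  · refine phi_eq_aux ηc ηd x0 xd lam ηc _ h le_rfl h.le rfl fun s hs hs' => ?_
    apply max_le_max <;> nlinarith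
  · have e2 : lam * x0 / xd = lam / xd * x0 := by ring
    have e3 : lam = lam / xd * xd := by field_simp
    rw [e1 x0, e2]
    generalize lam / xd = r at *
    clear e2
    subst e3
    have hl : ∀ s, ηc ≤ s → s ≤ 1 / ηd → max (ηc * (xd - x0) - r * xd) (max (-(r * x0)) (-(1 / ηd * x0)))
        ≤ max (s * (xd - x0) - r * xd) (-(s * x0)) := by
      intro s hs hs'
      refine max_le (le_max_of_le_left (by nlinarith)) (max_le ?_ (le_max_of_le_right (by nlinarith)))
      rcases le_total s r with h' | h'
      · exact le_max_of_le_right (by nlinarith)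
      · exact le_max_of_le_left (by nlinarith)
    have key : ∃ t, ηc ≤ t ∧ t ≤ 1 / ηd ∧ max (t * (xd - x0) - r * xd) (-(t * x0)) ≤
        max (ηc * (xd - x0) - r * xd) (max (-(r * x0)) (-(1 / ηd * x0))) := by
      rcases le_total r ηc with h1 | h1
      · refine ⟨ηc, le_rfl, h.le, max_le (le_max_left _ _) (le_max_of_le_left (by nlinarith))⟩
      rcases le_total r (1 / ηd) with h2 | h2
      · refine ⟨r, h1, h2, le_max_of_le_right (le_max_of_le_left (max_le (by nlinarith) le_rfl))⟩
      · refine ⟨1 / ηd, h.le, le_rfl,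
          le_max_of_le_right (le_max_of_le_right (max_le (by nlinarith) le_rfl))⟩
    obtain ⟨t, ht1, ht2, ht⟩ := key
    exact phi_eq_aux ηc ηd x0 xd _ t _ h ht1 ht2 (le_antisymm ht (hl t ht1 ht2)) hl
end

section
/- Let k be a positive integer, σ ∈ ℝ^k with σ_l ≥ 0 for all l, γ ≥ 0, and c ∈ ℝ^k. Then the maximum of Σ_{l=1}^{k} σ_l·c_l·ξ_l over all ξ ∈ [0,1]^k with Σ_{l=1}^{k} σ_l·ξ_l ≤ γ equals the infimum over λ ≥ 0 of γ·λ + Σ_{l=1}^{k} σ_l·[c_l − λ]⁺, and this infimum is attained. -/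
/-- A dual threshold together with a complementary primal point. -/
theorem exists_threshold (k : ℕ) (σ c : Fin k → ℝ) (hσ : ∀ l, 0 ≤ σ l)
    (γ : ℝ) (hγ : 0 ≤ γ) :
    ∃ lam : ℝ, ∃ t : ℝ, 0 ≤ lam ∧ 0 ≤ t ∧ t ≤ 1 ∧
      (∑ l, σ l * (if lam < c l then 1 else if c l = lam then t else 0)) ≤ γ ∧
      lam * (γ - ∑ l, σ l * (if lam < c l then 1 else if c l = lam then t else 0)) = 0 := by
  classical
  set S : ℝ → ℝ := fun x => ∑ l, σ l * (if x < c l then 1 else 0) with hS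
  set A : Finset ℝ := (insert 0 (Finset.univ.image c)).filter (fun x => 0 ≤ x) with hA
  have h0A : (0:ℝ) ∈ A := by simp [hA]
  have hcA : ∀ l, 0 ≤ c l → c l ∈ A := fun l hl => by simp [hA, hl]
  have hApos : ∀ x ∈ A, 0 ≤ x := fun x hx => (Finset.mem_filter.1 hx).2
  have hB : (A.filter (fun x => S x ≤ γ)).Nonempty := by
    obtain ⟨m, hm, hmax⟩ := A.exists_max_image id ⟨0, h0A⟩
    refine ⟨m, Finset.mem_filter.2 ⟨hm, ?_⟩⟩
    have : S m = 0 := by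
      refine Finset.sum_eq_zero fun l _ => ?_
      rw [if_neg, mul_zero]
      intro h
      have := hmax _ (hcA l ((hApos m hm).trans h.le))
      simp only [id] at this
      linarith
    linarith
  obtain ⟨lam, hlam, hmin⟩ := (A.filter (fun x => S x ≤ γ)).exists_min_image id hB
  obtain ⟨hlA, hSl⟩ := Finset.mem_filter.1 hlam
  have hl0 := hApos _ hlA
  set E : ℝ := ∑ l, σ l * (if c l = lam then 1 else 0) with hE
  have key : ∀ t : ℝ, (∑ l, σ l * (if lam < c l then 1 else if c l = lam then t else 0))
      = S lam + t * E := by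
    intro t
    rw [hS, hE, Finset.mul_sum, ← Finset.sum_add_distrib]
    refine Finset.sum_congr rfl fun l _ => ?_
    by_cases h1 : lam < c l
    · simp [h1, h1.ne']
    · by_cases h2 : c l = lam
      · simp [h2, mul_comm]
      · simp [h1, h2]
  rcases hl0.eq_or_lt with h | hpos
  · refine ⟨lam, 0, hl0, le_rfl, zero_le_one, ?_, ?_⟩
    · rw [key]; linarith
    · rw [← h, zero_mul]
  have hE0 : 0 ≤ E := Finset.sum_nonneg fun l _ => mul_nonneg (hσ l) (by split_ifs <;> simp)
  have hT : γ ≤ S lam + E := by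
    obtain ⟨p, hp, hmax⟩ := (A.filter (fun x => x < lam)).exists_max_image id
      ⟨0, Finset.mem_filter.2 ⟨h0A, hpos⟩⟩
    obtain ⟨hpA, hpl⟩ := Finset.mem_filter.1 hp
    have h1 : γ < S p := by
      by_contra hcon
      have := hmin p (Finset.mem_filter.2 ⟨hpA, not_lt.1 hcon⟩)
      simp only [id] at this
      linarith
    have h2 : S p ≤ S lam + E := by
      have := key 1
      rw [one_mul] at this
      rw [← this]
      refine Finset.sum_le_sum fun l _ => mul_le_mul_of_nonneg_left ?_ (hσ l)
      by_cases hpc : p < c l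
      · have : lam ≤ c l := by
          by_contra hcon
          have := hmax (c l) (Finset.mem_filter.2
            ⟨hcA l ((hApos p hpA).trans hpc.le), not_le.1 hcon⟩)
          simp only [id] at this
          linarith
        rcases this.eq_or_lt with h | h
        · rw [if_pos hpc]; simp [h]
        · simp [h, hpc]
      · rw [if_neg hpc]
        split_ifs <;> simp
    linarith
  rcases hE0.eq_or_lt with h | hEpos
  · refine ⟨lam, 0, hl0, le_rfl, zero_le_one, ?_, ?_⟩
    · rw [key]; linarith
    · rw [key, show γ - (S lam + 0 * E) = 0 by linarith, mul_zero]
  · have ht : (γ - S lam) / E * E = γ - S lam := div_mul_cancel₀ _ hEpos.ne'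
    refine ⟨lam, (γ - S lam) / E, hl0, div_nonneg (by linarith) hE0,
      (div_le_one hEpos).2 (by linarith), ?_, ?_⟩
    · rw [key, ht]; linarith
    · rw [key, ht]; ring

/-- LP duality with a budget constraint: the maximum of
`Σ σ_l·c_l·ξ_l` over `ξ ∈ [0,1]^k` with `Σ σ_l·ξ_l ≤ γ` equals the infimum over
`λ ≥ 0` of `γ·λ + Σ σ_l·[c_l − λ]⁺`, and both are attained. -/
theorem statement15 (k : ℕ) (hk : 0 < k) (σ c : Fin k → ℝ) (hσ : ∀ l, 0 ≤ σ l)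
    (γ : ℝ) (hγ : 0 ≤ γ) :
    ∃ M : ℝ,
      IsGreatest ((fun ξ : Fin k → ℝ => ∑ l, σ l * c l * ξ l) ''
        {ξ : Fin k → ℝ | (∀ l, ξ l ∈ Set.Icc (0:ℝ) 1) ∧ ∑ l, σ l * ξ l ≤ γ}) M ∧
      IsLeast ((fun lam : ℝ => γ * lam + ∑ l, σ l * max (c l - lam) 0) ''
        Set.Ici (0:ℝ)) M := by
  classical
  have weak : ∀ ξ : Fin k → ℝ, (∀ l, ξ l ∈ Set.Icc (0:ℝ) 1) → ∑ l, σ l * ξ l ≤ γ →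
      ∀ lam : ℝ, 0 ≤ lam →
      ∑ l, σ l * c l * ξ l ≤ γ * lam + ∑ l, σ l * max (c l - lam) 0 := by
    intro ξ hξ hb lam hl
    have h1 : ∑ l, σ l * c l * ξ l ≤ ∑ l, (lam * (σ l * ξ l) + σ l * max (c l - lam) 0) := by
      refine Finset.sum_le_sum fun l _ => ?_
      have h2 : (c l - lam) * ξ l ≤ max (c l - lam) 0 := by
        have hm := mul_le_mul_of_nonneg_right (le_max_left (c l - lam) 0) (hξ l).1
        have hn := mul_le_mul_of_nonneg_left (hξ l).2 (le_max_right (c l - lam) 0)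
        linarith
      have := mul_le_mul_of_nonneg_left h2 (hσ l)
      linarith
    rw [Finset.sum_add_distrib, ← Finset.mul_sum] at h1
    have := mul_le_mul_of_nonneg_left hb hl
    linarith
  obtain ⟨lam, t, hl, ht0, ht1, hb, hcs⟩ := exists_threshold k σ c hσ γ hγ
  set ξ : Fin k → ℝ := fun l => if lam < c l then 1 else if c l = lam then t else 0 with hξd
  have hξ : ∀ l, ξ l ∈ Set.Icc (0:ℝ) 1 := by
    intro l
    simp only [hξd]
    split_ifs
    · simp
    · exact ⟨ht0, ht1⟩
    · simp
  have heq : ∑ l, σ l * c l * ξ l = γ * lam + ∑ l, σ l * max (c l - lam) 0 := by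
    have h1 : ∑ l, σ l * c l * ξ l = ∑ l, (lam * (σ l * ξ l) + σ l * max (c l - lam) 0) := by
      refine Finset.sum_congr rfl fun l _ => ?_
      have h2 : (c l - lam) * ξ l = max (c l - lam) 0 := by
        simp only [hξd]
        split_ifs with h h'
        · rw [max_eq_left (by linarith), mul_one]
        · simp [h']
        · rw [max_eq_right (by linarith), mul_zero]
      rw [← h2]; ring
    rw [Finset.sum_add_distrib, ← Finset.mul_sum] at h1
    change lam * (γ - ∑ l, σ l * ξ l) = 0 at hcs
    linarith
  refine ⟨∑ l, σ l * c l * ξ l, ⟨⟨ξ, ⟨hξ, hb⟩, rfl⟩, ?_⟩, ⟨⟨lam, hl, heq.symm⟩, ?_⟩⟩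
  · rintro _ ⟨η, ⟨hη, hηb⟩, rfl⟩
    rw [heq]
    exact weak η hη hηb lam hl
  · rintro _ ⟨μ, hμ, rfl⟩
    exact weak ξ hξ hb μ hμ
end

section
/- Let k be a positive integer, Δt > 0, γ ≥ 0, Λ > 0, and let φ₁, …, φ_k : [0, Λ] → ℝ be convex and continuous. Then sup over s ∈ [0, Δt] of ( min over λ ∈ [0, Λ] of ( γ·λ + Δt·Σ_{l=1}^{k−1} φ_l(λ) + s·φ_k(λ) ) ) equals min over λ ∈ [0, Λ] of ( γ·λ + Δt·Σ_{l=1}^{k−1} φ_l(λ) + Δt·[φ_k(λ)]⁺ ). -/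
/-- for convex continuous `φ₁, …, φ_k : [0, Λ] → ℝ`,
`sup_{s ∈ [0,Δt]} min_{λ ∈ [0,Λ]} (γ·λ + Δt·Σ_{l<k} φ_l(λ) + s·φ_k(λ))`
equals `min_{λ ∈ [0,Λ]} (γ·λ + Δt·Σ_{l<k} φ_l(λ) + Δt·[φ_k(λ)]⁺)`. -/
theorem statement16 (k : ℕ) (hk : 0 < k) (Δt γ Λ : ℝ)
    (hΔt : 0 < Δt) (hγ : 0 ≤ γ) (hΛ : 0 < Λ)
    (φ : ℕ → ℝ → ℝ)
    (hconv : ∀ l, 1 ≤ l → l ≤ k → ConvexOn ℝ (Set.Icc 0 Λ) (φ l))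
    (hcont : ∀ l, 1 ≤ l → l ≤ k → ContinuousOn (φ l) (Set.Icc 0 Λ)) :
    sSup ((fun s : ℝ =>
        sInf ((fun lam : ℝ =>
            γ * lam + Δt * ∑ l ∈ Finset.Ico 1 k, φ l lam + s * φ k lam) ''
          Set.Icc (0:ℝ) Λ)) '' Set.Icc (0:ℝ) Δt) =
      sInf ((fun lam : ℝ =>
          γ * lam + Δt * ∑ l ∈ Finset.Ico 1 k, φ l lam + Δt * max (φ k lam) 0) ''
        Set.Icc (0:ℝ) Λ) := by
  classical
  set g : ℝ → ℝ := fun lam => γ * lam + Δt * ∑ l ∈ Finset.Ico 1 k, φ l lam with hg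
  have hk1 : 1 ≤ k := hk
  have gcont : ContinuousOn g (Set.Icc 0 Λ) := by
    refine ContinuousOn.add (by fun_prop) (continuousOn_const.mul ?_)
    refine continuousOn_finsetSum _ fun l hl => ?_
    rw [Finset.mem_Ico] at hl
    exact hcont l hl.1 hl.2.le
  have sumconv : ∀ t : Finset ℕ, (∀ l ∈ t, 1 ≤ l ∧ l ≤ k) →
      ConvexOn ℝ (Set.Icc 0 Λ) (fun lam => ∑ l ∈ t, φ l lam) := by
    intro t
    induction t using Finset.induction_on with
    | empty =>
      intro _
      simpa using convexOn_const (0:ℝ) (convex_Icc (0:ℝ) Λ)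
    | insert a t ha ih =>
      intro h
      have h1 := hconv a (h a (by simp)).1 (h a (by simp)).2
      have h2 := h1.add (ih fun l hl => h l (by simp [hl]))
      refine h2.congr fun x _ => ?_
      simp [Finset.sum_insert ha]
  have gconv : ConvexOn ℝ (Set.Icc 0 Λ) g := by
    have h1 : ConvexOn ℝ (Set.Icc 0 Λ) (fun lam : ℝ => γ * lam) :=
      (convexOn_id (convex_Icc (0:ℝ) Λ)).smul hγ
    have h2 := (sumconv (Finset.Ico 1 k) (fun l hl => by
      rw [Finset.mem_Ico] at hl; exact ⟨hl.1, hl.2.le⟩)).smul hΔt.le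
    exact h1.add h2
  have fcont : ∀ s : ℝ, ContinuousOn (fun lam => g lam + s * φ k lam) (Set.Icc 0 Λ) :=
    fun s => gcont.add (continuousOn_const.mul (hcont k hk1 le_rfl))
  have fconv : ∀ s : ℝ, 0 ≤ s → ConvexOn ℝ (Set.Icc 0 Λ) (fun lam => g lam + s * φ k lam) :=
    fun s hs => gconv.add ((hconv k hk1 le_rfl).smul hs)
  have ne : (Set.Icc (0:ℝ) Λ).Nonempty := ⟨0, le_rfl, hΛ.le⟩
  obtain ⟨a, ha, b, hb, hab⟩ := Sion.exists_isSaddlePointOn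
    (X := Set.Icc (0:ℝ) Λ) (Y := Set.Icc (0:ℝ) Δt) (f := fun lam s => g lam + s * φ k lam)
    ne (convex_Icc _ _) isCompact_Icc
    (fun s _ => (fcont s).lowerSemicontinuousOn)
    (fun s hs => (fconv s hs.1).quasiconvexOn)
    (convex_Icc _ _) ⟨0, le_rfl, hΔt.le⟩ isCompact_Icc
    (fun x _ => Continuous.continuousOn (by fun_prop) |>.upperSemicontinuousOn)
    (fun x _ => by
      refine ConcaveOn.quasiconcaveOn ⟨convex_Icc _ _, ?_⟩
      intro u _ v _ p q _ _ hpq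
      simp only [smul_eq_mul]
      have : p = 1 - q := by linarith
      subst this
      apply le_of_eq
      ring)
  have hab' : ∀ x ∈ Set.Icc (0:ℝ) Λ, ∀ s ∈ Set.Icc (0:ℝ) Δt,
      g a + s * φ k a ≤ g x + b * φ k x := hab
  have hL : IsGreatest ((fun s : ℝ => sInf ((fun lam : ℝ => g lam + s * φ k lam) ''
      Set.Icc (0:ℝ) Λ)) '' Set.Icc (0:ℝ) Δt) (g a + b * φ k a) := by
    constructor
    · refine ⟨b, hb, IsLeast.csInf_eq ⟨⟨a, ha, rfl⟩, ?_⟩⟩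
      rintro _ ⟨x, hx, rfl⟩
      exact hab' x hx b hb
    · rintro _ ⟨s, hs, rfl⟩
      exact (csInf_le (isCompact_Icc.image_of_continuousOn (fcont s)).bddBelow
        ⟨a, ha, rfl⟩).trans (hab' a ha s hs)
  have hR : IsLeast ((fun lam : ℝ => g lam + Δt * max (φ k lam) 0) '' Set.Icc (0:ℝ) Λ)
      (g a + b * φ k a) := by
    have key : ∀ x, g x + b * φ k x ≤ g x + Δt * max (φ k x) 0 := by
      intro x
      have h1 : b * φ k x ≤ b * max (φ k x) 0 :=
        mul_le_mul_of_nonneg_left (le_max_left _ _) hb.1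
      have h2 : b * max (φ k x) 0 ≤ Δt * max (φ k x) 0 :=
        mul_le_mul_of_nonneg_right hb.2 (le_max_right _ _)
      linarith
    constructor
    · refine ⟨a, ha, le_antisymm ?_ (key a)⟩
      have h0 := hab' a ha 0 ⟨le_rfl, hΔt.le⟩
      have h1 := hab' a ha Δt ⟨hΔt.le, le_rfl⟩
      rcases le_total (φ k a) 0 with h | h
      · simpa [max_eq_right h] using h0
      · simpa [max_eq_left h] using h1
    · rintro _ ⟨x, hx, rfl⟩
      exact (hab' x hx b hb).trans (key x)
  exact hL.csSup_eq.trans hR.csInf_eq.symm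
end

section
/- Let k be a positive integer, σ ∈ ℝ^k with σ_l ≥ 0 for all l, γ ≥ 0, x⁰ ∈ ℝ^k, and x↓ ∈ ℝ^k with x↓_l ≥ 0 for all l. Then the maximum of Σ_{l=1}^{k} σ_l·min{ ηc·(ξ_l·x↓_l − x⁰_l), (ξ_l·x↓_l − x⁰_l)/ηd } over all ξ ∈ [0,1]^k with Σ_{l=1}^{k} σ_l·ξ_l ≤ γ equals the infimum over λ ≥ 0 of γ·λ + Σ_{l=1}^{k} σ_l·φ(x⁰_l, x↓_l, λ), and this infimum is attained. -/
noncomputable def ff (ηc ηd x0 xd t : ℝ) : ℝ :=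
  min (ηc * (t * xd - x0)) ((t * xd - x0) / ηd)

lemma weak_aux {c d x0 xd lam t s : ℝ} (hcs : c ≤ s) (hsd : s ≤ d)
    (ht : t ∈ Set.Icc (0:ℝ) 1) :
    min (c * (t * xd - x0)) (d * (t * xd - x0)) - lam * t
      ≤ max (s * (xd - x0) - lam) (-s * x0) := by
  obtain ⟨h0, h1⟩ := ht
  have h2 : min (c * (t * xd - x0)) (d * (t * xd - x0)) ≤ s * (t * xd - x0) := by
    rcases le_total 0 (t * xd - x0) with hz | hz
    · exact (min_le_left _ _).trans (mul_le_mul_of_nonneg_right hcs hz)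
    · exact (min_le_right _ _).trans (mul_le_mul_of_nonpos_right hsd hz)
  have h3 := mul_le_mul_of_nonneg_left (le_max_left (s * (xd - x0) - lam) (-s * x0)) h0
  have h4 := mul_le_mul_of_nonneg_left (le_max_right (s * (xd - x0) - lam) (-s * x0))
    (sub_nonneg.2 h1)
  linarith

lemma strong_aux {c d x0 xd lam : ℝ} (hcd : c ≤ d) (hxd : 0 ≤ xd) :
    ∃ s ∈ Set.Icc c d, ∃ t ∈ Set.Icc (0:ℝ) 1,
      max (s * (xd - x0) - lam) (-s * x0) ≤
        min (c * (t * xd - x0)) (d * (t * xd - x0)) - lam * t := by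
  rcases le_total x0 0 with h | h
  · refine ⟨c, ⟨le_rfl, hcd⟩, ?_⟩
    have key : ∀ t : ℝ, 0 ≤ t → min (c * (t * xd - x0)) (d * (t * xd - x0)) = c * (t * xd - x0) := by
      intro t ht
      exact min_eq_left (mul_le_mul_of_nonneg_right hcd (by nlinarith))
    rcases le_total (c * (xd - x0) - lam) (-c * x0) with h' | h'
    · refine ⟨0, by simp, ?_⟩
      rw [max_eq_right h', key 0 le_rfl]; linarith
    · refine ⟨1, by simp, ?_⟩
      rw [max_eq_left h', key 1 zero_le_one]; linarith
  rcases le_total xd x0 with h2 | h2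
  · refine ⟨d, ⟨hcd, le_rfl⟩, ?_⟩
    have key : ∀ t : ℝ, t ≤ 1 → min (c * (t * xd - x0)) (d * (t * xd - x0)) = d * (t * xd - x0) := by
      intro t ht
      exact min_eq_right (mul_le_mul_of_nonpos_right hcd (by nlinarith))
    rcases le_total (d * (xd - x0) - lam) (-d * x0) with h' | h'
    · refine ⟨0, by simp, ?_⟩
      rw [max_eq_right h', key 0 zero_le_one]; linarith
    · refine ⟨1, by simp, ?_⟩
      rw [max_eq_left h', key 1 le_rfl]; linarith
  rcases le_total lam (c * xd) with h3 | h3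
  · refine ⟨c, ⟨le_rfl, hcd⟩, 1, by simp, ?_⟩
    rw [max_eq_left (by linarith), min_eq_left (mul_le_mul_of_nonneg_right hcd (by linarith))]
    linarith
  rcases le_total (d * xd) lam with h4 | h4
  · refine ⟨d, ⟨hcd, le_rfl⟩, 0, by simp, ?_⟩
    rw [max_eq_right (by linarith), min_eq_right (mul_le_mul_of_nonpos_right hcd (by linarith))]
    linarith
  rcases hxd.eq_or_lt with h5 | h5
  · subst h5
    refine ⟨c, ⟨le_rfl, hcd⟩, 0, by simp, ?_⟩
    have : x0 = 0 := le_antisymm h2 h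
    subst this
    simp at *
    linarith
  · refine ⟨lam / xd, ⟨(le_div_iff₀ h5).2 h3, (div_le_iff₀ h5).2 h4⟩, x0 / xd,
      ⟨by positivity, (div_le_one h5).2 h2⟩, ?_⟩
    have e : x0 / xd * xd - x0 = 0 := by field_simp; ring
    rw [e]
    simp only [mul_zero, min_self]
    apply max_le
    · apply le_of_eq; field_simp; ring
    · apply le_of_eq; field_simp; ring

lemma phi_spec {ηc ηd : ℝ} (hηc : ηc ∈ Set.Ioo (0:ℝ) 1) (hηd : ηd ∈ Set.Ioo (0:ℝ) 1)
    {x0 xd lam : ℝ} (hxd : 0 ≤ xd) :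
    (∀ t ∈ Set.Icc (0:ℝ) 1, ff ηc ηd x0 xd t - lam * t ≤ phi ηc ηd x0 xd lam) ∧
    ∃ t ∈ Set.Icc (0:ℝ) 1, phi ηc ηd x0 xd lam ≤ ff ηc ηd x0 xd t - lam * t := by
  have hd : 1 < 1 / ηd := by rw [lt_div_iff₀ hηd.1]; linarith [hηd.2]
  have hff : ∀ t, ff ηc ηd x0 xd t = min (ηc * (t * xd - x0)) (1 / ηd * (t * xd - x0)) := by
    intro t; unfold ff; congr 1; ring
  simp only [hff]
  unfold phi
  generalize 1 / ηd = d at *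
  have hcd : ηc < d := by linarith [hηc.2]
  have weak : ∀ u ∈ Set.Icc (0:ℝ) 1, ∀ t ∈ Set.Icc (0:ℝ) 1,
      min (ηc * (t * xd - x0)) (d * (t * xd - x0)) - lam * t ≤
      max ((d - (d - ηc) * u) * (xd - x0) - lam) (((d - ηc) * u - d) * x0) := by
    intro u hu t ht
    have := weak_aux (c := ηc) (d := d) (x0 := x0) (xd := xd) (lam := lam) (s := d - (d - ηc) * u)
      (by nlinarith [hu.2]) (by nlinarith [hu.1]) ht
    rwa [neg_sub] at this
  constructor
  · intro t ht
    apply le_csInf ((Set.nonempty_Icc.2 zero_le_one).image _)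
    rintro _ ⟨u, hu, rfl⟩
    exact weak u hu t ht
  · obtain ⟨s, hs, t, ht, h⟩ := strong_aux (x0 := x0) (lam := lam) hcd.le hxd
    refine ⟨t, ht, le_trans (csInf_le ?_ ⟨(d - s) / (d - ηc), ?_, rfl⟩) ?_⟩
    · refine ⟨min (ηc * (0 * xd - x0)) (d * (0 * xd - x0)) - lam * 0, ?_⟩
      rintro _ ⟨u, hu, rfl⟩
      exact weak u hu 0 (by simp)
    · have : 0 < d - ηc := by linarith
      exact ⟨div_nonneg (by linarith [hs.2]) this.le, (div_le_one this).2 (by linarith [hs.1])⟩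
    · have e : (d - ηc) * ((d - s) / (d - ηc)) = d - s := by
        have : d - ηc ≠ 0 := by linarith
        field_simp
      simp only [e]
      have e1 : d - (d - s) = s := by ring
      have e2 : d - s - d = -s := by ring
      rw [e1, e2]
      exact h

lemma ff_lip {ηc ηd : ℝ} (hηc : ηc ∈ Set.Ioo (0:ℝ) 1) (hηd : ηd ∈ Set.Ioo (0:ℝ) 1)
    {x0 xd t : ℝ} (hxd : 0 ≤ xd) (ht : 0 ≤ t) :
    ff ηc ηd x0 xd t ≤ ff ηc ηd x0 xd 0 + xd / ηd * t := by
  have hd : 1 < 1 / ηd := by rw [lt_div_iff₀ hηd.1]; linarith [hηd.2]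
  unfold ff
  rw [div_eq_mul_one_div (t * xd - x0) ηd, div_eq_mul_one_div (0 * xd - x0) ηd,
    div_eq_mul_one_div xd ηd]
  generalize 1 / ηd = d at *
  rw [← sub_le_iff_le_add]
  apply le_min
  · have h1 : ηc * (t * xd) ≤ d * (t * xd) :=
      mul_le_mul_of_nonneg_right (by linarith [hηc.2]) (by positivity)
    have := min_le_left (ηc * (t * xd - x0)) ((t * xd - x0) * d)
    linarith
  · have := min_le_right (ηc * (t * xd - x0)) ((t * xd - x0) * d)
    linarith

lemma ff_concave (ηc ηd x0 xd : ℝ) : ConcaveOn ℝ Set.univ (ff ηc ηd x0 xd) := by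
  have h1 : ConcaveOn ℝ Set.univ (fun t : ℝ => ηc * (t * xd - x0)) := by
    refine ⟨convex_univ, fun x _ y _ a b _ _ hab => le_of_eq ?_⟩
    simp only [smul_eq_mul]
    linear_combination (-ηc * x0) * hab
  have h2 : ConcaveOn ℝ Set.univ (fun t : ℝ => (t * xd - x0) / ηd) := by
    refine ⟨convex_univ, fun x _ y _ a b _ _ hab => le_of_eq ?_⟩
    simp only [smul_eq_mul]
    linear_combination (-x0 / ηd) * hab
  exact h1.inf h2

lemma ff_cont (ηc ηd x0 xd : ℝ) : Continuous (ff ηc ηd x0 xd) := by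
  unfold ff; fun_prop

/-- the maximum of the concave budget-constrained problem
`max Σ σ_l·min{ηc·(ξ_l·x↓_l − x⁰_l), (ξ_l·x↓_l − x⁰_l)/ηd}` over `ξ ∈ [0,1]^k`
with `Σ σ_l·ξ_l ≤ γ` equals the infimum over `λ ≥ 0` of
`γ·λ + Σ σ_l·φ(x⁰_l, x↓_l, λ)`, and both are attained. -/
theorem statement17 (ηc ηd : ℝ) (hηc : ηc ∈ Set.Ioo (0:ℝ) 1) (hηd : ηd ∈ Set.Ioo (0:ℝ) 1)
    (k : ℕ) (hk : 0 < k) (σ : Fin k → ℝ) (hσ : ∀ l, 0 ≤ σ l)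
    (γ : ℝ) (hγ : 0 ≤ γ)
    (x0 xd : Fin k → ℝ) (hxd : ∀ l, 0 ≤ xd l) :
    ∃ M : ℝ,
      IsGreatest ((fun ξ : Fin k → ℝ =>
          ∑ l, σ l * min (ηc * (ξ l * xd l - x0 l)) ((ξ l * xd l - x0 l) / ηd)) ''
        {ξ : Fin k → ℝ | (∀ l, ξ l ∈ Set.Icc (0:ℝ) 1) ∧ ∑ l, σ l * ξ l ≤ γ}) M ∧
      IsLeast ((fun lam : ℝ =>
          γ * lam + ∑ l, σ l * phi ηc ηd (x0 l) (xd l) lam) '' Set.Ici (0:ℝ)) M := by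
  change ∃ M : ℝ,
      IsGreatest ((fun ξ : Fin k → ℝ => ∑ l, σ l * ff ηc ηd (x0 l) (xd l) (ξ l)) ''
        {ξ : Fin k → ℝ | (∀ l, ξ l ∈ Set.Icc (0:ℝ) 1) ∧ ∑ l, σ l * ξ l ≤ γ}) M ∧
      IsLeast ((fun lam : ℝ =>
          γ * lam + ∑ l, σ l * phi ηc ηd (x0 l) (xd l) lam) '' Set.Ici (0:ℝ)) M
  have hsp := fun (lam : ℝ) (l : Fin k) => phi_spec hηc hηd (x0 := x0 l) (lam := lam) (hxd l)
  set L : ℝ := 1 + ∑ l, xd l / ηd with hL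
  have hdn : ∀ l, 0 ≤ xd l / ηd := fun l => div_nonneg (hxd l) hηd.1.le
  have hLl : ∀ l, xd l / ηd + 1 ≤ L := by
    intro l
    have := Finset.single_le_sum (f := fun l => xd l / ηd) (fun i _ => hdn i) (Finset.mem_univ l)
    linarith
  have hL0 : 0 ≤ L := by
    have := Finset.sum_nonneg (s := Finset.univ) (fun i _ => hdn i)
    linarith
  let F : ℝ → (Fin k → ℝ) → ℝ := fun lam ξ =>
    γ * lam + ∑ l, σ l * (ff ηc ηd (x0 l) (xd l) (ξ l) - lam * ξ l)
  have hF : ∀ lam ξ, F lam ξ =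
      ∑ l, σ l * ff ηc ηd (x0 l) (xd l) (ξ l) + (γ - ∑ l, σ l * ξ l) * lam := by
    intro lam ξ
    simp only [F, mul_sub, Finset.sum_sub_distrib, sub_mul, Finset.sum_mul]
    have : ∑ l, σ l * (lam * ξ l) = ∑ l, σ l * ξ l * lam :=
      Finset.sum_congr rfl fun _ _ => by ring
    rw [this]; ring
  obtain ⟨a, ha, b, hb, hab⟩ : ∃ a ∈ Set.Icc (0:ℝ) L,
      ∃ b ∈ Set.Icc (0 : Fin k → ℝ) 1, IsSaddlePointOn (Set.Icc (0:ℝ) L)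
        (Set.Icc (0 : Fin k → ℝ) 1) F a b := by
    apply Sion.exists_isSaddlePointOn
    · exact Set.nonempty_Icc.2 hL0
    · exact convex_Icc _ _
    · exact isCompact_Icc
    · intro y _
      refine LowerSemicontinuous.lowerSemicontinuousOn (Continuous.lowerSemicontinuous ?_) _
      simp only [F]; fun_prop
    · intro y _
      apply ConvexOn.quasiconvexOn
      refine ⟨convex_Icc _ _, fun x _ z _ p q _ _ hpq => le_of_eq ?_⟩
      simp only [hF, smul_eq_mul]
      linear_combination (-∑ l, σ l * ff ηc ηd (x0 l) (xd l) (y l)) * hpq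
    · exact convex_Icc _ _
    · exact Set.nonempty_Icc.2 zero_le_one
    · exact isCompact_Icc
    · intro x _
      refine UpperSemicontinuous.upperSemicontinuousOn (Continuous.upperSemicontinuous ?_) _
      have := fun l => ff_cont ηc ηd (x0 l) (xd l)
      simp only [F]; fun_prop
    · intro x _
      apply ConcaveOn.quasiconcaveOn
      refine ⟨convex_Icc _ _, fun y _ z _ p q hp hq hpq => ?_⟩
      have h1 : ∀ l, p * (σ l * (ff ηc ηd (x0 l) (xd l) (y l) - x * y l)) +
          q * (σ l * (ff ηc ηd (x0 l) (xd l) (z l) - x * z l)) ≤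
          σ l * (ff ηc ηd (x0 l) (xd l) (p * y l + q * z l) - x * (p * y l + q * z l)) := by
        intro l
        have := (ff_concave ηc ηd (x0 l) (xd l)).2 (Set.mem_univ (y l)) (Set.mem_univ (z l)) hp hq hpq
        simp only [smul_eq_mul] at this
        have := mul_le_mul_of_nonneg_left this (hσ l)
        linarith
      have h2 := Finset.sum_le_sum (s := Finset.univ) fun l _ => h1 l
      rw [Finset.sum_add_distrib, ← Finset.mul_sum, ← Finset.mul_sum] at h2
      simp only [F, smul_eq_mul, Pi.add_apply, Pi.smul_apply]
      have h3 : γ * x = p * (γ * x) + q * (γ * x) := by linear_combination (-γ * x) * hpq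
      linarith
  have hb' : ∀ l, b l ∈ Set.Icc (0:ℝ) 1 := fun l => ⟨hb.1 l, hb.2 l⟩
  have hfeas : ∑ l, σ l * b l ≤ γ := by
    by_contra! hlt
    have e1 := hab L ⟨hL0, le_rfl⟩ b hb
    have e2 := hab L ⟨hL0, le_rfl⟩ 0 ⟨le_rfl, zero_le_one⟩
    rw [hF, hF] at e1 e2
    have haL : a = L := by
      apply le_antisymm ha.2
      by_contra! hc
      nlinarith
    have h1 : ∀ l, σ l * ff ηc ηd (x0 l) (xd l) (b l) + σ l * b l ≤
        σ l * ff ηc ηd (x0 l) (xd l) 0 + σ l * b l * L := by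
      intro l
      have k1 := ff_lip hηc hηd (x0 := x0 l) (hxd l) (hb' l).1
      have k2 := mul_le_mul_of_nonneg_right (hLl l) (hb' l).1
      have k3 : ff ηc ηd (x0 l) (xd l) (b l) + b l ≤ ff ηc ηd (x0 l) (xd l) 0 + b l * L := by
        linarith
      have := mul_le_mul_of_nonneg_left k3 (hσ l)
      linarith
    have h2 := Finset.sum_le_sum (s := Finset.univ) fun l _ => h1 l
    rw [Finset.sum_add_distrib, Finset.sum_add_distrib, ← Finset.sum_mul] at h2
    simp only [Pi.zero_apply, mul_zero, Finset.sum_const_zero] at e2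
    rw [haL] at e2
    linarith
  have hcs : (γ - ∑ l, σ l * b l) * a ≤ 0 := by
    have e1 := hab 0 ⟨le_rfl, hL0⟩ b hb
    rw [hF, hF] at e1
    linarith
  have hcs' : (γ - ∑ l, σ l * b l) * a = 0 :=
    le_antisymm hcs (mul_nonneg (by linarith) ha.1)
  -- weak duality
  have hweak : ∀ lam, 0 ≤ lam → ∀ ξ : Fin k → ℝ, (∀ l, ξ l ∈ Set.Icc (0:ℝ) 1) →
      ∑ l, σ l * ξ l ≤ γ → ∑ l, σ l * ff ηc ηd (x0 l) (xd l) (ξ l) ≤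
        γ * lam + ∑ l, σ l * phi ηc ηd (x0 l) (xd l) lam := by
    intro lam hlam ξ hξ hs
    have e1 : F lam ξ ≤ γ * lam + ∑ l, σ l * phi ηc ηd (x0 l) (xd l) lam := by
      simp only [F]
      gcongr with l _
      · exact hσ l
      · exact (hsp lam l).1 _ (hξ l)
    rw [hF] at e1
    have := mul_nonneg (sub_nonneg.2 hs) hlam
    linarith
  have hstrong : γ * a + ∑ l, σ l * phi ηc ηd (x0 l) (xd l) a ≤
      ∑ l, σ l * ff ηc ηd (x0 l) (xd l) (b l) := by
    choose y hy hy2 using fun l => (hsp a l).2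
    have e1 := hab a ha y ⟨fun l => (hy l).1, fun l => (hy l).2⟩
    have e2 : γ * a + ∑ l, σ l * phi ηc ηd (x0 l) (xd l) a ≤ F a y := by
      simp only [F]
      gcongr with l _
      · exact hσ l
      · exact hy2 l
    rw [hF a b, hcs', add_zero] at e1
    exact e2.trans e1
  refine ⟨∑ l, σ l * ff ηc ηd (x0 l) (xd l) (b l), ⟨⟨b, ⟨hb', hfeas⟩, rfl⟩, ?_⟩,
    ⟨a, ha.1, le_antisymm hstrong (hweak a ha.1 b hb' hfeas)⟩, ?_⟩
  · rintro _ ⟨ξ, ⟨h1, h2⟩, rfl⟩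
    exact (hweak a ha.1 ξ h1 h2).trans hstrong
  · rintro _ ⟨lam, hlam, rfl⟩
    exact hweak lam hlam b hb' hfeas
end

section
/- Suppose (i) x̲ ≤ x⁰_1 − xr_1 and x⁰_1 + xr_1 ≤ x̄; (ii) there exists λ ∈ ℝ^K with λ_k ≥ 0 such that for every k ∈ {1,…,K−1}: x⁰_{k+1} − xr_{k+1} − (γ′/Δt)·λ_k − Σ_{i=ī(k+1)}^{k} [ (Δt/(Γ′ − Δt))·xr_i − λ_k ]⁺ ≥ x̲ and x⁰_{k+1} + xr_{k+1} + (γ′/Δt)·λ_k + Σ_{i=ī(k+1)}^{k} [ (Δt/(Γ′ − Δt))·xr_i − λ_k ]⁺ ≤ x̄; and (iii) for every measurable ξ̃ : [0,T] → [−1,1] with ∫₀ᵀ |ξ̃(τ)| dτ ≤ γ′ and every t ∈ [0,T], y̲ ≤ y₀ − ∫₀ᵗ ( x⁰(τ) + ξ̃(τ)·xr(τ) ) dτ ≤ ȳ. Then for every ξ ∈ Ξ′: (a) x̲ ≤ x⁰_k + xa_k − xr_k and x⁰_k + xa_k + xr_k ≤ x̄ for all k ∈ {1,…,K}; and (b)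 y̲ ≤ y₀ − ∫₀ᵗ ( x⁰(τ) + xa(τ) + ξ(τ)·xr(τ) ) dτ ≤ ȳ for all t ∈ [0,T]. -/
open MeasureTheory

open Classical in
/-- The piecewise constant function on `[0, K·Δt)` with (1-indexed) values `v k`
on the trading intervals `𝒯_k = [(k−1)·Δt, k·Δt)`, and `0` elsewhere. -/
noncomputable def pcFun (Δt : ℝ) (K : ℕ) (v : ℕ → ℝ) : ℝ → ℝ :=
  fun τ => if 0 ≤ τ ∧ τ < (K : ℝ) * Δt then v ((⌊τ / Δt⌋).toNat + 1) else 0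

/-- Membership in the sliding-window uncertainty set
`Ξ′ = {ξ : [0,T] → [−1,1] measurable, ∫_{max{t−Γ′,0}}^{t} |ξ| ≤ γ′ for all t}`,
where `Γ′ = M·Δt` and `γ′ = g·Δt`. -/
def memXiSlide (Δt : ℝ) (K M g : ℕ) (ξ : ℝ → ℝ) : Prop :=
  Measurable ξ ∧ (∀ τ, ξ τ ∈ Set.Icc (-1:ℝ) 1) ∧
  ∀ t ∈ Set.Icc (0:ℝ) ((K : ℝ) * Δt),
    (∫ τ in (max (t - (M : ℝ) * Δt) 0)..t, |ξ τ|) ≤ (g : ℝ) * Δt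

/-- The intraday adjustments (1-indexed): `xa_1 = 0` and
`xa_{k+1} = −(1/(Γ′ − Δt))·Σ_{i = ī(k+1)}^{k} xr_i·∫_{(i−1)·Δt}^{i·Δt} ξ(τ) dτ`,
with `ī(j) = max{1, j − M + 1}` (which is `j - M + 1` in ℕ-subtraction). -/
noncomputable def xaVec (Δt : ℝ) (M : ℕ) (xr : ℕ → ℝ) (ξ : ℝ → ℝ) : ℕ → ℝ :=
  fun j =>
    if j ≤ 1 then 0
    else
      -(1 / ((M : ℝ) * Δt - Δt)) *
        ∑ i ∈ Finset.Icc (j - M + 1) (j - 1),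
          xr i * ∫ τ in (((i : ℝ) - 1) * Δt)..((i : ℝ) * Δt), ξ τ

lemma aux_pc_eq {Δt : ℝ} (hΔt : 0 < Δt) {K : ℕ} (v : ℕ → ℝ) {n : ℕ} (hn : n < K) {τ : ℝ}
    (h1 : (n : ℝ) * Δt ≤ τ) (h2 : τ < ((n + 1 : ℕ) : ℝ) * Δt) :
    pcFun Δt K v τ = v (n + 1) := by
  have h0 : 0 ≤ (n : ℝ) * Δt := by positivity
  have hK : ((n + 1 : ℕ) : ℝ) * Δt ≤ (K : ℝ) * Δt := by
    have : ((n + 1 : ℕ) : ℝ) ≤ (K : ℝ) := by exact_mod_cast hn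
    exact mul_le_mul_of_nonneg_right this hΔt.le
  have hf : ⌊τ / Δt⌋ = (n : ℤ) := by
    rw [Int.floor_eq_iff]
    constructor
    · rw [le_div_iff₀ hΔt]; exact_mod_cast h1
    · rw [div_lt_iff₀ hΔt]; push_cast at h2 ⊢; exact h2
  unfold pcFun
  rw [if_pos ⟨by linarith, by linarith⟩, hf]
  simp

lemma aux_pc_exists {Δt : ℝ} (hΔt : 0 < Δt) {K : ℕ} {τ : ℝ}
    (h0 : 0 ≤ τ) (hK : τ < (K : ℝ) * Δt) :
    ∃ n : ℕ, n < K ∧ (n : ℝ) * Δt ≤ τ ∧ τ < ((n + 1 : ℕ) : ℝ) * Δt := by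
  have hd : 0 ≤ τ / Δt := by positivity
  have ha : (⌊τ / Δt⌋₊ : ℝ) * Δt ≤ τ := by
    rw [← le_div_iff₀ hΔt]; exact Nat.floor_le hd
  refine ⟨⌊τ / Δt⌋₊, ?_, ha, ?_⟩
  · have : (⌊τ / Δt⌋₊ : ℝ) * Δt < (K : ℝ) * Δt := by linarith
    exact_mod_cast lt_of_mul_lt_mul_right this hΔt.le
  · rw [← div_lt_iff₀ hΔt]; push_cast; exact Nat.lt_floor_add_one _

lemma aux_pc_meas (Δt : ℝ) (K : ℕ) (v : ℕ → ℝ) : Measurable (pcFun Δt K v) := by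
  unfold pcFun
  refine Measurable.ite ?_ ?_ measurable_const
  · exact (measurableSet_le measurable_const measurable_id).inter
      (measurableSet_lt measurable_id measurable_const)
  · have h : Measurable (fun z : ℤ => v (z.toNat + 1)) := measurable_from_top
    exact h.comp (Int.measurable_floor.comp (measurable_id.div_const Δt))

/-- Integral of a product with a piecewise constant function. -/
lemma aux_pc_int {Δt : ℝ} (hΔt : 0 < Δt) {K : ℕ} (v : ℕ → ℝ) (f : ℝ → ℝ)
    (hf : ∀ a b, IntervalIntegrable f volume a b) {t : ℝ} (ht : t ∈ Set.Icc (0:ℝ) ((K : ℝ) * Δt)) :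
    IntervalIntegrable (fun τ => f τ * pcFun Δt K v τ) volume 0 t ∧
    ∫ τ in (0:ℝ)..t, f τ * pcFun Δt K v τ =
      ∑ n ∈ Finset.range K, v (n + 1) *
        ∫ τ in (min ((n : ℝ) * Δt) t)..(min (((n + 1 : ℕ) : ℝ) * Δt) t), f τ := by
  obtain ⟨ht0, htK⟩ := ht
  set a : ℕ → ℝ := fun n => min ((n : ℝ) * Δt) t with ha
  have hmono : ∀ n, a n ≤ a (n + 1) := by
    intro n
    apply min_le_min_right
    push_cast
    nlinarith
  have hE : ∀ n < K, Set.EqOn (fun τ => f τ * v (n + 1)) (fun τ => f τ * pcFun Δt K v τ)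
      (Set.uIoo (a n) (a (n + 1))) := by
    intro n hn τ hτ
    rw [Set.uIoo_of_le (hmono n)] at hτ
    obtain ⟨hl, hr⟩ := hτ
    have hr' := lt_min_iff.mp hr
    have hl' : (n : ℝ) * Δt ≤ τ := by
      rcases min_lt_iff.mp hl with h | h
      · exact h.le
      · linarith [hr'.2]
    simp only
    rw [aux_pc_eq hΔt v hn hl' hr'.1]
  have hI : ∀ n < K, IntervalIntegrable (fun τ => f τ * pcFun Δt K v τ) volume (a n) (a (n + 1)) :=
    fun n hn => ((hf _ _).mul_const _).congr_uIoo (hE n hn)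
  have ha0 : a 0 = 0 := by simp [ha, ht0]
  have haK : a K = t := by simp [ha, htK]
  have h1 := IntervalIntegrable.trans_iterate hI
  have h2 := intervalIntegral.sum_integral_adjacent_intervals hI
  rw [ha0, haK] at h1 h2
  refine ⟨h1, ?_⟩
  rw [← h2]
  refine Finset.sum_congr rfl fun n hn => ?_
  rw [← intervalIntegral.integral_congr_uIoo (hE n (Finset.mem_range.mp hn)),
    intervalIntegral.integral_mul_const, mul_comm]

lemma aux_bdd_int {f : ℝ → ℝ} (hf : Measurable f) (hb : ∀ τ, f τ ∈ Set.Icc (-1:ℝ) 1) (a b : ℝ) :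
    IntervalIntegrable f volume a b := by
  refine (intervalIntegrable_const (c := (1:ℝ))).mono_fun hf.aestronglyMeasurable ?_
  refine Filter.Eventually.of_forall fun τ => ?_
  simpa [abs_le] using hb τ

lemma aux_xa (Δt : ℝ) (M : ℕ) (xr : ℕ → ℝ) (ξ : ℝ → ℝ) (j : ℕ) :
    xaVec Δt M xr ξ (j + 1) = -(1 / ((M : ℝ) * Δt - Δt)) *
      ∑ n ∈ Finset.Ico (j + 1 - M) j,
        xr (n + 1) * ∫ τ in ((n : ℝ) * Δt)..(((n + 1 : ℕ) : ℝ) * Δt), ξ τ := by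
  have hs : ∑ i ∈ Finset.Icc (j + 1 - M + 1) j,
        xr i * ∫ τ in (((i : ℝ) - 1) * Δt)..((i : ℝ) * Δt), ξ τ =
      ∑ n ∈ Finset.Ico (j + 1 - M) j,
        xr (n + 1) * ∫ τ in ((n : ℝ) * Δt)..(((n + 1 : ℕ) : ℝ) * Δt), ξ τ := by
    have : Finset.Icc (j + 1 - M + 1) j = Finset.Ico (j + 1 - M + 1) (j + 1) := by
      ext; simp
    rw [this, ← Finset.sum_Ico_add']
    refine Finset.sum_congr rfl fun n _ => ?_
    push_cast
    simp
  rw [← hs]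
  unfold xaVec
  split_ifs with h
  · have : j = 0 := by omega
    subst this
    simp
  · simp

/-- Power bound on the adjustments. -/
lemma aux_a {Δt : ℝ} (hΔt : 0 < Δt) {K M g : ℕ} (hM : 2 ≤ M) {xr : ℕ → ℝ}
    (hxr : ∀ k, 1 ≤ k → k ≤ K → 0 ≤ xr k) {ξ : ℝ → ℝ} (hξ : memXiSlide Δt K M g ξ)
    {k : ℕ} (hk : k < K) {l : ℝ} (hl : 0 ≤ l) :
    |xaVec Δt M xr ξ (k + 1)| ≤ ((g : ℝ) * Δt / Δt) * l +
      ∑ i ∈ Finset.Icc (k + 1 - M + 1) k,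
            max ((Δt / ((M : ℝ) * Δt - Δt)) * xr i - l) 0 := by
  obtain ⟨hm, hb, hw⟩ := hξ
  have hM' : (2:ℝ) ≤ M := by exact_mod_cast hM
  have hD : 0 < (M : ℝ) * Δt - Δt := by nlinarith
  have hint := aux_bdd_int hm hb
  have hs : Finset.Icc (k + 1 - M + 1) k = Finset.Ico (k + 1 - M + 1) (k + 1) := by
      ext; simp
  rw [hs, ← Finset.sum_Ico_add', aux_xa]
  set A : ℕ → ℝ := fun n => ∫ τ in ((n : ℝ) * Δt)..(((n + 1 : ℕ) : ℝ) * Δt), ξ τ with hA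
  have hstep : ∀ n : ℕ, (n : ℝ) * Δt ≤ ((n + 1 : ℕ) : ℝ) * Δt := by
    intro n; push_cast; nlinarith
  have hA1 : ∀ n, |A n| ≤ Δt := by
    intro n
    have := intervalIntegral.norm_integral_le_of_norm_le_const (f := ξ) (C := 1)
      (a := (n : ℝ) * Δt) (b := ((n + 1 : ℕ) : ℝ) * Δt)
      (fun x _ => by simpa [abs_le] using hb x)
    rw [Real.norm_eq_abs, abs_of_nonneg (by linarith [hstep n] : 0 ≤ ((n + 1 : ℕ) : ℝ) * Δt - n * Δt)] at this
    push_cast at this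
    have e : 1 * (((n:ℝ) + 1) * Δt - n * Δt) = Δt := by ring
    rw [e] at this
    simpa [hA] using this
  have hAs : ∑ n ∈ Finset.Ico (k + 1 - M) k, |A n| ≤ g * Δt := by
    have hle : k + 1 - M ≤ k := by omega
    have h1 : ∑ n ∈ Finset.Ico (k + 1 - M) k, |A n| ≤
        ∑ n ∈ Finset.Ico (k + 1 - M) k, ∫ τ in ((n : ℝ) * Δt)..(((n + 1 : ℕ) : ℝ) * Δt), |ξ τ| :=
      Finset.sum_le_sum fun n _ => intervalIntegral.abs_integral_le_integral_abs (hstep n)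
    have h2 := intervalIntegral.sum_integral_adjacent_intervals_Ico (f := fun τ => |ξ τ|)
      (μ := volume) (a := fun n : ℕ => (n : ℝ) * Δt) hle (fun n _ => (hint _ _).abs)
    have hkK : (k : ℝ) * Δt ≤ K * Δt := by
      have : (k : ℝ) ≤ K := by exact_mod_cast hk.le
      exact mul_le_mul_of_nonneg_right this hΔt.le
    have h3 := hw ((k : ℝ) * Δt) ⟨by positivity, hkK⟩
    have hlo : max ((k : ℝ) * Δt - M * Δt) 0 ≤ ((k + 1 - M : ℕ) : ℝ) * Δt := by
      apply max_le
      · have : (k : ℝ) ≤ ((k + 1 - M : ℕ) : ℝ) + M := by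
          exact_mod_cast (by omega : k ≤ (k + 1 - M) + M)
        nlinarith
      · positivity
    have h4 : ∫ τ in (((k + 1 - M : ℕ) : ℝ) * Δt)..((k : ℝ) * Δt), |ξ τ| ≤
        ∫ τ in (max ((k : ℝ) * Δt - M * Δt) 0)..((k : ℝ) * Δt), |ξ τ| := by
      refine intervalIntegral.integral_mono_interval hlo ?_ le_rfl ?_ (hint _ _).abs
      · have : ((k + 1 - M : ℕ) : ℝ) ≤ k := by exact_mod_cast hle
        exact mul_le_mul_of_nonneg_right this hΔt.le
      · exact Filter.Eventually.of_forall fun x => abs_nonneg _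
    linarith
  have hc : |-(1 / ((M : ℝ) * Δt - Δt))| = 1 / ((M : ℝ) * Δt - Δt) := by
    rw [abs_neg, abs_of_pos (by positivity)]
  rw [abs_mul, hc]
  have hterm : ∀ n ∈ Finset.Ico (k + 1 - M) k,
      1 / ((M : ℝ) * Δt - Δt) * |xr (n + 1) * A n| ≤
        l / Δt * |A n| + max ((Δt / ((M : ℝ) * Δt - Δt)) * xr (n + 1) - l) 0 := by
    intro n hn
    have hn' := Finset.mem_Ico.mp hn
    have hx := hxr (n + 1) (by omega) (by omega)
    rw [abs_mul, abs_of_nonneg hx]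
    set b := |A n| / Δt with hbdef
    have hAb : |A n| = b * Δt := by rw [hbdef]; field_simp
    have hb0 : 0 ≤ b := by positivity
    have hb1 : b ≤ 1 := by rw [hbdef, div_le_one hΔt]; exact hA1 n
    rw [hAb]
    have e1 : 1 / ((M : ℝ) * Δt - Δt) * (xr (n + 1) * (b * Δt)) =
      (Δt / ((M : ℝ) * Δt - Δt) * xr (n + 1)) * b := by ring
    have e2 : l / Δt * (b * Δt) = l * b := by field_simp
    rw [e1, e2]
    set q := Δt / ((M : ℝ) * Δt - Δt) * xr (n + 1)
    have := le_max_left (q - l) 0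
    have := le_max_right (q - l) 0
    nlinarith
  have hfin : 1 / ((M : ℝ) * Δt - Δt) * |∑ n ∈ Finset.Ico (k + 1 - M) k, xr (n + 1) * A n| ≤
      ∑ n ∈ Finset.Ico (k + 1 - M) k, (l / Δt * |A n| +
        max ((Δt / ((M : ℝ) * Δt - Δt)) * xr (n + 1) - l) 0) := by
    calc _ ≤ 1 / ((M : ℝ) * Δt - Δt) * ∑ n ∈ Finset.Ico (k + 1 - M) k, |xr (n + 1) * A n| :=
          mul_le_mul_of_nonneg_left (Finset.abs_sum_le_sum_abs _ _) (by positivity)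
      _ = ∑ n ∈ Finset.Ico (k + 1 - M) k, 1 / ((M : ℝ) * Δt - Δt) * |xr (n + 1) * A n| :=
          Finset.mul_sum _ _ _
      _ ≤ _ := Finset.sum_le_sum hterm
  rw [Finset.sum_add_distrib, ← Finset.mul_sum] at hfin
  refine hfin.trans (add_le_add ?_ le_rfl)
  calc l / Δt * ∑ n ∈ Finset.Ico (k + 1 - M) k, |A n| ≤ l / Δt * (g * Δt) :=
        mul_le_mul_of_nonneg_left hAs (by positivity)
    _ = _ := by ring

/-- Reduction of the state of charge with adjustments to a signal of small total budget. -/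
lemma aux_b {Δt : ℝ} (hΔt : 0 < Δt) {K M g : ℕ} (hM : 2 ≤ M) (x0 xr : ℕ → ℝ)
    {ξ : ℝ → ℝ} (hξ : memXiSlide Δt K M g ξ) {t : ℝ} (ht : t ∈ Set.Icc (0:ℝ) ((K : ℝ) * Δt)) :
    ∃ ξ' : ℝ → ℝ, Measurable ξ' ∧ (∀ τ, ξ' τ ∈ Set.Icc (-1:ℝ) 1) ∧
      (∫ τ in (0:ℝ)..((K : ℝ) * Δt), |ξ' τ|) ≤ (g : ℝ) * Δt ∧
      ∫ τ in (0:ℝ)..t,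
        (pcFun Δt K x0 τ + pcFun Δt K (xaVec Δt M xr ξ) τ + ξ τ * pcFun Δt K xr τ) =
      ∫ τ in (0:ℝ)..t, (pcFun Δt K x0 τ + ξ' τ * pcFun Δt K xr τ) := by
  obtain ⟨hm, hb, hw⟩ := hξ
  have ht0 := ht.1
  have htK := ht.2
  have hM' : (2:ℝ) ≤ M := by exact_mod_cast hM
  have hD : 0 < (M : ℝ) * Δt - Δt := by nlinarith
  have hint := aux_bdd_int hm hb
  set c : ℝ := 1 / ((M : ℝ) * Δt - Δt) with hc
  have hc0 : 0 < c := by positivity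
  set L : ℕ → ℝ := fun n => min (((n + 1 : ℕ) : ℝ) * Δt) t - min ((n : ℝ) * Δt) t with hL
  have hsucc : ∀ n : ℕ, ((n + 1 : ℕ) : ℝ) * Δt = (n : ℝ) * Δt + Δt := by
    intro n; push_cast; ring
  have hmul : ∀ {m n : ℕ}, m ≤ n → (m : ℝ) * Δt ≤ (n : ℝ) * Δt := by
    intro m n h
    exact mul_le_mul_of_nonneg_right (by exact_mod_cast h) hΔt.le
  have hL0 : ∀ n, 0 ≤ L n := by
    intro n
    simp only [hL]
    rw [hsucc]
    have := min_le_min_right t (by linarith : (n : ℝ) * Δt ≤ (n : ℝ) * Δt + Δt)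
    linarith
  have hL1 : ∀ n, L n ≤ Δt := by
    intro n
    simp only [hL]
    rw [hsucc]
    rcases le_total ((n : ℝ) * Δt) t with h | h
    · rw [min_eq_left h]
      linarith [min_le_left ((n : ℝ) * Δt + Δt) t]
    · rw [min_eq_right h]
      linarith [min_le_right ((n : ℝ) * Δt + Δt) t]
  have hLz : ∀ n : ℕ, t ≤ (n : ℝ) * Δt → L n = 0 := by
    intro n h
    simp only [hL]
    rw [hsucc, min_eq_right h, min_eq_right (by linarith), sub_self]
  have hLf : ∀ n : ℕ, ((n + 1 : ℕ) : ℝ) * Δt ≤ t → L n = Δt := by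
    intro n h
    simp only [hL]
    rw [min_eq_left h, hsucc, min_eq_left (by rw [hsucc] at h; linarith)]
    ring
  set S : ℕ → ℝ := fun n => ∑ j ∈ Finset.Ico (n + 1) (n + M), L j with hS
  have hcard : ∀ n : ℕ, ∑ j ∈ Finset.Ico (n + 1) (n + M), Δt = (M : ℝ) * Δt - Δt := by
    intro n
    rw [Finset.sum_const, Nat.card_Ico, nsmul_eq_mul]
    have : ((n + M - (n + 1) : ℕ) : ℝ) = (M : ℝ) - 1 := by
      have e : n + M - (n + 1) = M - 1 := by omega
      rw [e, Nat.cast_sub (by omega)]; simp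
    rw [this]; ring
  have hcD : c * ((M : ℝ) * Δt - Δt) = 1 := by
    rw [hc]; exact one_div_mul_cancel hD.ne'
  have hS0 : ∀ n, 0 ≤ c * S n := fun n =>
    mul_nonneg hc0.le (Finset.sum_nonneg fun j _ => hL0 j)
  have hS1 : ∀ n, c * S n ≤ 1 := by
    intro n
    rw [← hcD, ← hcard n]
    exact mul_le_mul_of_nonneg_left (Finset.sum_le_sum fun j _ => hL1 j) hc0.le
  have hSf : ∀ n : ℕ, ((n + M : ℕ) : ℝ) * Δt ≤ t → c * S n = 1 := by
    intro n h
    rw [← hcD, ← hcard n]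
    congr 1
    refine Finset.sum_congr rfl fun j hj => hLf j ?_
    exact (hmul (by have := Finset.mem_Ico.mp hj; omega)).trans h
  have hSz : ∀ n : ℕ, t ≤ ((n + 1 : ℕ) : ℝ) * Δt → S n = 0 := by
    intro n h
    refine Finset.sum_eq_zero fun j hj => hLz j ?_
    exact h.trans (hmul (by have := Finset.mem_Ico.mp hj; omega))
  set w : ℕ → ℝ := fun i => 1 - c * S (i - 1) with hwdef
  have hw1 : ∀ i, w i ∈ Set.Icc (0:ℝ) 1 := fun i =>
    ⟨by simp only [hwdef]; linarith [hS1 (i - 1)], by simp only [hwdef]; linarith [hS0 (i - 1)]⟩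
  have hpw : ∀ τ, pcFun Δt K w τ ∈ Set.Icc (0:ℝ) 1 := by
    intro τ
    unfold pcFun
    split_ifs
    · exact hw1 _
    · simp
  set ξ' : ℝ → ℝ := fun τ => if τ ≤ t then ξ τ * pcFun Δt K w τ else 0 with hξ'
  have hm' : Measurable ξ' :=
    Measurable.ite measurableSet_Iic (hm.mul (aux_pc_meas Δt K w)) measurable_const
  have habs : ∀ τ, |ξ' τ| ≤ |ξ τ| := by
    intro τ
    simp only [hξ']
    split_ifs
    · rw [abs_mul, abs_of_nonneg (hpw τ).1]
      exact mul_le_of_le_one_right (abs_nonneg _) (hpw τ).2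
    · simp
  have hb' : ∀ τ, ξ' τ ∈ Set.Icc (-1:ℝ) 1 := by
    intro τ
    have h1 := habs τ
    have h2 : |ξ τ| ≤ 1 := abs_le.mpr (hb τ)
    exact abs_le.mp (h1.trans h2)
  have hint' := aux_bdd_int hm' hb'
  refine ⟨ξ', hm', hb', ?_, ?_⟩
  · set s := max (t - (M : ℝ) * Δt) 0 with hs
    have hs0 : 0 ≤ s := le_max_right _ _
    have hst : s ≤ t := max_le (by nlinarith) ht0
    have e1 : ∫ τ in (0:ℝ)..s, |ξ' τ| = 0 := by
      rw [intervalIntegral.integral_congr_Ioo_of_le (g := fun _ => (0:ℝ)) hs0]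
      · simp
      · intro τ hτ
        obtain ⟨h0, h1⟩ := hτ
        obtain ⟨n, hn, hn1, hn2⟩ := aux_pc_exists hΔt (K := K) h0.le (by linarith)
        have hlt : τ < t - (M : ℝ) * Δt := by
          rcases lt_max_iff.mp h1 with h | h
          · exact h
          · linarith
        have : pcFun Δt K w τ = 0 := by
          rw [aux_pc_eq hΔt w hn hn1 hn2]
          simp only [hwdef, Nat.add_sub_cancel]
          rw [hSf n (by push_cast; linarith), sub_self]
        simp [hξ', this]
    have e2 : ∫ τ in t..((K : ℝ) * Δt), |ξ' τ| = 0 := by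
      rw [intervalIntegral.integral_congr_Ioo_of_le (g := fun _ => (0:ℝ)) htK]
      · simp
      · intro τ hτ
        simp [hξ', not_le.mpr hτ.1]
    have e3 : ∫ τ in s..t, |ξ' τ| ≤ ∫ τ in s..t, |ξ τ| :=
      intervalIntegral.integral_mono_on hst (hint' _ _).abs (hint _ _).abs fun τ _ => habs τ
    rw [← intervalIntegral.integral_add_adjacent_intervals (b := t) (hint' _ _).abs (hint' _ _).abs,
      ← intervalIntegral.integral_add_adjacent_intervals (b := s) (hint' _ _).abs (hint' _ _).abs,
      e1, e2]
    have := hw t ht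
    linarith
  · have hone : ∀ a b : ℝ, IntervalIntegrable (fun _ : ℝ => (1:ℝ)) volume a b :=
      fun a b => intervalIntegrable_const
    obtain ⟨i0, -⟩ := aux_pc_int hΔt x0 _ hone ht
    obtain ⟨ia, ea⟩ := aux_pc_int hΔt (xaVec Δt M xr ξ) _ hone ht
    obtain ⟨ir, er⟩ := aux_pc_int hΔt xr ξ hint ht
    obtain ⟨ir', -⟩ := aux_pc_int hΔt xr ξ' hint' ht
    obtain ⟨iw, ew⟩ := aux_pc_int hΔt (fun i => w i * xr i) ξ hint ht
    simp only [one_mul] at i0 ia ea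
    rw [intervalIntegral.integral_add (i0.add ia) ir, intervalIntegral.integral_add i0 ia,
      intervalIntegral.integral_add i0 ir', add_assoc]
    congr 1
    have hpm : ∫ τ in (0:ℝ)..t, ξ' τ * pcFun Δt K xr τ =
        ∫ τ in (0:ℝ)..t, ξ τ * pcFun Δt K (fun i => w i * xr i) τ := by
      refine intervalIntegral.integral_congr_Ioo_of_le ht0 fun τ hτ => ?_
      simp only [hξ', if_pos hτ.2.le]
      unfold pcFun
      split_ifs <;> ring
    rw [hpm, ea, er, ew]
    simp only [intervalIntegral.integral_const, smul_eq_mul, mul_one]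
    set A : ℕ → ℝ := fun n => ∫ τ in ((n : ℝ) * Δt)..(((n + 1 : ℕ) : ℝ) * Δt), ξ τ with hA
    set B : ℕ → ℝ := fun n =>
      ∫ τ in (min ((n : ℝ) * Δt) t)..(min (((n + 1 : ℕ) : ℝ) * Δt) t), ξ τ with hB
    have hSB : ∀ n, S n * B n = S n * A n := by
      intro n
      rcases le_total t (((n + 1 : ℕ) : ℝ) * Δt) with h | h
      · rw [hSz n h]; simp
      · simp only [hA, hB]
        rw [min_eq_left h, min_eq_left ((hmul (Nat.le_succ n)).trans h)]
    have hswap : ∑ n ∈ Finset.range K, xaVec Δt M xr ξ (n + 1) * L n =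
        - ∑ n ∈ Finset.range K, c * S n * (xr (n + 1) * B n) := by
      have l1 : ∑ n ∈ Finset.range K, xaVec Δt M xr ξ (n + 1) * L n =
          ∑ j ∈ Finset.range K, ∑ n ∈ Finset.Ico (j + 1 - M) j,
            -c * (xr (n + 1) * A n) * L j := by
        refine Finset.sum_congr rfl fun j _ => ?_
        rw [aux_xa, Finset.mul_sum, Finset.sum_mul]
      have l2 : ∑ n ∈ Finset.range K, c * S n * (xr (n + 1) * B n) =
          ∑ n ∈ Finset.range K, ∑ j ∈ (Finset.Ico (n + 1) (n + M)).filter (· < K),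
            c * (xr (n + 1) * A n) * L j := by
        refine Finset.sum_congr rfl fun n _ => ?_
        have e : S n = ∑ j ∈ (Finset.Ico (n + 1) (n + M)).filter (· < K), L j := by
          simp only [hS]
          symm
          refine Finset.sum_subset (Finset.filter_subset _ _) fun j hj hj' => hLz j ?_
          have : K ≤ j := by
            by_contra hcon
            exact hj' (Finset.mem_filter.mpr ⟨hj, not_le.mp hcon⟩)
          exact htK.trans (hmul this)
        rw [← Finset.mul_sum, ← e]
        linear_combination c * xr (n + 1) * hSB n
      rw [l1, l2, ← Finset.sum_neg_distrib]
      simp only [← Finset.sum_neg_distrib]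
      rw [Finset.sum_comm' (s' := fun n => (Finset.Ico (n + 1) (n + M)).filter (· < K))
        (t' := Finset.range K)]
      · refine Finset.sum_congr rfl fun n _ => Finset.sum_congr rfl fun j _ => ?_
        ring
      · intro x y
        simp only [Finset.mem_range, Finset.mem_Ico, Finset.mem_filter]
        omega
    have hswap' := hswap
    simp only [hL] at hswap'
    rw [hswap', ← Finset.sum_neg_distrib, ← Finset.sum_add_distrib]
    refine Finset.sum_congr rfl fun n _ => ?_
    simp only [hwdef, Nat.add_sub_cancel]
    ring

/-- Proposition 10: with lossless storage, if the tightened power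
bounds hold for some multiplier vector `λ ≥ 0` and the state-of-charge bounds hold
robustly over the smaller budget-`γ′` uncertainty set, then for every signal in the
sliding-window set `Ξ′` the intraday adjustments keep both the power output and the
state of charge within their bounds. -/
theorem statement18 (Δt : ℝ) (hΔt : 0 < Δt) (K : ℕ) (hK : 0 < K)
    (M g : ℕ) (hM : 2 ≤ M) (hg1 : 1 ≤ g) (hgM : g ≤ M)
    (xlb xub : ℝ) (hxlb : xlb ≤ 0) (hxub : 0 ≤ xub)
    (ylb yub : ℝ) (hy : ylb ≤ yub) (y0 : ℝ)
    (x0 xr : ℕ → ℝ) (hxr : ∀ k, 1 ≤ k → k ≤ K → 0 ≤ xr k)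
    -- (i) power bounds in the first trading interval
    (h1 : xlb ≤ x0 1 - xr 1 ∧ x0 1 + xr 1 ≤ xub)
    -- (ii) tightened power bounds for the later trading intervals
    (h2 : ∃ lam : ℕ → ℝ, (∀ k, 0 ≤ lam k) ∧
      ∀ k, 1 ≤ k → k < K →
        (xlb ≤ x0 (k + 1) - xr (k + 1) - ((g : ℝ) * Δt / Δt) * lam k -
          ∑ i ∈ Finset.Icc (k + 1 - M + 1) k,
            max ((Δt / ((M : ℝ) * Δt - Δt)) * xr i - lam k) 0) ∧
        (x0 (k + 1) + xr (k + 1) + ((g : ℝ) * Δt / Δt) * lam k +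
          ∑ i ∈ Finset.Icc (k + 1 - M + 1) k,
            max ((Δt / ((M : ℝ) * Δt - Δt)) * xr i - lam k) 0 ≤ xub))
    -- (iii) robust state-of-charge bounds over the budget-γ′ uncertainty set
    (h3 : ∀ ξ' : ℝ → ℝ, Measurable ξ' → (∀ τ, ξ' τ ∈ Set.Icc (-1:ℝ) 1) →
      (∫ τ in (0:ℝ)..((K : ℝ) * Δt), |ξ' τ|) ≤ (g : ℝ) * Δt →
      ∀ t ∈ Set.Icc (0:ℝ) ((K : ℝ) * Δt),
        ylb ≤ y0 - ∫ τ in (0:ℝ)..t, (pcFun Δt K x0 τ + ξ' τ * pcFun Δt K xr τ) ∧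
        y0 - ∫ τ in (0:ℝ)..t, (pcFun Δt K x0 τ + ξ' τ * pcFun Δt K xr τ) ≤ yub) :
    ∀ ξ : ℝ → ℝ, memXiSlide Δt K M g ξ →
      -- (a) power bounds with intraday adjustments
      (∀ k, 1 ≤ k → k ≤ K →
        xlb ≤ x0 k + xaVec Δt M xr ξ k - xr k ∧
        x0 k + xaVec Δt M xr ξ k + xr k ≤ xub) ∧
      -- (b) state-of-charge bounds with intraday adjustments
      (∀ t ∈ Set.Icc (0:ℝ) ((K : ℝ) * Δt),
        ylb ≤ y0 - ∫ τ in (0:ℝ)..t,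
          (pcFun Δt K x0 τ + pcFun Δt K (xaVec Δt M xr ξ) τ + ξ τ * pcFun Δt K xr τ) ∧
        y0 - ∫ τ in (0:ℝ)..t,
          (pcFun Δt K x0 τ + pcFun Δt K (xaVec Δt M xr ξ) τ + ξ τ * pcFun Δt K xr τ) ≤ yub) := by
  intro ξ hξ
  refine ⟨?_, ?_⟩
  · intro k hk1 hkK
    obtain ⟨lam, hlam, h2⟩ := h2
    rcases Nat.lt_or_ge 1 k with h | h
    · obtain ⟨m, rfl⟩ : ∃ m, k = m + 1 := ⟨k - 1, by omega⟩
      have ha := abs_le.mp (aux_a hΔt hM hxr hξ (k := m) (by omega) (hlam m))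
      have := h2 m (by omega) (by omega)
      constructor
      · linarith [this.1, ha.1]
      · linarith [this.2, ha.2]
    · obtain rfl : k = 1 := by omega
      have : xaVec Δt M xr ξ 1 = 0 := by simp [xaVec]
      rw [this]
      simpa using h1
  · intro t ht
    obtain ⟨ξ', hm', hb', hbud, heq⟩ := aux_b hΔt hM x0 xr hξ ht
    rw [heq]
    exact h3 ξ' hm' hb' hbud t ht
end
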